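/- Assume U and g are real-analytic, let s ≥ 1, and let (q, p) : [0,T] → ℝ^m × ℝ^m solve the constrained system (q̇ = M⁻¹p, ṗ = −∇U(q) − ∇g(q)·λ(q,p), g(q(t)) = 0) with consistent initial data and with ∇g(q(t))ᵀM⁻¹∇g(q(t)) nonsingular on [0,T]. Then there exist h₀ > 0 and C > 0 such that for every N ∈ ℕ with h := T/N ≤ h₀ there exist (q_n, p_n)_{n=0,…,N} with q_0 = q(0), p_0 = p(0), multipliers (λ_n)_{n=0,…,N−1} ⊂ ℝ^ν, and pairs of polynomials (u_n, v_n) of degree at most s on [0,h] satisfying u_n(0) = q_n, v_n(0) = p_n, u̇_n(ch) = Σ_{j=0}^{s−1} P̂_j(c)·γ_j(v_n), v̇_n(ch) = −Σ_{j=0}^{s−1} P̂_j(c)·[ψ_j(u_n) + ρ_j(u_n)λ_n] for c ∈ [0,1], and q_{n+1} = u_n(h), p_{n+1} = v_n(h), such that for all n: g(q_n) = 0, H(q_n, p_n) = H(q_0, p_0), ‖q_n − q(nh)‖ ≤ C·h², ‖p_n − p(nh)‖ ≤ C·h², ‖∇g(q_n)ᵀM⁻¹p_n‖ ≤ C·h²,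 and ‖λ_n − λ(q(nh), p(nh))‖ ≤ C·h. Here γ_j(w) := M⁻¹∫₀¹ P̂_j(c)·w(ch) dc, ψ_j(w) := ∫₀¹ P̂_j(c)·∇U(w(ch)) dc, ρ_j(w) := ∫₀¹ P̂_j(c)·∇g(w(ch)) dc. -/

import Mathlib

open MeasureTheory Matrix Set

noncomputable def grad {m : ℕ} (f : (Fin m → ℝ) → ℝ) (q : Fin m → ℝ) : Fin m → ℝ :=
  fun i => fderiv ℝ f q (Pi.single i 1)

noncomputable def gradMat {m ν : ℕ} (g : (Fin m → ℝ) → (Fin ν → ℝ)) (q : Fin m → ℝ) :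
    Matrix (Fin m) (Fin ν) ℝ :=
  Matrix.of fun i a => fderiv ℝ (fun x => g x a) q (Pi.single i 1)

noncomputable def hessVec {m ν : ℕ} (g : (Fin m → ℝ) → (Fin ν → ℝ)) (q v w : Fin m → ℝ) :
    Fin ν → ℝ :=
  fun a => fderiv ℝ (fun x => fderiv ℝ (fun y => g y a) x w) q v

noncomputable def lagMult {m ν : ℕ} (M : Matrix (Fin m) (Fin m) ℝ)
    (U : (Fin m → ℝ) → ℝ) (g : (Fin m → ℝ) → (Fin ν → ℝ)) (q p : Fin m → ℝ) : Fin ν → ℝ :=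
  ((gradMat g q)ᵀ * M⁻¹ * gradMat g q)⁻¹ *ᵥ
    (hessVec g q (M⁻¹ *ᵥ p) (M⁻¹ *ᵥ p) - (gradMat g q)ᵀ *ᵥ (M⁻¹ *ᵥ grad U q))

noncomputable def Ham {m : ℕ} (M : Matrix (Fin m) (Fin m) ℝ)
    (U : (Fin m → ℝ) → ℝ) (q p : Fin m → ℝ) : ℝ :=
  (1 / 2) * (p ⬝ᵥ (M⁻¹ *ᵥ p)) + U q

noncomputable def HamHat {m ν : ℕ} (M : Matrix (Fin m) (Fin m) ℝ)
    (U : (Fin m → ℝ) → ℝ) (g : (Fin m → ℝ) → (Fin ν → ℝ))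
    (q p : Fin m → ℝ) (lam : Fin ν → ℝ) : ℝ :=
  Ham M U q p + lam ⬝ᵥ g q

noncomputable def shiftedLegendre (j : ℕ) (x : ℝ) : ℝ :=
  (Real.sqrt (2 * j + 1) / (Nat.factorial j)) * iteratedDeriv j (fun y => (y ^ 2 - y) ^ j) x

noncomputable def gammaC {m : ℕ} (M : Matrix (Fin m) (Fin m) ℝ)
    (h : ℝ) (v : ℝ → Fin m → ℝ) (j : ℕ) : Fin m → ℝ :=
  M⁻¹ *ᵥ ∫ c in (0:ℝ)..1, shiftedLegendre j c • v (c * h)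

noncomputable def psiC {m : ℕ} (U : (Fin m → ℝ) → ℝ)
    (h : ℝ) (u : ℝ → Fin m → ℝ) (j : ℕ) : Fin m → ℝ :=
  ∫ c in (0:ℝ)..1, shiftedLegendre j c • grad U (u (c * h))

noncomputable def rhoC {m ν : ℕ} (g : (Fin m → ℝ) → (Fin ν → ℝ))
    (h : ℝ) (u : ℝ → Fin m → ℝ) (j : ℕ) : Matrix (Fin m) (Fin ν) ℝ :=
  Matrix.of fun i a => ∫ c in (0:ℝ)..1, shiftedLegendre j c * gradMat g (u (c * h)) i a


open MeasureTheory Matrix Set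
open scoped ContDiff Topology
open Asymptotics Filter

section Toolbox
variable {Ω : Type*} {l : Filter Ω}
  {E F : Type*} [NormedAddCommGroup E] [NormedSpace ℝ E] [ProperSpace E]
  [NormedAddCommGroup F] [NormedSpace ℝ F]

theorem ball_smooth (Φ : E → F) (hΦ : ContDiff ℝ ∞ Φ) (R : ℝ) :
    ∃ C : ℝ, ∀ x y : E, ‖x‖ ≤ R → ‖y‖ ≤ R → ‖Φ x‖ ≤ C ∧ ‖Φ y - Φ x‖ ≤ C * ‖y - x‖ := by
  have hK : IsCompact (Metric.closedBall (0 : E) R) := isCompact_closedBall 0 R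
  obtain ⟨C1, h1⟩ := hK.exists_bound_of_continuousOn hΦ.continuous.continuousOn
  have hd : Continuous (fderiv ℝ Φ) := hΦ.continuous_fderiv (by simp)
  obtain ⟨C2, h2⟩ := hK.exists_bound_of_continuousOn hd.continuousOn
  refine ⟨max C1 C2, fun x y hx hy => ⟨(h1 x (by simpa using hx)).trans (le_max_left _ _), ?_⟩⟩
  have := (convex_closedBall (0 : E) R).norm_image_sub_le_of_norm_fderiv_le (f := Φ) (𝕜 := ℝ)
    (fun z _ => (hΦ.differentiable (by simp)).differentiableAt) h2
    (by simpa using hx : x ∈ _) (by simpa using hy : y ∈ _)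
  exact this.trans (by gcongr; exact le_max_right _ _)

theorem bigO_bdd {Φ : E → F} (hΦ : ContDiff ℝ ∞ Φ) {x : Ω → E}
    (hx : x =O[l] (fun _ => (1 : ℝ))) : (fun o => Φ (x o)) =O[l] (fun _ => (1 : ℝ)) := by
  obtain ⟨R, hR⟩ := hx.bound
  obtain ⟨C, hC⟩ := ball_smooth Φ hΦ R
  refine IsBigO.of_bound C ?_
  filter_upwards [hR] with o h1
  have h1' : ‖x o‖ ≤ R := by simpa using h1
  simpa using (hC _ _ h1' h1').1

theorem bigO_lip {Φ : E → F} (hΦ : ContDiff ℝ ∞ Φ) {x y : Ω → E}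
    (hx : x =O[l] (fun _ => (1 : ℝ))) (hy : y =O[l] (fun _ => (1 : ℝ))) :
    (fun o => Φ (y o) - Φ (x o)) =O[l] (fun o => y o - x o) := by
  obtain ⟨R, hR⟩ := hx.bound
  obtain ⟨R', hR'⟩ := hy.bound
  obtain ⟨C, hC⟩ := ball_smooth Φ hΦ (max R R')
  refine IsBigO.of_bound C ?_
  filter_upwards [hR, hR'] with o h1 h2
  have h1' : ‖x o‖ ≤ R := by simpa using h1
  have h2' : ‖y o‖ ≤ R' := by simpa using h2
  exact (hC _ _ (h1'.trans (le_max_left _ _)) (h2'.trans (le_max_right _ _))).2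

theorem bigO_taylor {Φ : E → F} (hΦ : ContDiff ℝ ∞ Φ) {x y : Ω → E}
    (hx : x =O[l] (fun _ => (1 : ℝ))) (hy : y =O[l] (fun _ => (1 : ℝ))) :
    (fun o => Φ (y o) - Φ (x o) - fderiv ℝ Φ (x o) (y o - x o)) =O[l]
      (fun o => ‖y o - x o‖ ^ 2) := by
  obtain ⟨R, hR⟩ := hx.bound
  obtain ⟨R', hR'⟩ := hy.bound
  have hd : ContDiff ℝ ∞ (fderiv ℝ Φ) := hΦ.fderiv_right (by simp)
  obtain ⟨C, hC⟩ := ball_smooth _ hd (max R R')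
  refine IsBigO.of_bound C ?_
  filter_upwards [hR, hR'] with o h1 h2
  have h1' : ‖x o‖ ≤ max R R' := le_trans (by simpa using h1) (le_max_left _ _)
  have h2' : ‖y o‖ ≤ max R R' := le_trans (by simpa using h2) (le_max_right _ _)
  have hseg : segment ℝ (x o) (y o) ⊆ Metric.closedBall (0 : E) (max R R') :=
    (convex_closedBall (0 : E) _).segment_subset (by simpa using h1') (by simpa using h2')
  have hC0 : 0 ≤ C := (norm_nonneg _).trans (hC _ _ h1' h1').1
  have := (convex_segment (x o) (y o)).norm_image_sub_le_of_norm_fderiv_le' (f := Φ) (𝕜 := ℝ)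
    (φ := fderiv ℝ Φ (x o)) (C := C * ‖y o - x o‖)
    (fun z _ => (hΦ.differentiable (by simp)).differentiableAt) (by
      intro z hz
      refine (hC _ _ h1' (by simpa using hseg hz)).2.trans ?_
      gcongr
      simpa [dist_eq_norm, norm_sub_rev] using norm_sub_le_of_mem_segment hz) 
    (left_mem_segment ℝ _ _) (right_mem_segment ℝ _ _)
  rw [norm_pow, norm_norm]
  calc _ ≤ _ := this
    _ = _ := by ring

theorem bigO_clm {E F : Type*} [NormedAddCommGroup E] [NormedSpace ℝ E]
    [NormedAddCommGroup F] [NormedSpace ℝ F] {A : Ω → E →L[ℝ] F} {x : Ω → E} {a b : Ω → ℝ}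
    (hA : A =O[l] a) (hx : x =O[l] b) : (fun o => A o (x o)) =O[l] (fun o => a o * b o) := by
  have h1 : (fun o => A o (x o)) =O[l] (fun o => ‖A o‖ * ‖x o‖) :=
    IsBigO.of_bound 1 (by
      filter_upwards with o
      simpa using (A o).le_opNorm (x o))
  exact h1.trans (hA.norm_left.mul hx.norm_left)

theorem bigO_clm' {E F : Type*} [NormedAddCommGroup E] [NormedSpace ℝ E]
    [NormedAddCommGroup F] [NormedSpace ℝ F] (A : E →L[ℝ] F) {x : Ω → E} {b : Ω → ℝ}
    (hx : x =O[l] b) : (fun o => A (x o)) =O[l] b :=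
  (A.isBigO_comp x l).trans hx

theorem bigO_integral [CompleteSpace F] {P : ℝ → ℝ} (hP : Continuous P) {Φ : Ω → ℝ → F} {b : Ω → ℝ}
    (hΦ : (fun z : Ω × ℝ => Φ z.1 z.2) =O[l ×ˢ 𝓟 (Icc (0 : ℝ) 1)] (fun z => b z.1)) :
    (fun o => ∫ c in (0 : ℝ)..1, P c • Φ o c) =O[l] b := by
  obtain ⟨C, hC⟩ := hΦ.bound
  obtain ⟨D, hD⟩ := (isCompact_Icc (a := (0 : ℝ)) (b := 1)).exists_bound_of_continuousOn
    hP.continuousOn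
  have hD0 : 0 ≤ D := (norm_nonneg _).trans (hD 0 (by simp))
  rw [Filter.eventually_prod_principal_iff] at hC
  refine IsBigO.of_bound (D * C) ?_
  filter_upwards [hC] with o h
  have := intervalIntegral.norm_integral_le_of_norm_le_const (a := (0 : ℝ)) (b := 1)
    (C := D * (C * ‖b o‖)) (f := fun c => P c • Φ o c) (by
      intro c hc
      rw [uIoc_of_le zero_le_one] at hc
      have hc' : c ∈ Icc (0 : ℝ) 1 := ⟨hc.1.le, hc.2⟩
      rw [norm_smul]
      exact mul_le_mul (hD c hc') (h c hc') (norm_nonneg _) hD0)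
  simpa [mul_assoc] using this

end Toolbox

open MeasureTheory Matrix Set
open scoped ContDiff Topology
open Asymptotics Filter

section Trap
variable {V L : Type*} [NormedAddCommGroup V] [NormedSpace ℝ V] [ProperSpace V]
  [NormedAddCommGroup L] [NormedSpace ℝ L]

theorem mvt_bound {W : Type*} [NormedAddCommGroup W] [NormedSpace ℝ W] {φ φ' : ℝ → W} {h C : ℝ}
    (hd : ∀ τ ∈ Icc 0 h, HasDerivAt φ (φ' τ) τ) (h0 : φ 0 = 0)
    (hb : ∀ τ ∈ Icc 0 h, ‖φ' τ‖ ≤ C) : ∀ τ ∈ Icc 0 h, ‖φ τ‖ ≤ C * τ := by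
  intro τ hτ
  have := norm_image_sub_le_of_norm_deriv_le_segment' (f := φ) (f' := φ') (a := 0) (b := h)
    (C := C) (fun x hx => (hd x hx).hasDerivWithinAt) (fun x hx => hb x ⟨hx.1, hx.2.le⟩) τ hτ
  simpa [h0] using this

set_option maxSynthPendingDepth 3 in
theorem trap_ball (g : V → L) (hg : ContDiff ℝ ∞ g) (R : ℝ) :
    ∃ C : ℝ, ∀ (x a : V) (h : ℝ), ‖x‖ ≤ R → ‖a‖ ≤ R → 0 ≤ h → h ≤ R →
      ‖(h / 2) • (fderiv ℝ g x a + fderiv ℝ g (x + h • a) a) - (g (x + h • a) - g x)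
        - (h ^ 3 / 12) • (fderiv ℝ (fderiv ℝ (fderiv ℝ g)) x a a a)‖ ≤ C * h ^ 4 := by
  have h1 : ContDiff ℝ ∞ (fderiv ℝ g) := hg.fderiv_right (by simp)
  have h2 : ContDiff ℝ ∞ (fderiv ℝ (fderiv ℝ g)) := h1.fderiv_right (by simp)
  have h3 : ContDiff ℝ ∞ (fderiv ℝ (fderiv ℝ (fderiv ℝ g))) := h2.fderiv_right (by simp)
  obtain ⟨C, hC⟩ := ball_smooth (fun z : V × V => fderiv ℝ (fderiv ℝ (fderiv ℝ g)) z.1 z.2 z.2 z.2)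
    (by fun_prop) (R + R * R)
  refine ⟨C * R, fun x a h hx ha h0 hR => ?_⟩
  have hR0 : 0 ≤ R := (norm_nonneg _).trans hx
  have hline : ∀ τ : ℝ, HasDerivAt (fun τ : ℝ => x + τ • a) a τ := fun τ => by
    simpa using ((hasDerivAt_id τ).smul_const a).const_add x
  have d0 : ∀ τ : ℝ, HasDerivAt (fun τ : ℝ => g (x + τ • a)) (fderiv ℝ g (x + τ • a) a) τ :=
    fun τ => ((hg.differentiable (by simp)).differentiableAt.hasFDerivAt).comp_hasDerivAt τ (hline τ)
  have d1 : ∀ τ : ℝ, HasDerivAt (fun τ : ℝ => fderiv ℝ g (x + τ • a) a)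
      (fderiv ℝ (fderiv ℝ g) (x + τ • a) a a) τ := fun τ => by
    have := ((h1.differentiable (by simp)).differentiableAt.hasFDerivAt).comp_hasDerivAt τ (hline τ)
    simpa using this.clm_apply (hasDerivAt_const τ a)
  have d2 : ∀ τ : ℝ, HasDerivAt (fun τ : ℝ => fderiv ℝ (fderiv ℝ g) (x + τ • a) a a)
      (fderiv ℝ (fderiv ℝ (fderiv ℝ g)) (x + τ • a) a a a) τ := fun τ => by
    have := ((h2.differentiable (by simp)).differentiableAt.hasFDerivAt).comp_hasDerivAt τ (hline τ)
    simpa using (this.clm_apply (hasDerivAt_const τ a)).clm_apply (hasDerivAt_const τ a)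
  set k3 := fderiv ℝ (fderiv ℝ (fderiv ℝ g)) x a a a with hk3
  have e2 : ∀ τ ∈ Icc 0 h, ‖(τ / 2) • (fderiv ℝ (fderiv ℝ (fderiv ℝ g)) (x + τ • a) a a a - k3)‖
      ≤ C * R * h ^ 2 := by
    intro τ hτ
    have hxa : ‖x + τ • a‖ ≤ R + R * R := by
      refine (norm_add_le _ _).trans ?_
      rw [norm_smul, Real.norm_of_nonneg hτ.1]
      gcongr
      exact hτ.2.trans hR
    have hb := (hC (x, a) (x + τ • a, a) (by
      simp only [Prod.norm_mk]; exact max_le (by nlinarith) (by nlinarith)) (by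
      simp only [Prod.norm_mk]; exact max_le hxa (by nlinarith)))
    have hC0 : 0 ≤ C := (norm_nonneg _).trans hb.1
    have hb2 := hb.2
    have e : ‖((x + τ • a, a) : V × V) - (x, a)‖ = τ * ‖a‖ := by
      simp [Prod.norm_mk, norm_smul, abs_of_nonneg hτ.1, mul_nonneg hτ.1]
    rw [e] at hb2
    rw [norm_smul, Real.norm_of_nonneg (by linarith [hτ.1])]
    calc τ / 2 * _ ≤ τ / 2 * (C * (τ * ‖a‖)) := by
            gcongr
            linarith [hτ.1]
      _ ≤ h * (C * (h * R)) := by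
            have := hτ.2
            have := hτ.1
            gcongr
            linarith
      _ = _ := by ring
  have e1 := mvt_bound (h := h) (φ := fun τ => (1 / 2 : ℝ) • (fderiv ℝ g x a - fderiv ℝ g (x + τ • a) a
      + τ • fderiv ℝ (fderiv ℝ g) (x + τ • a) a a) - (τ ^ 2 / 4) • k3) (φ' := fun τ =>
      (τ / 2) • (fderiv ℝ (fderiv ℝ (fderiv ℝ g)) (x + τ • a) a a a - k3)) (by
      intro τ _
      have := ((((d1 τ).const_sub (fderiv ℝ g x a)).add ((hasDerivAt_id τ).smul (d2 τ))).const_smul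
        (1 / 2 : ℝ)).sub ((((hasDerivAt_id τ).pow 2).div_const 4).smul_const k3)
      refine HasDerivAt.congr_deriv this ?_
      norm_num
      module) (by simp) e2
  have e0 := mvt_bound (h := h) (φ := fun τ => (τ / 2) • (fderiv ℝ g x a + fderiv ℝ g (x + τ • a) a)
       - (g (x + τ • a) - g x) - (τ ^ 3 / 12) • k3) (φ' := fun τ =>
       (1 / 2 : ℝ) • (fderiv ℝ g x a - fderiv ℝ g (x + τ • a) a
      + τ • fderiv ℝ (fderiv ℝ g) (x + τ • a) a a) - (τ ^ 2 / 4) • k3) (C := C * R * h ^ 2 * h) (by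
      intro τ _
      have := ((((hasDerivAt_id τ).div_const 2).smul ((d1 τ).const_add (fderiv ℝ g x a))).sub
        ((d0 τ).sub_const (g x))).sub ((((hasDerivAt_id τ).pow 3).div_const 12).smul_const k3)
      refine HasDerivAt.congr_deriv this ?_
      norm_num
      module) (by simp) (fun τ hτ => (e1 τ hτ).trans (by
        have := (norm_nonneg _).trans (e2 τ hτ)
        have := hτ.2
        gcongr))
  refine (e0 h ⟨h0, le_rfl⟩).trans (le_of_eq (by ring))

set_option maxSynthPendingDepth 3 in
theorem bigO_trap {Ω : Type*} {l : Filter Ω} {g : V → L} (hg : ContDiff ℝ ∞ g) {x a : Ω → V} {h : Ω → ℝ}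
    (hx : x =O[l] (fun _ => (1 : ℝ))) (ha : a =O[l] (fun _ => (1 : ℝ)))
    (hh : ∀ᶠ o in l, 0 ≤ h o ∧ h o ≤ 1) :
    (fun o => (h o / 2) • (fderiv ℝ g (x o) (a o) + fderiv ℝ g (x o + h o • a o) (a o))
      - (g (x o + h o • a o) - g (x o))
      - (h o ^ 3 / 12) • (fderiv ℝ (fderiv ℝ (fderiv ℝ g)) (x o) (a o) (a o) (a o))) =O[l]
      (fun o => h o ^ 4) := by
  obtain ⟨R, hR⟩ := hx.bound
  obtain ⟨R', hR'⟩ := ha.bound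
  obtain ⟨C, hC⟩ := trap_ball g hg (max (max R R') 1)
  refine IsBigO.of_bound C ?_
  filter_upwards [hR, hR', hh] with o h1 h2 h3
  rw [Real.norm_of_nonneg (pow_nonneg h3.1 4)]
  refine hC _ _ _ (le_trans (by simpa using h1) (le_max_of_le_left (le_max_left _ _)))
    (le_trans (by simpa using h2) (le_max_of_le_left (le_max_right _ _))) h3.1
    (h3.2.trans (le_max_right _ _))

end Trap

open MeasureTheory Matrix Set
open scoped ContDiff Topology
open Asymptotics Filter

structure CSys (V L : Type*) [NormedAddCommGroup V] [NormedSpace ℝ V]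
    [NormedAddCommGroup L] [NormedSpace ℝ L] where
  g : V → L
  f : V → V
  G : V → L →L[ℝ] V
  Mi : V →L[ℝ] V
  hg : ContDiff ℝ ∞ g
  hf : ContDiff ℝ ∞ f
  hG : ContDiff ℝ ∞ G

section Traj
variable {V L : Type*} [NormedAddCommGroup V] [NormedSpace ℝ V]
  [NormedAddCommGroup L] [NormedSpace ℝ L]

namespace CSys
variable (S : CSys V L)

noncomputable def F (z : V × L) : V := S.f z.1 + S.G z.1 z.2

noncomputable def A (x : V) : L →L[ℝ] L := (fderiv ℝ S.g x).comp (S.Mi.comp (S.G x))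

noncomputable def DF (z : V × V × L) : V := fderiv ℝ S.F (z.1, z.2.2) (S.Mi z.2.1, 0)

noncomputable def Psi (z : V × V × L) : L :=
  -(fderiv ℝ S.g z.1 (S.Mi (S.F (z.1, z.2.2))))
    + fderiv ℝ (fderiv ℝ S.g) z.1 (S.Mi z.2.1) (S.Mi z.2.1)

noncomputable def dhat (c : ℝ) (z : V × V × L) : L :=
  (-(1 / 2 : ℝ)) • fderiv ℝ (fderiv ℝ S.g) z.1 (S.Mi z.2.1) (S.Mi (S.F (z.1, z.2.2)))
    + (2 * c) • fderiv ℝ S.g z.1 (S.Mi (S.DF z))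
    + (1 / 6 : ℝ) • fderiv ℝ (fderiv ℝ (fderiv ℝ S.g)) z.1 (S.Mi z.2.1) (S.Mi z.2.1) (S.Mi z.2.1)

noncomputable def Proj (z : V × (L →L[ℝ] L)) : V →L[ℝ] V :=
  ContinuousLinearMap.id ℝ V - (S.G z.1).comp (z.2.comp ((fderiv ℝ S.g z.1).comp S.Mi))

theorem hg1 : ContDiff ℝ ∞ (fderiv ℝ S.g) := S.hg.fderiv_right (by simp)
theorem hg2 : ContDiff ℝ ∞ (fderiv ℝ (fderiv ℝ S.g)) := S.hg1.fderiv_right (by simp)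
set_option maxSynthPendingDepth 3 in
theorem hg3 : ContDiff ℝ ∞ (fderiv ℝ (fderiv ℝ (fderiv ℝ S.g))) := S.hg2.fderiv_right (by simp)

theorem hF : ContDiff ℝ ∞ S.F := by
  have := S.hf
  have := S.hG
  unfold F
  fun_prop

theorem hA : ContDiff ℝ ∞ S.A := by
  have := S.hg1
  have := S.hG
  unfold A
  fun_prop

theorem hDF : ContDiff ℝ ∞ S.DF := by
  have : ContDiff ℝ ∞ (fderiv ℝ S.F) := S.hF.fderiv_right (by simp)
  unfold DF
  fun_prop

theorem hPsi : ContDiff ℝ ∞ S.Psi := by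
  have := S.hg1
  have := S.hg2
  have := S.hF
  unfold Psi
  fun_prop

set_option maxSynthPendingDepth 3 in
theorem hdhat (c : ℝ) : ContDiff ℝ ∞ (S.dhat c) := by
  have := S.hg1
  have := S.hg2
  have := S.hg3
  have := S.hF
  have := S.hDF
  unfold dhat
  fun_prop

theorem hProj : ContDiff ℝ ∞ S.Proj := by
  have := S.hg1
  have := S.hG
  unfold Proj
  fun_prop

theorem F_sub (x : V) (a b : L) : S.F (x, a) - S.F (x, b) = S.G x (a - b) := by
  simp [F]

end CSys
end Traj

open MeasureTheory Matrix Set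
open scoped ContDiff Topology
open Asymptotics Filter

section TrajSec

def BL {E : Type*} [NormedAddCommGroup E] (T : ℝ) (z : ℝ → E) : Prop :=
  ∃ K : ℝ, ∀ t ∈ Icc (0 : ℝ) T, ∀ t' ∈ Icc (0 : ℝ) T, ‖z t‖ ≤ K ∧ ‖z t' - z t‖ ≤ K * |t' - t|

theorem BL.nonneg {E : Type*} [NormedAddCommGroup E] {T : ℝ} {z : ℝ → E} (hz : BL T z) :
    ∃ K : ℝ, 0 ≤ K ∧ ∀ t ∈ Icc (0 : ℝ) T, ∀ t' ∈ Icc (0 : ℝ) T,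
      ‖z t‖ ≤ K ∧ ‖z t' - z t‖ ≤ K * |t' - t| := by
  obtain ⟨K, hK⟩ := hz
  refine ⟨max K 0, le_max_right _ _, fun t ht t' ht' => ?_⟩
  have := hK t ht t' ht'
  exact ⟨this.1.trans (le_max_left _ _), this.2.trans (by gcongr; exact le_max_left _ _)⟩

theorem BL.comp {E F : Type*} [NormedAddCommGroup E] [NormedSpace ℝ E] [ProperSpace E]
    [NormedAddCommGroup F] [NormedSpace ℝ F] {T : ℝ} {z : ℝ → E} (hz : BL T z)
    {Φ : E → F} (hΦ : ContDiff ℝ ∞ Φ) : BL T (fun t => Φ (z t)) := by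
  obtain ⟨K, hK⟩ := hz
  obtain ⟨C, hC⟩ := ball_smooth Φ hΦ K
  refine ⟨max C (C * K), fun t ht t' ht' => ?_⟩
  have h1 := hC _ _ (hK t ht t' ht').1 (hK t' ht' t ht).1
  have h0 : 0 ≤ C := (norm_nonneg _).trans h1.1
  refine ⟨h1.1.trans (le_max_left _ _), h1.2.trans ?_⟩
  calc C * ‖z t' - z t‖ ≤ C * (K * |t' - t|) := by gcongr; exact (hK t ht t' ht').2
    _ = (C * K) * |t' - t| := by ring
    _ ≤ _ := by gcongr; exact le_max_right _ _

theorem BL.prodMk {E F : Type*} [NormedAddCommGroup E] [NormedAddCommGroup F] {T : ℝ}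
    {z : ℝ → E} {w : ℝ → F} (hz : BL T z) (hw : BL T w) : BL T (fun t => (z t, w t)) := by
  obtain ⟨K, hK⟩ := hz
  obtain ⟨C, hC⟩ := hw
  refine ⟨max K C, fun t ht t' ht' => ?_⟩
  have h1 := hK t ht t' ht'
  have h2 := hC t ht t' ht'
  refine ⟨max_le_max h1.1 h2.1, ?_⟩
  rw [Prod.mk_sub_mk, Prod.norm_mk, max_mul_of_nonneg _ _ (abs_nonneg _)]
  exact max_le_max h1.2 h2.2

theorem BL.of_deriv {E : Type*} [NormedAddCommGroup E] [NormedSpace ℝ E] {T : ℝ} {z z' : ℝ → E}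
    (hd : ∀ t ∈ Icc (0 : ℝ) T, HasDerivAt z (z' t) t)
    (hb : ∃ C, ∀ t ∈ Icc (0 : ℝ) T, ‖z' t‖ ≤ C) : BL T z := by
  obtain ⟨C, hC⟩ := hb
  obtain ⟨D, hD⟩ := (isCompact_Icc (a := (0 : ℝ)) (b := T)).exists_bound_of_continuousOn
    (f := z) (fun t ht => (hd t ht).continuousAt.continuousWithinAt)
  refine ⟨max C D, fun t ht t' ht' => ⟨(hD t ht).trans (le_max_right _ _), ?_⟩⟩
  have := (convex_Icc (0 : ℝ) T).norm_image_sub_le_of_norm_hasDerivWithin_le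
    (fun x hx => (hd x hx).hasDerivWithinAt) hC ht ht'
  refine this.trans ?_
  rw [Real.norm_eq_abs]
  gcongr
  exact le_max_left _ _

theorem taylor_back {W : Type*} [NormedAddCommGroup W] [NormedSpace ℝ W] {φ φ' : ℝ → W} {h K : ℝ}
    (hK : 0 ≤ K)
    (hd : ∀ τ ∈ Icc 0 h, HasDerivAt φ (φ' τ) τ)
    (hb : ∀ τ ∈ Icc 0 h, ∀ σ ∈ Icc 0 h, ‖φ' σ - φ' τ‖ ≤ K * |σ - τ|) :
    ∀ τ ∈ Icc 0 h, ‖φ τ - φ 0 - τ • φ' τ‖ ≤ K * τ ^ 2 := by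
  intro τ hτ
  have := mvt_bound (φ := fun σ => φ σ - φ 0 - σ • φ' τ) (φ' := fun σ => φ' σ - φ' τ)
    (h := τ) (C := K * τ) (by
      intro σ hσ
      have := ((hd σ ⟨hσ.1, hσ.2.trans hτ.2⟩).sub_const (φ 0)).sub
        ((hasDerivAt_id σ).smul_const (φ' τ))
      exact HasDerivAt.congr_deriv this (by simp)) (by simp) (by
      intro σ hσ
      refine (hb τ hτ σ ⟨hσ.1, hσ.2.trans hτ.2⟩).trans ?_
      gcongr
      rw [abs_le]
      constructor <;> linarith [hσ.1, hσ.2]) τ ⟨hτ.1, le_rfl⟩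
  refine this.trans (le_of_eq (by ring))

structure Traj {V L : Type*} [NormedAddCommGroup V] [NormedSpace ℝ V]
    [NormedAddCommGroup L] [NormedSpace ℝ L] (S : CSys V L) (T : ℝ) where
  q : ℝ → V
  p : ℝ → V
  lam : ℝ → L
  N : ℝ → L →L[ℝ] L
  dq : ∀ t ∈ Icc (0 : ℝ) T, HasDerivAt q (S.Mi (p t)) t
  dp : ∀ t ∈ Icc (0 : ℝ) T, HasDerivAt p (-(S.F (q t, lam t))) t
  con : ∀ t ∈ Icc (0 : ℝ) T, S.g (q t) = 0
  tan : ∀ t ∈ Icc (0 : ℝ) T, fderiv ℝ S.g (q t) (S.Mi (p t)) = 0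
  hN : ∀ t ∈ Icc (0 : ℝ) T, (N t).comp (S.A (q t)) = ContinuousLinearMap.id ℝ L
  mult : ∀ t ∈ Icc (0 : ℝ) T, S.Psi (q t, p t, lam t) = 0
  blq : BL T q
  blp : BL T p
  blam : BL T lam
  blN : BL T N

variable {V L : Type*} [NormedAddCommGroup V] [NormedSpace ℝ V] [FiniteDimensional ℝ V]
  [NormedAddCommGroup L] [NormedSpace ℝ L] [FiniteDimensional ℝ L]
variable {S : CSys V L} {T : ℝ} (Y : Traj S T)

theorem Traj.q_trap : ∃ C, ∀ t h, 0 ≤ t → 0 ≤ h → t + h ≤ T →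
    ‖Y.q (t + h) - Y.q t - (h / 2) • S.Mi (Y.p t + Y.p (t + h))‖ ≤ C * h ^ 3 := by
  obtain ⟨K, hK0, hK⟩ := ((Y.blq.prodMk Y.blam).comp S.hF).nonneg
  refine ⟨‖S.Mi‖ * K, fun t h ht hh hT => ?_⟩
  have hmem : ∀ τ ∈ Icc 0 h, t + τ ∈ Icc 0 T := fun τ hτ =>
    ⟨by linarith [hτ.1], by linarith [hτ.2]⟩
  have d1 : ∀ τ ∈ Icc 0 h, HasDerivAt (fun τ => Y.q (t + τ)) (S.Mi (Y.p (t + τ))) τ :=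
    fun τ hτ => (Y.dq _ (hmem τ hτ)).comp_const_add t τ
  have d2 : ∀ τ ∈ Icc 0 h, HasDerivAt (fun τ => Y.p (t + τ))
      (-(S.F (Y.q (t + τ), Y.lam (t + τ)))) τ :=
    fun τ hτ => (Y.dp _ (hmem τ hτ)).comp_const_add t τ
  have tb := taylor_back hK0 d2 (by
    intro τ hτ σ hσ
    have := (hK _ (hmem τ hτ) _ (hmem σ hσ)).2
    rw [neg_sub_neg, norm_sub_rev]
    simpa using this)
  have := mvt_bound
    (φ := fun τ => Y.q (t + τ) - Y.q t - (τ / 2) • S.Mi (Y.p t + Y.p (t + τ)))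
    (φ' := fun τ => (1 / 2 : ℝ) • S.Mi (Y.p (t + τ) - Y.p (t + 0) -
        τ • -(S.F (Y.q (t + τ), Y.lam (t + τ))))) (h := h) (C := ‖S.Mi‖ * K * h ^ 2) (by
      intro τ hτ
      have e1 := ((d1 τ hτ).sub_const (Y.q t)).sub
        (((hasDerivAt_id τ).div_const 2).smul
          (S.Mi.hasFDerivAt.comp_hasDerivAt τ ((d2 τ hτ).const_add (Y.p t))))
      refine HasDerivAt.congr_deriv e1 ?_
      simp only [map_sub, map_add, map_smul, map_neg, add_zero, id, Function.comp_apply]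
      module) (by simp) (by
      intro τ hτ
      rw [norm_smul]
      have h1 := S.Mi.le_opNorm (Y.p (t + τ) - Y.p (t + 0) -
        τ • -(S.F (Y.q (t + τ), Y.lam (t + τ))))
      have h2 := tb τ hτ
      have h3 : K * τ ^ 2 ≤ K * h ^ 2 := by
        have := hτ.1; have := hτ.2; gcongr
      have h4 : ‖S.Mi‖ * ‖(Y.p (t + τ) - Y.p (t + 0) -
        τ • -(S.F (Y.q (t + τ), Y.lam (t + τ))))‖ ≤ ‖S.Mi‖ * (K * h ^ 2) := by
        gcongr; exact h2.trans h3
      norm_num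
      have h5 := h1.trans h4
      norm_num at h5
      have h6 := norm_nonneg (S.Mi (Y.p (t + τ)) - S.Mi (Y.p t)
        + τ • S.Mi (S.F (Y.q (t + τ), Y.lam (t + τ))))
      linarith [h6, h5]) h ⟨hh, le_rfl⟩
  refine this.trans (le_of_eq (by ring))

theorem CSys.Proj_G {S : CSys V L} {x : V} {n : L →L[ℝ] L}
    (h : n.comp (S.A x) = ContinuousLinearMap.id ℝ L) :
    (S.Proj (x, n)).comp (S.G x) = 0 := by
  ext y
  have := DFunLike.congr_fun h y
  simp [CSys.A] at this
  simp [CSys.Proj, this]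

theorem Traj.p_trap : ∃ C, ∀ t h, 0 ≤ t → 0 ≤ h → t + h ≤ T →
    ‖((1 / 2 : ℝ) • (S.Proj (Y.q t, Y.N t) + S.Proj (Y.q (t + h), Y.N (t + h))))
      (Y.p (t + h) - Y.p t
        + (h / 2) • (S.F (Y.q t, Y.lam t) + S.F (Y.q (t + h), Y.lam t)))‖ ≤ C * h ^ 3 := by
  obtain ⟨Kl, hKl0, hKl⟩ := Y.blam.nonneg
  obtain ⟨KG, hKG0, hKG⟩ := (Y.blq.comp S.hG).nonneg
  obtain ⟨KP, hKP0, hKP⟩ := ((Y.blq.prodMk Y.blN).comp S.hProj).nonneg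
  obtain ⟨Kz, hKz0, hKz⟩ := (Y.blq.prodMk (Y.blp.prodMk Y.blam)).nonneg
  obtain ⟨KD, hKD⟩ := ball_smooth S.DF S.hDF Kz
  refine ⟨KP * ((max (KD * Kz) 0) + KG * Kl), fun t h ht hh hT => ?_⟩
  have hmem : ∀ τ ∈ Icc 0 h, t + τ ∈ Icc 0 T := fun τ hτ =>
    ⟨by linarith [hτ.1], by linarith [hτ.2]⟩
  have ht0 : t ∈ Icc 0 T := ⟨ht, by linarith⟩
  have hth : t + h ∈ Icc 0 T := hmem h ⟨hh, le_rfl⟩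
  have d1 : ∀ τ ∈ Icc 0 h, HasDerivAt (fun τ => Y.q (t + τ)) (S.Mi (Y.p (t + τ))) τ :=
    fun τ hτ => (Y.dq _ (hmem τ hτ)).comp_const_add t τ
  have d2 : ∀ τ ∈ Icc 0 h, HasDerivAt (fun τ => Y.p (t + τ))
      (-(S.F (Y.q (t + τ), Y.lam (t + τ)))) τ :=
    fun τ hτ => (Y.dp _ (hmem τ hτ)).comp_const_add t τ
  have d3 : ∀ τ ∈ Icc 0 h, HasDerivAt (fun τ => S.F (Y.q (t + τ), Y.lam t))
      (S.DF (Y.q (t + τ), Y.p (t + τ), Y.lam t)) τ := fun τ hτ =>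
    (S.hF.differentiable (by simp)).differentiableAt.hasFDerivAt.comp_hasDerivAt τ
      ((d1 τ hτ).prodMk (hasDerivAt_const τ (Y.lam t)))
  have hz : ∀ τ ∈ Icc 0 h, ‖(Y.q (t + τ), Y.p (t + τ), Y.lam t)‖ ≤ Kz := by
    intro τ hτ
    have h1 := (hKz _ (hmem τ hτ) _ (hmem τ hτ)).1
    have h2 := (hKz _ ht0 _ ht0).1
    simp only [Prod.norm_mk, max_le_iff] at h1 h2 ⊢
    exact ⟨h1.1, h1.2.1, h2.2.2⟩
  have tb := taylor_back (le_max_right (KD * Kz) 0) d3 (by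
    intro τ hτ σ hσ
    have h1 := hKD _ _ (hz τ hτ) (hz σ hσ)
    have h0 : 0 ≤ KD := (norm_nonneg _).trans h1.1
    refine h1.2.trans ?_
    calc _ ≤ KD * (Kz * |σ - τ|) := by
          gcongr
          have := (hKz _ (hmem τ hτ) _ (hmem σ hσ)).2
          simp only [Prod.mk_sub_mk, Prod.norm_mk, max_le_iff, add_sub_add_left_eq_sub] at this ⊢
          exact ⟨this.1, this.2.1, by simp; positivity⟩
      _ = (KD * Kz) * |σ - τ| := by ring
      _ ≤ _ := by gcongr; exact le_max_left _ _)
  set KD' := max (KD * Kz) 0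
  have hKD' : 0 ≤ KD' := le_max_right _ _
  set Pb := ((1 / 2 : ℝ) • (S.Proj (Y.q t, Y.N t) + S.Proj (Y.q (t + h), Y.N (t + h)))) with hPb
  have nPb : ‖Pb‖ ≤ KP := by
    rw [hPb, norm_smul]
    have h1 := (hKP _ ht0 _ ht0).1
    have h2 := (hKP _ hth _ hth).1
    have h3 := norm_add_le (S.Proj (Y.q t, Y.N t)) (S.Proj (Y.q (t + h), Y.N (t + h)))
    norm_num
    linarith
  have nPG : ∀ τ ∈ Icc 0 h, ∀ y, ‖Pb (S.G (Y.q (t + τ)) y)‖ ≤ KP * (KG * h) * ‖y‖ := by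
    intro τ hτ y
    have z1 := DFunLike.congr_fun (CSys.Proj_G (Y.hN _ ht0)) y
    have z2 := DFunLike.congr_fun (CSys.Proj_G (Y.hN _ hth)) y
    simp only [ContinuousLinearMap.comp_apply, _root_.zero_apply] at z1 z2
    have e : Pb (S.G (Y.q (t + τ)) y) = (1 / 2 : ℝ) •
        (S.Proj (Y.q t, Y.N t) ((S.G (Y.q (t + τ)) - S.G (Y.q t)) y) +
          S.Proj (Y.q (t + h), Y.N (t + h)) ((S.G (Y.q (t + τ)) - S.G (Y.q (t + h))) y)) := by
      simp [hPb, z1, z2]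
    have b1 : ‖S.Proj (Y.q t, Y.N t) ((S.G (Y.q (t + τ)) - S.G (Y.q t)) y)‖
        ≤ KP * (KG * h * ‖y‖) := by
      refine ContinuousLinearMap.le_of_opNorm_le_of_le _ (hKP _ ht0 _ ht0).1 ?_
      refine ContinuousLinearMap.le_of_opNorm_le _ ?_ _
      refine (hKG _ ht0 _ (hmem τ hτ)).2.trans ?_
      gcongr
      rw [abs_le]; constructor <;> linarith [hτ.1, hτ.2]
    have b2 : ‖S.Proj (Y.q (t + h), Y.N (t + h)) ((S.G (Y.q (t + τ)) - S.G (Y.q (t + h))) y)‖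
        ≤ KP * (KG * h * ‖y‖) := by
      refine ContinuousLinearMap.le_of_opNorm_le_of_le _ (hKP _ hth _ hth).1 ?_
      refine ContinuousLinearMap.le_of_opNorm_le _ ?_ _
      refine (hKG _ hth _ (hmem τ hτ)).2.trans ?_
      gcongr
      rw [abs_le]; constructor <;> linarith [hτ.1, hτ.2]
    rw [e, norm_smul]
    have b3 := (norm_add_le _ _).trans (add_le_add b1 b2)
    norm_num at b3 ⊢
    linarith
  have := mvt_bound
    (φ := fun τ => Pb (Y.p (t + τ) - Y.p t
        + (τ / 2) • (S.F (Y.q t, Y.lam t) + S.F (Y.q (t + τ), Y.lam t))))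
    (φ' := fun τ => Pb ((-(1 / 2 : ℝ)) • (S.F (Y.q (t + τ), Y.lam t) - S.F (Y.q (t + 0), Y.lam t) -
        τ • (S.DF (Y.q (t + τ), Y.p (t + τ), Y.lam t)))) -
          Pb (S.G (Y.q (t + τ)) (Y.lam (t + τ) - Y.lam t)))
     (h := h) (C := KP * (KD' + KG * Kl) * h ^ 2) (by
      intro τ hτ
      have e1 := Pb.hasFDerivAt.comp_hasDerivAt τ (((d2 τ hτ).sub_const (Y.p t)).add
        (((hasDerivAt_id τ).div_const 2).smul
          ((d3 τ hτ).const_add (S.F (Y.q t, Y.lam t)))))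
      refine HasDerivAt.congr_deriv e1 ?_
      rw [← map_sub, ← S.F_sub]
      congr 1
      simp only [add_zero, id]
      module) (by simp) (by
      intro τ hτ
      have c1 : ‖Pb ((-(1 / 2 : ℝ)) • (S.F (Y.q (t + τ), Y.lam t) - S.F (Y.q (t + 0), Y.lam t) -
        τ • (S.DF (Y.q (t + τ), Y.p (t + τ), Y.lam t))))‖ ≤ KP * (1 / 2 * (KD' * h ^ 2)) := by
        refine ContinuousLinearMap.le_of_opNorm_le_of_le _ nPb ?_
        rw [norm_smul]
        have h2 := tb τ hτ
        have h3 : KD' * τ ^ 2 ≤ KD' * h ^ 2 := by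
          have := hτ.1; have := hτ.2; gcongr
        have h4 := h2.trans h3
        norm_num at h4 ⊢
        linarith
      have c2 : ‖Pb (S.G (Y.q (t + τ)) (Y.lam (t + τ) - Y.lam t))‖ ≤ KP * (KG * h) * (Kl * h) := by
        refine (nPG τ hτ _).trans ?_
        gcongr
        refine (hKl _ ht0 _ (hmem τ hτ)).2.trans ?_
        gcongr
        rw [abs_le]; constructor <;> linarith [hτ.1, hτ.2]
      refine (norm_sub_le _ _).trans ((add_le_add c1 c2).trans ?_)
      have : 0 ≤ KP * (KD' * h ^ 2) := by positivity
      nlinarith) h ⟨hh, le_rfl⟩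
  refine this.trans (le_of_eq (by ring))

end TrajSec

open MeasureTheory Matrix Set
open scoped ContDiff Topology
open Asymptotics Filter

theorem wk_mul {Ω E : Type*} [Norm E] {l : Filter Ω} {f : Ω → E} {h a b : Ω → ℝ}
    (hf : f =O[l] fun o => h o * a o) (hab : ∀ o, |a o| ≤ b o) : f =O[l] fun o => h o * b o := by
  refine hf.trans (isBigO_of_le _ fun o => ?_)
  rw [norm_mul, norm_mul]
  gcongr
  exact (hab o).trans (le_abs_self _)

structure Bas (σ : ℕ) where
  P : Fin (σ + 1) → ℝ → ℝ
  I : Fin (σ + 1) → ℝ → ℝ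
  hP : ∀ k, Continuous (P k)
  hI : ∀ k, Continuous (I k)
  P0 : ∀ c, P 0 c = 1
  I0 : ∀ c, I 0 c = c
  I1 : ∀ k, k ≠ 0 → I k 1 = 0
  intP : ∀ k, k ≠ 0 → ∫ c in (0 : ℝ)..1, P k c = 0

section StepSec
variable {σ : ℕ} (B : Bas σ)

namespace Bas
noncomputable def X (j k : Fin (σ + 1)) : ℝ := ∫ c in (0 : ℝ)..1, B.P j c * B.I k c
noncomputable def d (j : Fin (σ + 1)) : ℝ := if j = 0 then 1 else 0

theorem X00 : B.X 0 0 = 1 / 2 := by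
  simp [X, B.P0, B.I0]

theorem intP_eq (k : Fin (σ + 1)) : ∫ c in (0 : ℝ)..1, B.P k c = d k := by
  unfold d
  split_ifs with h
  · subst h; simp [B.P0]
  · exact B.intP k h

variable {V : Type*} [NormedAddCommGroup V] [NormedSpace ℝ V]

noncomputable def Xi (j : Fin (σ + 1)) : (Fin (σ + 1) → V) →L[ℝ] V :=
  ∑ k, B.X j k • ContinuousLinearMap.proj (R := ℝ) (φ := fun _ => V) k

theorem Xi_apply (j : Fin (σ + 1)) (z : Fin (σ + 1) → V) : B.Xi j z = ∑ k, B.X j k • z k := by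
  simp [Xi]

noncomputable def Ups (c : ℝ) : (Fin (σ + 1) → V) →L[ℝ] V := ∑ j, B.I j c • B.Xi j

theorem Ups_one : B.Ups (V := V) 1 = B.Xi 0 := by
  unfold Ups
  rw [Finset.sum_eq_single 0]
  · simp [B.I0]
  · intro j _ hj; simp [B.I1 j hj]
  · simp

theorem Ups_bound : ∃ C : ℝ, ∀ c ∈ Icc (0 : ℝ) 1, ‖B.Ups (V := V) c‖ ≤ C := by
  have hc : Continuous (fun c => B.Ups (V := V) c) := by
    unfold Ups
    have := B.hI
    fun_prop
  exact (isCompact_Icc (a := (0 : ℝ)) (b := 1)).exists_bound_of_continuousOn hc.continuousOn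

end Bas

variable {V L : Type*} [NormedAddCommGroup V] [NormedSpace ℝ V] 
  [NormedAddCommGroup L] [NormedSpace ℝ L] 
variable (S : CSys V L)

namespace CSys
noncomputable def gam (p0 : V) (h : ℝ) (ζ : Fin (σ + 1) → V) (j : Fin (σ + 1)) : V :=
  S.Mi (Bas.d j • p0 + h • ∑ k, B.X j k • ζ k)

noncomputable def uu (q0 p0 : V) (h : ℝ) (ζ : Fin (σ + 1) → V) (c : ℝ) : V :=
  q0 + h • ∑ j, B.I j c • S.gam B p0 h ζ j

noncomputable def ZZ (q0 p0 : V) (h : ℝ) (ζ : Fin (σ + 1) → V) (lam : L) : Fin (σ + 1) → V :=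
  fun k => -∫ c in (0 : ℝ)..1, B.P k c • S.F (S.uu B q0 p0 h ζ c, lam)

theorem uu_eq (q0 p0 : V) (h : ℝ) (ζ : Fin (σ + 1) → V) (c : ℝ) :
    S.uu B q0 p0 h ζ c = q0 + h • (c • S.Mi p0 + h • S.Mi (B.Ups c ζ)) := by
  unfold uu gam
  congr 2
  simp only [map_add, map_smul, smul_add, Finset.sum_add_distrib]
  congr 1
  · rw [Finset.sum_eq_single 0]
    · simp [B.I0, Bas.d]
    · intro j _ hj; simp [Bas.d, hj]
    · simp
  · simp only [Bas.Ups, _root_.sum_apply, _root_.smul_apply, map_sum, map_smul, B.Xi_apply, Finset.smul_sum]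
    refine Finset.sum_congr rfl fun j _ => Finset.sum_congr rfl fun k _ => ?_
    module

theorem uu_one (q0 p0 : V) (h : ℝ) (ζ : Fin (σ + 1) → V) :
    S.uu B q0 p0 h ζ 1 = q0 + h • (S.Mi p0 + h • S.Mi (B.Xi 0 ζ)) := by
  rw [uu_eq, B.Ups_one, one_smul]

theorem uu_cont (q0 p0 : V) (h : ℝ) (ζ : Fin (σ + 1) → V) :
    Continuous (S.uu B q0 p0 h ζ) := by
  have := B.hI
  unfold uu
  fun_prop

theorem F_int (q0 p0 : V) (h : ℝ) (ζ : Fin (σ + 1) → V) (lam : L) (k : Fin (σ + 1)) :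
    IntervalIntegrable (fun c => B.P k c • S.F (S.uu B q0 p0 h ζ c, lam)) volume 0 1 := by
  apply Continuous.intervalIntegrable
  have := B.hP k
  have := S.uu_cont B q0 p0 h ζ
  have := S.hF.continuous
  fun_prop

variable {Ω : Type*} {l : Filter Ω} {q0 p0 : Ω → V} {h : Ω → ℝ}
  {ζ ζ' : Ω → Fin (σ + 1) → V} {lam lam' : Ω → L}

theorem lift_fst {E E' : Type*} [Norm E] [Norm E'] {f : Ω → E} {b : Ω → E'} (hf : f =O[l] b) :
    (fun z : Ω × ℝ => f z.1) =O[l ×ˢ 𝓟 (Icc (0 : ℝ) 1)] (fun z => b z.1) :=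
  hf.comp_tendsto tendsto_fst

theorem c_bdd : (fun z : Ω × ℝ => z.2) =O[l ×ˢ 𝓟 (Icc (0 : ℝ) 1)] (fun _ => (1 : ℝ)) := by
  refine IsBigO.of_bound 1 ?_
  rw [Filter.eventually_prod_principal_iff]
  filter_upwards with o c hc
  simp [abs_of_nonneg hc.1, hc.2]

theorem Ups_bigO {b : Ω → ℝ} (hζ : ζ =O[l] b) :
    (fun z : Ω × ℝ => B.Ups z.2 (ζ z.1)) =O[l ×ˢ 𝓟 (Icc (0 : ℝ) 1)] (fun z => b z.1) := by
  obtain ⟨C, hC⟩ := B.Ups_bound (V := V)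
  have h1 : (fun z : Ω × ℝ => B.Ups (V := V) z.2) =O[l ×ˢ 𝓟 (Icc (0 : ℝ) 1)]
      (fun _ => (1 : ℝ)) := by
    refine IsBigO.of_bound C ?_
    rw [Filter.eventually_prod_principal_iff]
    filter_upwards with o c hc
    simpa using hC c hc
  simpa using bigO_clm h1 (lift_fst hζ)

theorem h_bdd (hh : ∀ᶠ o in l, 0 ≤ h o ∧ h o ≤ 1) : h =O[l] (fun _ => (1 : ℝ)) := by
  refine IsBigO.of_bound 1 ?_
  filter_upwards [hh] with o ho
  simp [abs_of_nonneg ho.1, ho.2]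

theorem uu_sub (hp : p0 =O[l] (fun _ => (1 : ℝ))) (hζ : ζ =O[l] (fun _ => (1 : ℝ)))
    (hh : ∀ᶠ o in l, 0 ≤ h o ∧ h o ≤ 1) :
    (fun z : Ω × ℝ => S.uu B (q0 z.1) (p0 z.1) (h z.1) (ζ z.1) z.2 - q0 z.1)
      =O[l ×ˢ 𝓟 (Icc (0 : ℝ) 1)] (fun z => h z.1) := by
  simp only [uu_eq, add_sub_cancel_left]
  have h1 : (fun z : Ω × ℝ => z.2 • S.Mi (p0 z.1)) =O[l ×ˢ 𝓟 (Icc (0 : ℝ) 1)]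
      (fun _ => (1 : ℝ)) := by
    simpa using c_bdd.smul (lift_fst (bigO_clm' S.Mi hp))
  have h2 : (fun z : Ω × ℝ => h z.1 • S.Mi (B.Ups z.2 (ζ z.1))) =O[l ×ˢ 𝓟 (Icc (0 : ℝ) 1)]
      (fun _ => (1 : ℝ)) := by
    simpa using (lift_fst (h_bdd hh)).smul (bigO_clm' S.Mi (Ups_bigO B hζ))
  simpa using (isBigO_refl (fun z : Ω × ℝ => h z.1) _).smul (h1.add h2)

theorem uu_bdd (hq : q0 =O[l] (fun _ => (1 : ℝ))) (hp : p0 =O[l] (fun _ => (1 : ℝ)))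
    (hζ : ζ =O[l] (fun _ => (1 : ℝ)))
    (hh : ∀ᶠ o in l, 0 ≤ h o ∧ h o ≤ 1) :
    (fun z : Ω × ℝ => S.uu B (q0 z.1) (p0 z.1) (h z.1) (ζ z.1) z.2)
      =O[l ×ˢ 𝓟 (Icc (0 : ℝ) 1)] (fun _ => (1 : ℝ)) := by
  have := ((S.uu_sub B (q0 := q0) hp hζ hh).trans (lift_fst (h_bdd hh))).add (lift_fst hq)
  simpa using this

variable [FiniteDimensional ℝ V] [FiniteDimensional ℝ L]

theorem ZZ_bdd (hq : q0 =O[l] (fun _ => (1 : ℝ))) (hp : p0 =O[l] (fun _ => (1 : ℝ)))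
    (hζ : ζ =O[l] (fun _ => (1 : ℝ))) (hl : lam =O[l] (fun _ => (1 : ℝ)))
    (hh : ∀ᶠ o in l, 0 ≤ h o ∧ h o ≤ 1) :
    (fun o => S.ZZ B (q0 o) (p0 o) (h o) (ζ o) (lam o)) =O[l] (fun _ => (1 : ℝ)) := by
  rw [isBigO_pi]
  intro k
  have h1 := bigO_bdd S.hF ((S.uu_bdd B hq hp hζ hh).prod_left (lift_fst hl))
  exact (bigO_integral (B.hP k) h1).neg_left

theorem ZZ_diff (hq : q0 =O[l] (fun _ => (1 : ℝ))) (hp : p0 =O[l] (fun _ => (1 : ℝ)))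
    (hζ : ζ =O[l] (fun _ => (1 : ℝ))) (hl : lam =O[l] (fun _ => (1 : ℝ)))
    (hζ' : ζ' =O[l] (fun _ => (1 : ℝ))) (hl' : lam' =O[l] (fun _ => (1 : ℝ)))
    (hh : ∀ᶠ o in l, 0 ≤ h o ∧ h o ≤ 1) :
    (fun o => S.ZZ B (q0 o) (p0 o) (h o) (ζ' o) (lam' o) - S.ZZ B (q0 o) (p0 o) (h o) (ζ o) (lam o)
      + fun k => Bas.d k • S.G (q0 o) (lam' o - lam o)) =O[l]
      (fun o => h o * (‖ζ' o - ζ o‖ + ‖lam' o - lam o‖)) := by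
  rw [isBigO_pi]
  intro k
  have e : ∀ o, S.ZZ B (q0 o) (p0 o) (h o) (ζ' o) (lam' o) k
      - S.ZZ B (q0 o) (p0 o) (h o) (ζ o) (lam o) k + Bas.d k • S.G (q0 o) (lam' o - lam o)
      = - ∫ c in (0 : ℝ)..1, B.P k c • (S.F (S.uu B (q0 o) (p0 o) (h o) (ζ' o) c, lam' o) -
          S.F (S.uu B (q0 o) (p0 o) (h o) (ζ o) c, lam o) - S.G (q0 o) (lam' o - lam o)) := by
    intro o
    simp only [smul_sub]
    rw [intervalIntegral.integral_sub, intervalIntegral.integral_sub,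
      intervalIntegral.integral_smul_const, B.intP_eq]
    · simp only [ZZ]; module
    · exact S.F_int ..
    · exact S.F_int ..
    · exact (S.F_int ..).sub (S.F_int ..)
    · apply Continuous.intervalIntegrable
      have := B.hP k
      fun_prop
  simp only [Pi.add_apply, Pi.sub_apply, e]
  refine (bigO_integral (B.hP k) ?_).neg_left
  have u1 := S.uu_bdd B hq hp hζ hh
  have u2 := S.uu_bdd B hq hp hζ' hh
  have a1 : (fun z : Ω × ℝ => S.F (S.uu B (q0 z.1) (p0 z.1) (h z.1) (ζ' z.1) z.2, lam' z.1) -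
      S.F (S.uu B (q0 z.1) (p0 z.1) (h z.1) (ζ z.1) z.2, lam' z.1))
      =O[l ×ˢ 𝓟 (Icc (0 : ℝ) 1)] (fun z => h z.1 * (‖ζ' z.1 - ζ z.1‖)) := by
    have t1 := bigO_lip S.hF (u1.prod_left (lift_fst hl')) (u2.prod_left (lift_fst hl'))
    refine t1.trans ?_
    have t2 : (fun z : Ω × ℝ => h z.1 • h z.1 • S.Mi (B.Ups z.2 (ζ' z.1 - ζ z.1)))
        =O[l ×ˢ 𝓟 (Icc (0 : ℝ) 1)] (fun z => h z.1 * (‖ζ' z.1 - ζ z.1‖)) := by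
      have t3 := (lift_fst (h_bdd hh)).smul
        (bigO_clm' S.Mi (Ups_bigO (ζ := fun o => ζ' o - ζ o) B (isBigO_norm_right.2 (isBigO_refl _ l))))
      simpa using (isBigO_refl (fun z : Ω × ℝ => h z.1) _).smul t3
    refine IsBigO.trans (IsBigO.of_bound 1 (Eventually.of_forall fun z => ?_)) t2
    simp only [Prod.mk_sub_mk, Prod.norm_mk, sub_self, norm_zero, one_mul]
    rw [max_eq_left (norm_nonneg _)]
    refine le_of_eq (congrArg _ ?_)
    simp only [uu_eq, map_sub]
    module
  have a2 : (fun z : Ω × ℝ => (S.G (S.uu B (q0 z.1) (p0 z.1) (h z.1) (ζ z.1) z.2) - S.G (q0 z.1))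
      (lam' z.1 - lam z.1)) =O[l ×ˢ 𝓟 (Icc (0 : ℝ) 1)] (fun z => h z.1 * ‖lam' z.1 - lam z.1‖) := by
    refine bigO_clm ((bigO_lip S.hG (lift_fst hq) u1).trans (S.uu_sub B hp hζ hh)) ?_
    exact isBigO_norm_right.2 (isBigO_refl _ _)
  have a1' := wk_mul (b := fun z : Ω × ℝ => ‖ζ' z.1 - ζ z.1‖ + ‖lam' z.1 - lam z.1‖) a1 (fun z => by
    rw [abs_norm]
    linarith [norm_nonneg (lam' z.1 - lam z.1)])
  have a2' := wk_mul (b := fun z : Ω × ℝ => ‖ζ' z.1 - ζ z.1‖ + ‖lam' z.1 - lam z.1‖) a2 (fun z => by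
    rw [abs_norm]
    linarith [norm_nonneg (ζ' z.1 - ζ z.1)])
  refine (a1'.add a2').congr_left fun z => ?_
  rw [_root_.sub_apply, ← S.F_sub (S.uu B (q0 z.1) (p0 z.1) (h z.1) (ζ z.1) z.2)]
  abel

end CSys
end StepSec

open MeasureTheory Matrix Set
open scoped ContDiff Topology
open Asymptotics Filter

section Exist

theorem bigO_clm1 {Ω : Type*} {l : Filter Ω} {E F : Type*} [NormedAddCommGroup E] [NormedSpace ℝ E]
    [NormedAddCommGroup F] [NormedSpace ℝ F] {A : Ω → E →L[ℝ] F} {x : Ω → E} {b : Ω → ℝ}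
    (hA : A =O[l] (fun _ => (1 : ℝ))) (hx : x =O[l] b) : (fun o => A o (x o)) =O[l] b :=
  (bigO_clm hA hx).congr_right fun o => one_mul _

theorem bigO_csmul {Ω : Type*} {l : Filter Ω} {F : Type*}
    [NormedAddCommGroup F] [NormedSpace ℝ F] (r : ℝ) {x : Ω → F} {b : Ω → ℝ}
    (hx : x =O[l] b) : (fun o => r • x o) =O[l] b :=
  hx.const_smul_left r

variable {σ : ℕ} (B : Bas σ)
variable {V L : Type*} [NormedAddCommGroup V] [NormedSpace ℝ V] 
  [NormedAddCommGroup L] [NormedSpace ℝ L] 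
variable (S : CSys V L)

theorem Bas.Xi_d (y : V) : B.Xi 0 (fun k => Bas.d k • y) = (1 / 2 : ℝ) • y := by
  rw [B.Xi_apply, Finset.sum_eq_single 0]
  · simp [Bas.d, B.X00]
  · intro j _ hj; simp [Bas.d, hj]
  · simp

namespace CSys

noncomputable def lp (q0 p0 : V) (h : ℝ) (N0 : L →L[ℝ] L) (ζ : Fin (σ + 1) → V) (lam : L) : L :=
  lam + (2 / h ^ 2) • N0 (S.g (S.uu B q0 p0 h (S.ZZ B q0 p0 h ζ lam) 1))

variable {Ω : Type*} {l : Filter Ω} {q0 p0 : Ω → V} {h : Ω → ℝ} {N0 : Ω → L →L[ℝ] L}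
  {ζ ζ' : Ω → Fin (σ + 1) → V} {lam lam' : Ω → L}

variable [FiniteDimensional ℝ V] [FiniteDimensional ℝ L]

theorem g_lin {x y z : Ω → V} (hx : x =O[l] (fun _ => (1 : ℝ))) (hy : y =O[l] (fun _ => (1 : ℝ)))
    (hz : z =O[l] (fun _ => (1 : ℝ))) {b d : Ω → ℝ} (hxz : (fun o => x o - z o) =O[l] b)
    (hyz : (fun o => y o - z o) =O[l] b) (hyx : (fun o => y o - x o) =O[l] d) :
    (fun o => S.g (y o) - S.g (x o) - fderiv ℝ S.g (z o) (y o - x o)) =O[l]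
      (fun o => b o * d o) := by
  have h1 := bigO_taylor S.hg hx hy
  have h2 : (fun o => ‖y o - x o‖ ^ 2) =O[l] (fun o => b o * d o) := by
    have h3 : (fun o => y o - x o) =O[l] b := (hyz.sub hxz).congr_left fun o => by abel
    simpa [sq] using h3.norm_left.mul hyx.norm_left
  have h4 := bigO_clm ((bigO_lip S.hg1 hz hx).trans hxz) hyx
  refine ((h1.trans h2).add h4).congr_left fun o => ?_
  simp

theorem uu_one_sub (hp : p0 =O[l] (fun _ => (1 : ℝ)))
    (hζ : ζ =O[l] (fun _ => (1 : ℝ))) (hh : ∀ᶠ o in l, 0 ≤ h o ∧ h o ≤ 1) :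
    (fun o => S.uu B (q0 o) (p0 o) (h o) (ζ o) 1 - q0 o) =O[l] h := by
  simp only [uu_one, add_sub_cancel_left]
  have h1 := (h_bdd hh).smul (bigO_clm' S.Mi (bigO_clm' (B.Xi 0) hζ))
  simpa using (isBigO_refl h l).smul ((bigO_clm' S.Mi hp).add (by simpa using h1))

theorem uu_one_bdd (hq : q0 =O[l] (fun _ => (1 : ℝ))) (hp : p0 =O[l] (fun _ => (1 : ℝ)))
    (hζ : ζ =O[l] (fun _ => (1 : ℝ))) (hh : ∀ᶠ o in l, 0 ≤ h o ∧ h o ≤ 1) :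
    (fun o => S.uu B (q0 o) (p0 o) (h o) (ζ o) 1) =O[l] (fun _ => (1 : ℝ)) := by
  simpa using ((S.uu_one_sub B (q0 := q0) hp hζ hh).trans (h_bdd hh)).add hq

theorem lp_diff (hq : q0 =O[l] (fun _ => (1 : ℝ))) (hp : p0 =O[l] (fun _ => (1 : ℝ)))
    (hN : N0 =O[l] (fun _ => (1 : ℝ)))
    (hζ : ζ =O[l] (fun _ => (1 : ℝ))) (hl : lam =O[l] (fun _ => (1 : ℝ)))
    (hζ' : ζ' =O[l] (fun _ => (1 : ℝ))) (hl' : lam' =O[l] (fun _ => (1 : ℝ)))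
    (hh : ∀ᶠ o in l, 0 < h o ∧ h o ≤ 1) :
    (fun o => S.lp B (q0 o) (p0 o) (h o) (N0 o) (ζ' o) (lam' o)
        - S.lp B (q0 o) (p0 o) (h o) (N0 o) (ζ o) (lam o)
      - (ContinuousLinearMap.id ℝ L - (N0 o).comp (S.A (q0 o))) (lam' o - lam o)) =O[l]
      (fun o => h o * (‖ζ' o - ζ o‖ + ‖lam' o - lam o‖)) := by
  have hh' : ∀ᶠ o in l, 0 ≤ h o ∧ h o ≤ 1 := hh.mono fun o ho => ⟨ho.1.le, ho.2⟩
  set Δ : Ω → ℝ := fun o => ‖ζ' o - ζ o‖ + ‖lam' o - lam o‖ with hΔ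
  set Z : Ω → Fin (σ + 1) → V := fun o => S.ZZ B (q0 o) (p0 o) (h o) (ζ o) (lam o) with hZ
  set Z' : Ω → Fin (σ + 1) → V := fun o => S.ZZ B (q0 o) (p0 o) (h o) (ζ' o) (lam' o) with hZ'
  have bZ : Z =O[l] (fun _ => (1 : ℝ)) := S.ZZ_bdd B hq hp hζ hl hh'
  have bZ' : Z' =O[l] (fun _ => (1 : ℝ)) := S.ZZ_bdd B hq hp hζ' hl' hh'
  have dZ := S.ZZ_diff B hq hp hζ hl hζ' hl' hh'
  have bh := h_bdd hh'
  have hΔh : (fun o => h o * Δ o) =O[l] Δ := by simpa using bh.mul (isBigO_refl Δ l)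
  have bG := bigO_bdd S.hG hq
  have bl : (fun o => lam' o - lam o) =O[l] Δ := isBigO_of_le _ fun o => by
    rw [hΔ, Real.norm_of_nonneg (by positivity)]
    linarith [norm_nonneg (ζ' o - ζ o)]
  have bGl : (fun o k => Bas.d k • S.G (q0 o) (lam' o - lam o) : Ω → Fin (σ + 1) → V) =O[l] Δ := by
    rw [isBigO_pi]
    intro k
    exact bigO_csmul _ (bigO_clm1 bG bl)
  have bD : (fun o => Z' o - Z o) =O[l] Δ :=
    ((dZ.trans hΔh).sub bGl).congr_left fun o => by simp [hZ, hZ']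
  have u1 := S.uu_one_bdd B hq hp bZ hh'
  have u1' := S.uu_one_bdd B hq hp bZ' hh'
  have us := S.uu_one_sub B (q0 := q0) hp bZ hh'
  have us' := S.uu_one_sub B (q0 := q0) hp bZ' hh'
  have ud : (fun o => S.uu B (q0 o) (p0 o) (h o) (Z' o) 1 - S.uu B (q0 o) (p0 o) (h o) (Z o) 1)
      =O[l] (fun o => h o ^ 2 * Δ o) := by
    have := ((isBigO_refl h l).pow 2).smul (bigO_clm' S.Mi (bigO_clm' (B.Xi 0) bD))
    refine (this.congr_left fun o => ?_)
    simp only [uu_one, map_sub]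
    module
  have gl := S.g_lin u1 u1' hq us us' ud
  have t1 : (fun o => (2 / h o ^ 2) • N0 o (S.g (S.uu B (q0 o) (p0 o) (h o) (Z' o) 1) -
      S.g (S.uu B (q0 o) (p0 o) (h o) (Z o) 1) - fderiv ℝ S.g (q0 o)
        (S.uu B (q0 o) (p0 o) (h o) (Z' o) 1 - S.uu B (q0 o) (p0 o) (h o) (Z o) 1))) =O[l]
      (fun o => h o * Δ o) := by
    refine ((isBigO_refl (fun o => 2 / h o ^ 2) l).smul (bigO_clm hN gl)).trans ?_
    refine IsBigO.of_bound 2 ?_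
    filter_upwards [hh] with o ho
    have h0 := ho.1.ne'
    refine le_of_eq ?_
    rw [show (2 / h o ^ 2) • (1 * (h o * (h o ^ 2 * Δ o))) = 2 * (h o * Δ o) by
      simp only [smul_eq_mul]; field_simp]
    rw [norm_mul]; norm_num
  have bg := bigO_bdd S.hg1 hq
  have t2 : (fun o => (2 : ℝ) • N0 o (fderiv ℝ S.g (q0 o) (S.Mi (B.Xi 0
      (Z' o - Z o + fun k => Bas.d k • S.G (q0 o) (lam' o - lam o)))))) =O[l]
      (fun o => h o * Δ o) := by
    exact bigO_csmul 2 (bigO_clm1 hN (bigO_clm1 bg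
      (bigO_clm' S.Mi (bigO_clm' (B.Xi 0) dZ))))
  refine (t1.add t2).congr' ?_ EventuallyEq.rfl
  filter_upwards [hh] with o ho
  have h0 := ho.1.ne'
  have e1 : S.uu B (q0 o) (p0 o) (h o) (Z' o) 1 - S.uu B (q0 o) (p0 o) (h o) (Z o) 1 =
      (h o ^ 2) • S.Mi (B.Xi 0 (Z' o - Z o)) := by
    simp only [uu_one, map_sub]
    module
  rw [e1, map_add, B.Xi_d]
  simp only [lp, A, hZ, hZ', map_sub, map_add, map_smul, _root_.sub_apply, ContinuousLinearMap.comp_apply, ContinuousLinearMap.id_apply,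
    smul_sub, smul_add, smul_smul]
  rw [show 2 / h o ^ 2 * h o ^ 2 = 2 by field_simp]
  module

theorem lp_zero (hq : q0 =O[l] (fun _ => (1 : ℝ))) (hp : p0 =O[l] (fun _ => (1 : ℝ)))
    (hN : N0 =O[l] (fun _ => (1 : ℝ)))
    (hg0 : ∀ᶠ o in l, S.g (q0 o) = 0)
    (hw : (fun o => fderiv ℝ S.g (q0 o) (S.Mi (p0 o))) =O[l] h)
    (hh : ∀ᶠ o in l, 0 < h o ∧ h o ≤ 1) :
    (fun o => S.lp B (q0 o) (p0 o) (h o) (N0 o) 0 0) =O[l] (fun _ => (1 : ℝ)) := by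
  have hh' : ∀ᶠ o in l, 0 ≤ h o ∧ h o ≤ 1 := hh.mono fun o ho => ⟨ho.1.le, ho.2⟩
  have z1 : (fun _ : Ω => (0 : Fin (σ + 1) → V)) =O[l] (fun _ => (1 : ℝ)) := isBigO_zero _ _
  have z2 : (fun _ : Ω => (0 : L)) =O[l] (fun _ => (1 : ℝ)) := isBigO_zero _ _
  set Z : Ω → Fin (σ + 1) → V := fun o => S.ZZ B (q0 o) (p0 o) (h o) 0 0 with hZ
  have bZ : Z =O[l] (fun _ => (1 : ℝ)) := S.ZZ_bdd B hq hp z1 z2 hh'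
  have u1 := S.uu_one_bdd B hq hp bZ hh'
  have us := S.uu_one_sub B (q0 := q0) hp bZ hh'
  have bh := h_bdd hh'
  have qq : (fun o => q0 o - q0 o) =O[l] h := by simpa using isBigO_zero h l
  have gl := S.g_lin hq u1 hq qq us us
  have t : (fun o => h o • (fderiv ℝ S.g (q0 o) (S.Mi (p0 o)) + h o • fderiv ℝ S.g (q0 o) (S.Mi (B.Xi 0 (Z o))))) =O[l]
     (fun o => h o * h o) := by
    refine (isBigO_refl h l).smul (hw.add ?_)
    simpa using (isBigO_refl h l).smul (bigO_clm (bigO_bdd S.hg1 hq)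
      (bigO_clm' S.Mi (bigO_clm' (B.Xi 0) bZ)))
  have t3 := (isBigO_refl (fun o => 2 / h o ^ 2) l).smul (bigO_clm hN (gl.add t))
  have t4 : (fun o => (2 / h o ^ 2) • (1 * (h o * h o))) =O[l] (fun _ => (1 : ℝ)) := by
    refine IsBigO.of_bound 2 ?_
    filter_upwards [hh] with o ho
    have h0 := ho.1.ne'
    rw [show (2 / h o ^ 2) • (1 * (h o * h o)) = 2  by
      simp only [smul_eq_mul]; field_simp]
    norm_num
  refine (t3.trans t4).congr' ?_ EventuallyEq.rfl
  filter_upwards [hg0] with o ho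
  simp only [lp, ho, zero_add]
  congr 2
  simp only [← hZ, uu_one, add_sub_cancel_left, map_add, map_smul]
  module

theorem lp_bdd (hq : q0 =O[l] (fun _ => (1 : ℝ))) (hp : p0 =O[l] (fun _ => (1 : ℝ)))
    (hN : N0 =O[l] (fun _ => (1 : ℝ)))
    (hζ : ζ =O[l] (fun _ => (1 : ℝ))) (hl : lam =O[l] (fun _ => (1 : ℝ)))
    (hg0 : ∀ᶠ o in l, S.g (q0 o) = 0)
    (hw : (fun o => fderiv ℝ S.g (q0 o) (S.Mi (p0 o))) =O[l] h)
    (hh : ∀ᶠ o in l, 0 < h o ∧ h o ≤ 1) :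
    (fun o => S.lp B (q0 o) (p0 o) (h o) (N0 o) (ζ o) (lam o)) =O[l] (fun _ => (1 : ℝ)) := by
  have hh' : ∀ᶠ o in l, 0 ≤ h o ∧ h o ≤ 1 := hh.mono fun o ho => ⟨ho.1.le, ho.2⟩
  have z1 : (fun _ : Ω => (0 : Fin (σ + 1) → V)) =O[l] (fun _ => (1 : ℝ)) := isBigO_zero _ _
  have z2 : (fun _ : Ω => (0 : L)) =O[l] (fun _ => (1 : ℝ)) := isBigO_zero _ _
  have h1 := S.lp_diff B hq hp hN z1 z2 hζ hl hh
  have h2 := S.lp_zero B hq hp hN hg0 hw hh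
  have h3 : (fun o => h o * (‖ζ o - 0‖ + ‖lam o - 0‖)) =O[l] (fun _ => (1 : ℝ)) := by
    simpa using (h_bdd hh').mul (hζ.norm_left.add hl.norm_left)
  have h4 : (fun o => (ContinuousLinearMap.id ℝ L - (N0 o).comp (S.A (q0 o))) (lam o)) =O[l]
      (fun _ => (1 : ℝ)) := by
    have := hl.sub (bigO_clm1 hN (bigO_clm1 (bigO_bdd S.hA hq) hl))
    simpa using this
  refine (((h1.trans h3).add h2).add h4).congr_left fun o => ?_
  simp only [sub_zero]
  abel

end CSys
end Exist

open MeasureTheory Matrix Set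
open scoped ContDiff Topology
open Asymptotics Filter

section Exist2

theorem fp_ball {E : Type*} [NormedAddCommGroup E] [CompleteSpace E] (f : E → E) (R : ℝ)
    (hR : 0 ≤ R) (h0 : ‖f 0‖ ≤ R / 2)
    (hl : ∀ x y, ‖x‖ ≤ R → ‖y‖ ≤ R → ‖f y - f x‖ ≤ 1 / 2 * ‖y - x‖) :
    ∃ x, ‖x‖ ≤ R ∧ f x = x := by
  have hm : MapsTo f (Metric.closedBall 0 R) (Metric.closedBall 0 R) := by
    intro x hx
    simp only [Metric.mem_closedBall, dist_zero_right] at hx ⊢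
    have h1 := hl 0 x (by simpa using hR) hx
    have h2 := norm_add_le (f x - f 0) (f 0)
    simp only [sub_add_cancel, sub_zero] at h1 h2
    linarith
  have hc : ContractingWith (1 / 2) (hm.restrict f _ _) := by
    refine ⟨by rw [← NNReal.coe_lt_coe]; norm_num, LipschitzWith.of_dist_le_mul ?_⟩
    rintro ⟨x, hx⟩ ⟨y, hy⟩
    simp only [Metric.mem_closedBall, dist_zero_right] at hx hy
    simp only [Subtype.dist_eq, MapsTo.val_restrict_apply, dist_eq_norm]
    simpa using hl y x hy hx
  obtain ⟨y, hy, hf, -⟩ := hc.exists_fixedPoint' Metric.isClosed_closedBall.isComplete hm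
    (x := 0) (by simpa using hR) (edist_ne_top _ _)
  exact ⟨y, by simpa using hy, hf⟩

variable {σ : ℕ} (B : Bas σ)
variable {V L : Type*} [NormedAddCommGroup V] [NormedSpace ℝ V] 
  [NormedAddCommGroup L] [NormedSpace ℝ L] 
variable (S : CSys V L)
namespace CSys

def IsStep (q0 p0 : V) (h : ℝ) (ζ : Fin (σ + 1) → V) (lam : L) : Prop :=
  ζ = S.ZZ B q0 p0 h ζ lam ∧ S.g (S.uu B q0 p0 h ζ 1) = 0

variable [FiniteDimensional ℝ V] [FiniteDimensional ℝ L]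

theorem inj_of_approx {N0 A : L →L[ℝ] L} (h : ‖ContinuousLinearMap.id ℝ L - N0.comp A‖ < 1) :
    Function.Injective N0 := by
  have h1 : Function.Injective (N0.comp A : L →ₗ[ℝ] L) := by
    rw [← LinearMap.ker_eq_bot, LinearMap.ker_eq_bot']
    intro x hx
    have h2 := (ContinuousLinearMap.id ℝ L - N0.comp A).le_opNorm x
    have h3 : (N0.comp A) x = 0 := hx
    rw [_root_.sub_apply, h3] at h2
    simp only [ContinuousLinearMap.id_apply, sub_zero] at h2
    by_contra hne
    have := norm_pos_iff.2 hne
    nlinarith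
  have h2 := LinearMap.surjective_of_injective h1
  have h3 : Function.Surjective (N0 : L →ₗ[ℝ] L) := fun y => by
    obtain ⟨x, hx⟩ := h2 y
    exact ⟨A x, hx⟩
  exact LinearMap.injective_iff_surjective.2 h3

theorem exists_step (ρ Λ : ℝ) : ∃ ε > 0, ∃ R : ℝ, ∃ h0 > 0, ∀ (q0 p0 : V) (N0 : L →L[ℝ] L) (h : ℝ),
    ‖q0‖ ≤ ρ → ‖p0‖ ≤ ρ → ‖N0‖ ≤ Λ → S.g q0 = 0 →
    ‖ContinuousLinearMap.id ℝ L - N0.comp (S.A q0)‖ ≤ ε →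
    ‖fderiv ℝ S.g q0 (S.Mi p0)‖ ≤ h → 0 < h → h ≤ h0 →
    ∃ (ζ : Fin (σ + 1) → V) (lam : L), ‖ζ‖ ≤ R ∧ ‖lam‖ ≤ R ∧ S.IsStep B q0 p0 h ζ lam := by
  obtain ⟨CG, hCG⟩ := ball_smooth S.G S.hG ρ
  obtain ⟨CG, hCG0, hCG⟩ : ∃ CG : ℝ, 0 ≤ CG ∧ ∀ x, ‖x‖ ≤ ρ → ‖S.G x‖ ≤ CG :=
    ⟨max CG 0, le_max_right _ _, fun x hx => (hCG x x hx hx).1.trans (le_max_left _ _)⟩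
  let Θ : V × V × ℝ × (L →L[ℝ] L) → (Fin (σ + 1) → V) × L → (Fin (σ + 1) → V) × L :=
    fun d z => (S.ZZ B d.1 d.2.1 d.2.2.1 z.1 (S.lp B d.1 d.2.1 d.2.2.1 d.2.2.2 z.1 z.2),
      S.lp B d.1 d.2.1 d.2.2.1 d.2.2.2 z.1 z.2)
  let s0 : Set (V × V × ℝ × (L →L[ℝ] L)) := {d | ‖d.1‖ ≤ ρ ∧ ‖d.2.1‖ ≤ ρ ∧ ‖d.2.2.2‖ ≤ Λ ∧
    S.g d.1 = 0 ∧ ‖fderiv ℝ S.g d.1 (S.Mi d.2.1)‖ ≤ d.2.2.1 ∧ 0 < d.2.2.1 ∧ d.2.2.1 ≤ 1}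
  have hΘ0 : (fun d => Θ d 0) =O[𝓟 s0] (fun _ => (1 : ℝ)) := by
    have a1 : (fun d : V × V × ℝ × (L →L[ℝ] L) => d.1) =O[𝓟 s0] (fun _ => (1 : ℝ)) :=
      isBigO_principal.2 ⟨ρ, fun x hx => by simpa using hx.1⟩
    have a2 : (fun d : V × V × ℝ × (L →L[ℝ] L) => d.2.1) =O[𝓟 s0] (fun _ => (1 : ℝ)) :=
      isBigO_principal.2 ⟨ρ, fun x hx => by simpa using hx.2.1⟩
    have a3 : (fun d : V × V × ℝ × (L →L[ℝ] L) => d.2.2.2) =O[𝓟 s0] (fun _ => (1 : ℝ)) :=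
      isBigO_principal.2 ⟨Λ, fun x hx => by simpa using hx.2.2.1⟩
    have a4 : ∀ᶠ d in 𝓟 s0, S.g d.1 = 0 := by
      rw [eventually_principal]; exact fun x hx => hx.2.2.2.1
    have a5 : (fun d : V × V × ℝ × (L →L[ℝ] L) => fderiv ℝ S.g d.1 (S.Mi d.2.1))
        =O[𝓟 s0] (fun d => d.2.2.1) :=
      isBigO_principal.2 ⟨1, fun x hx => by
        rw [one_mul]; exact hx.2.2.2.2.1.trans (le_abs_self _)⟩
    have a6 : ∀ᶠ d in 𝓟 s0, 0 < d.2.2.1 ∧ d.2.2.1 ≤ 1 := by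
      rw [eventually_principal]; exact fun x hx => hx.2.2.2.2.2
    have b1 := S.lp_zero B a1 a2 a3 a4 a5 a6
    exact (S.ZZ_bdd B a1 a2 (isBigO_zero _ _) b1
      (a6.mono fun d hd => ⟨hd.1.le, hd.2⟩)).prod_left b1
  obtain ⟨C0, hC0⟩ := isBigO_principal.1 hΘ0
  let R : ℝ := 2 * max C0 0
  have hR : 0 ≤ R := by positivity
  let s1 : Set ((V × V × ℝ × (L →L[ℝ] L)) × ((Fin (σ + 1) → V) × L) × ((Fin (σ + 1) → V) × L)) :=
    {d | d.1 ∈ s0 ∧ ‖d.2.1‖ ≤ R ∧ ‖d.2.2‖ ≤ R}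
  obtain ⟨C1, C2, hC⟩ : ∃ C1 C2 : ℝ, ∀ d ∈ s1,
      ‖(Θ d.1 d.2.2).2 - (Θ d.1 d.2.1).2 - (ContinuousLinearMap.id ℝ L
        - (d.1.2.2.2).comp (S.A d.1.1)) (d.2.2.2 - d.2.1.2)‖
        ≤ C1 * ‖d.1.2.2.1 * (‖d.2.2.1 - d.2.1.1‖ + ‖d.2.2.2 - d.2.1.2‖)‖ ∧
      ‖(Θ d.1 d.2.2).1 - (Θ d.1 d.2.1).1 + (fun k => Bas.d k • S.G d.1.1
        ((Θ d.1 d.2.2).2 - (Θ d.1 d.2.1).2))‖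
        ≤ C2 * ‖d.1.2.2.1 * (‖d.2.2.1 - d.2.1.1‖ + ‖(Θ d.1 d.2.2).2 - (Θ d.1 d.2.1).2‖)‖ := by
    have a1 : (fun d : (V × V × ℝ × (L →L[ℝ] L)) × ((Fin (σ + 1) → V) × L) × ((Fin (σ + 1) → V) × L) => d.1.1) =O[𝓟 s1] (fun _ => (1 : ℝ)) :=
      isBigO_principal.2 ⟨ρ, fun x hx => by simpa using hx.1.1⟩
    have a2 : (fun d : (V × V × ℝ × (L →L[ℝ] L)) × ((Fin (σ + 1) → V) × L) × ((Fin (σ + 1) → V) × L) => d.1.2.1) =O[𝓟 s1] (fun _ => (1 : ℝ)) :=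
      isBigO_principal.2 ⟨ρ, fun x hx => by simpa using hx.1.2.1⟩
    have a3 : (fun d : (V × V × ℝ × (L →L[ℝ] L)) × ((Fin (σ + 1) → V) × L) × ((Fin (σ + 1) → V) × L) => d.1.2.2.2) =O[𝓟 s1] (fun _ => (1 : ℝ)) :=
      isBigO_principal.2 ⟨Λ, fun x hx => by simpa using hx.1.2.2.1⟩
    have a4 : ∀ᶠ d in 𝓟 s1, S.g d.1.1 = 0 := by
      rw [eventually_principal]; exact fun x hx => hx.1.2.2.2.1
    have a5 : (fun d : (V × V × ℝ × (L →L[ℝ] L)) × ((Fin (σ + 1) → V) × L) × ((Fin (σ + 1) → V) × L) => fderiv ℝ S.g d.1.1 (S.Mi d.1.2.1))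
        =O[𝓟 s1] (fun d => d.1.2.2.1) :=
      isBigO_principal.2 ⟨1, fun x hx => by
        rw [one_mul]; exact hx.1.2.2.2.2.1.trans (le_abs_self _)⟩
    have a6 : ∀ᶠ d in 𝓟 s1, 0 < d.1.2.2.1 ∧ d.1.2.2.1 ≤ 1 := by
      rw [eventually_principal]; exact fun x hx => hx.1.2.2.2.2.2
    have a6' : ∀ᶠ d in 𝓟 s1, 0 ≤ d.1.2.2.1 ∧ d.1.2.2.1 ≤ 1 :=
      a6.mono fun d hd => ⟨hd.1.le, hd.2⟩
    have c1 : (fun d : (V × V × ℝ × (L →L[ℝ] L)) × ((Fin (σ + 1) → V) × L) × ((Fin (σ + 1) → V) × L) => d.2.1) =O[𝓟 s1] (fun _ => (1 : ℝ)) :=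
      isBigO_principal.2 ⟨R, fun x hx => by simpa using hx.2.1⟩
    have c2 : (fun d : (V × V × ℝ × (L →L[ℝ] L)) × ((Fin (σ + 1) → V) × L) × ((Fin (σ + 1) → V) × L) => d.2.2) =O[𝓟 s1] (fun _ => (1 : ℝ)) :=
      isBigO_principal.2 ⟨R, fun x hx => by simpa using hx.2.2⟩
    have c11 := isBigO_fst_prod.trans c1
    have c12 := isBigO_snd_prod.trans c1
    have c21 := isBigO_fst_prod.trans c2
    have c22 := isBigO_snd_prod.trans c2
    have e1 := S.lp_diff B a1 a2 a3 c11 c12 c21 c22 a6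
    have l1 := S.lp_bdd B a1 a2 a3 c11 c12 a4 a5 a6
    have l2 := S.lp_bdd B a1 a2 a3 c21 c22 a4 a5 a6
    have e2 := S.ZZ_diff B a1 a2 c11 l1 c21 l2 a6'
    obtain ⟨C1, h1⟩ := isBigO_principal.1 e1
    obtain ⟨C2, h2⟩ := isBigO_principal.1 e2
    exact ⟨C1, C2, fun d hd => ⟨h1 d hd, h2 d hd⟩⟩
  let ε : ℝ := 1 / (16 * (1 + CG))
  have hε : 0 < ε := by positivity
  have hε1 : ε ≤ 1 / 16 := by
    apply one_div_le_one_div_of_le <;> linarith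
  have hεG : CG * ε ≤ 1 / 16 := by
    rw [mul_one_div, div_le_div_iff₀] <;> nlinarith
  let D : ℝ := |C1| + |C2| + 1
  have hD : 0 < D := by positivity
  refine ⟨ε, hε, R, min 1 (ε / (2 * D)), by positivity, ?_⟩
  intro q0 p0 N0 h hq hp hN hg hA hw hpos hh0
  have hh1 : h ≤ 1 := hh0.trans (min_le_left _ _)
  have hhD : h * (2 * D) ≤ ε := (le_div_iff₀ (by positivity)).1 (hh0.trans (min_le_right _ _))
  let d : V × V × ℝ × (L →L[ℝ] L) := (q0, p0, h, N0)
  have hd : d ∈ s0 := ⟨hq, hp, hN, hg, hw, hpos, hh1⟩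
  obtain ⟨z, hz, hfz⟩ := fp_ball (Θ d) R hR (by
    have := hC0 d hd
    have h2 := le_max_left C0 0
    simp only [norm_one, mul_one] at this
    show _ ≤ 2 * max C0 0 / 2
    linarith) (by
    intro x y hx hy
    obtain ⟨e1, e2⟩ := hC (d, x, y) ⟨hd, hx, hy⟩
    set δ := ‖y - x‖
    have hδ : 0 ≤ δ := norm_nonneg _
    have dx1 : ‖y.1 - x.1‖ ≤ δ := norm_fst_le (y - x)
    have dx2 : ‖y.2 - x.2‖ ≤ δ := norm_snd_le (y - x)
    simp only at e1 e2
    set l2 := (Θ d y).2 - (Θ d x).2 with hl2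
    set z2 := (Θ d y).1 - (Θ d x).1 with hz2
    have n1 : ‖l2‖ ≤ 2 * ε * δ := by
      have h1 := norm_add_le (l2 - (ContinuousLinearMap.id ℝ L - N0.comp (S.A q0)) (y.2 - x.2))
        ((ContinuousLinearMap.id ℝ L - N0.comp (S.A q0)) (y.2 - x.2))
      rw [sub_add_cancel] at h1
      have h2 : ‖(ContinuousLinearMap.id ℝ L - N0.comp (S.A q0)) (y.2 - x.2)‖ ≤ ε * δ :=
        ContinuousLinearMap.le_of_opNorm_le_of_le _ hA dx2
      have h3 : C1 * ‖h * (‖y.1 - x.1‖ + ‖y.2 - x.2‖)‖ ≤ ε * δ := by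
        rw [norm_mul, Real.norm_of_nonneg hpos.le, Real.norm_of_nonneg (by positivity)]
        calc C1 * (h * (‖y.1 - x.1‖ + ‖y.2 - x.2‖)) ≤ D * (h * (δ + δ)) := by
              gcongr
              exact (le_abs_self C1).trans (by simp only [D]; linarith [abs_nonneg C2])
          _ = (h * (2 * D)) * δ := by ring
          _ ≤ _ := by gcongr
      linarith [e1.trans h3]
    have n2 : ‖z2‖ ≤ 1 / 2 * δ := by
      have h1 := norm_sub_le (z2 + fun k => Bas.d k • S.G q0 l2)
        (fun k : Fin (σ + 1) => Bas.d k • S.G q0 l2)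
      rw [add_sub_cancel_right] at h1
      have h2 : ‖(fun k : Fin (σ + 1) => Bas.d k • S.G q0 l2)‖ ≤ CG * (2 * ε * δ) := by
        rw [pi_norm_le_iff_of_nonneg (by positivity)]
        intro k
        rw [norm_smul]
        have h3 : ‖S.G q0 l2‖ ≤ CG * (2 * ε * δ) :=
          ContinuousLinearMap.le_of_opNorm_le_of_le _ (hCG _ hq) n1
        have h4 : ‖(Bas.d k : ℝ)‖ ≤ 1 := by unfold Bas.d; split_ifs <;> simp
        nlinarith [norm_nonneg (S.G q0 l2), norm_nonneg (Bas.d k : ℝ)]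
      have h3 : C2 * ‖h * (‖y.1 - x.1‖ + ‖l2‖)‖ ≤ 1 / 16 * δ := by
        rw [norm_mul, Real.norm_of_nonneg hpos.le, Real.norm_of_nonneg (by positivity)]
        calc C2 * (h * (‖y.1 - x.1‖ + ‖l2‖)) ≤ D * (h * (δ + δ)) := by
              gcongr
              · exact (le_abs_self C2).trans (by simp only [D]; linarith [abs_nonneg C1])
              · nlinarith
          _ = (h * (2 * D)) * δ := by ring
          _ ≤ _ := by gcongr; exact hhD.trans hε1
      have h4 : CG * (2 * ε * δ) ≤ 1 / 8 * δ := by nlinarith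
      linarith [e2.trans h3]
    exact (max_le n2 (n1.trans (by nlinarith)) : max _ _ ≤ _))
  obtain ⟨ζ, lam⟩ := z
  have f1 : S.lp B q0 p0 h N0 ζ lam = lam := congrArg Prod.snd hfz
  have f2 : S.ZZ B q0 p0 h ζ (S.lp B q0 p0 h N0 ζ lam) = ζ := congrArg Prod.fst hfz
  rw [f1] at f2
  refine ⟨ζ, lam, (norm_fst_le _).trans hz, (norm_snd_le _).trans hz, f2.symm, ?_⟩
  unfold lp at f1
  rw [f2] at f1
  have f3 := add_eq_left.1 f1
  rw [smul_eq_zero_iff_right (by positivity)] at f3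
  exact (inj_of_approx (lt_of_le_of_lt hA (by linarith))) (by rw [f3, map_zero])

end CSys
end Exist2

open MeasureTheory Matrix Set
open scoped ContDiff Topology
open Asymptotics Filter

section StepEst
variable {σ : ℕ} (B : Bas σ)
variable {V L : Type*} [NormedAddCommGroup V] [NormedSpace ℝ V] 
  [NormedAddCommGroup L] [NormedSpace ℝ L] 
variable (S : CSys V L)

noncomputable def Bas.mo (k : Fin (σ + 1)) : ℝ := ∫ c in (0 : ℝ)..1, B.P k c * c

noncomputable def Bas.cs : ℝ := ∑ k, B.X 0 k * B.mo k - 1 / 4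

theorem Bas.mo_zero : B.mo 0 = 1 / 2 := by simp [Bas.mo, B.P0]

variable {Ω : Type*} {l : Filter Ω} {q0 p0 : Ω → V} {h : Ω → ℝ} 
  {ζ : Ω → Fin (σ + 1) → V} {lam : Ω → L}

theorem hpow (hh : ∀ᶠ o in l, 0 < h o ∧ h o ≤ 1) {a b : ℕ} (hab : a ≤ b) :
    (fun o => h o ^ b) =O[l] (fun o => h o ^ a) := by
  refine IsBigO.of_bound 1 ?_
  filter_upwards [hh] with o ho
  rw [norm_pow, norm_pow, one_mul, Real.norm_of_nonneg ho.1.le]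
  exact pow_le_pow_of_le_one ho.1.le ho.2 hab

variable [FiniteDimensional ℝ V] [FiniteDimensional ℝ L]
namespace CSys

structure StepData (B : Bas σ) (S : CSys V L) (l : Filter Ω) (q0 p0 : Ω → V) (h : Ω → ℝ)
    (ζ : Ω → Fin (σ + 1) → V) (lam : Ω → L) : Prop where
  hq : q0 =O[l] (fun _ => (1 : ℝ))
  hp : p0 =O[l] (fun _ => (1 : ℝ))
  hζ : ζ =O[l] (fun _ => (1 : ℝ))
  hl : lam =O[l] (fun _ => (1 : ℝ))
  hh : ∀ᶠ o in l, 0 < h o ∧ h o ≤ 1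
  g0 : ∀ᶠ o in l, S.g (q0 o) = 0
  st : ∀ᶠ o in l, S.IsStep B (q0 o) (p0 o) (h o) (ζ o) (lam o)

namespace StepData
variable {B S}

theorem hh' (H : StepData B S l q0 p0 h ζ lam) : ∀ᶠ o in l, 0 ≤ h o ∧ h o ≤ 1 := H.hh.mono fun _ ho => ⟨ho.1.le, ho.2⟩

theorem F_exp (H : StepData B S l q0 p0 h ζ lam) : (fun z : Ω × ℝ => S.F (S.uu B (q0 z.1) (p0 z.1) (h z.1) (ζ z.1) z.2, lam z.1)
      - S.F (q0 z.1, lam z.1) - (h z.1 * z.2) • S.DF (q0 z.1, p0 z.1, lam z.1))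
      =O[l ×ˢ 𝓟 (Icc (0 : ℝ) 1)] (fun z => h z.1 ^ 2) := by
  have u1 := S.uu_bdd B H.hq H.hp H.hζ H.hh'
  have us := S.uu_sub B (q0 := q0) H.hp H.hζ H.hh'
  have x1 := (lift_fst H.hq).prod_left (lift_fst H.hl)
  have t1 := bigO_taylor S.hF x1 (u1.prod_left (lift_fst H.hl))
  have hF' : ContDiff ℝ ∞ (fderiv ℝ S.F) := S.hF.fderiv_right (by simp)
  have t2 : (fun z : Ω × ℝ => ‖(S.uu B (q0 z.1) (p0 z.1) (h z.1) (ζ z.1) z.2, lam z.1) -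
      (q0 z.1, lam z.1)‖ ^ 2) =O[l ×ˢ 𝓟 (Icc (0 : ℝ) 1)] (fun z => h z.1 ^ 2) := by
    refine IsBigO.pow (IsBigO.norm_left ?_) 2
    simp only [Prod.mk_sub_mk, sub_self]
    exact us.prod_left (isBigO_zero _ _)
  have t3 : (fun z : Ω × ℝ => h z.1 ^ 2 • fderiv ℝ S.F (q0 z.1, lam z.1)
      (S.Mi (B.Ups z.2 (ζ z.1)), 0)) =O[l ×ˢ 𝓟 (Icc (0 : ℝ) 1)] (fun z => h z.1 ^ 2) := by
    have := bigO_clm1 (bigO_bdd hF' x1)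
      ((bigO_clm' S.Mi (Ups_bigO B H.hζ)).prod_left (isBigO_zero (fun _ => (1 : ℝ)) _))
    simpa using (isBigO_refl (fun z : Ω × ℝ => h z.1 ^ 2) _).smul this
  refine ((t1.trans t2).add t3).congr_left fun z => ?_
  have e : ((S.uu B (q0 z.1) (p0 z.1) (h z.1) (ζ z.1) z.2, lam z.1) - (q0 z.1, lam z.1) : V × L)
      = (h z.1 * z.2) • (S.Mi (p0 z.1), 0) + h z.1 ^ 2 • (S.Mi (B.Ups z.2 (ζ z.1)), 0) := by
    ext
    · simp only [uu_eq, Prod.mk_sub_mk, Prod.smul_mk, Prod.mk_add_mk]; module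
    · simp
  rw [e, map_add, map_smul, map_smul]
  simp only [DF]
  abel

theorem zeta_exp (H : StepData B S l q0 p0 h ζ lam) : (fun o => ζ o + (fun k => Bas.d k • S.F (q0 o, lam o))
      + h o • (fun k => B.mo k • S.DF (q0 o, p0 o, lam o))) =O[l] (fun o => h o ^ 2) := by
  rw [isBigO_pi]
  intro k
  refine (bigO_integral (Φ := fun o c => S.F (S.uu B (q0 o) (p0 o) (h o) (ζ o) c, lam o)
    - S.F (q0 o, lam o) - (h o * c) • S.DF (q0 o, p0 o, lam o)) (b := fun o => h o ^ 2)
    (B.hP k) H.F_exp).neg_left.congr' ?_ EventuallyEq.rfl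
  filter_upwards [H.st] with o ho
  have hk : ζ o k = -∫ c in (0 : ℝ)..1, B.P k c • S.F (S.uu B (q0 o) (p0 o) (h o) (ζ o) c, lam o) := by
    conv_lhs => rw [ho.1]
    rfl
  have e2 : ∀ c, B.P k c • (h o * c) • S.DF (q0 o, p0 o, lam o)
      = (B.P k c * c) • h o • S.DF (q0 o, p0 o, lam o) := fun c => by module
  simp only [smul_sub, e2]
  have hc := B.hP k
  have i1 : IntervalIntegrable (fun c => B.P k c • S.F (q0 o, lam o)) volume 0 1 :=
    Continuous.intervalIntegrable (by fun_prop) _ _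
  have i2 : IntervalIntegrable (fun c => (B.P k c * c) • h o • S.DF (q0 o, p0 o, lam o)) volume 0 1 :=
    Continuous.intervalIntegrable (by fun_prop) _ _
  rw [intervalIntegral.integral_sub ((S.F_int ..).sub i1) i2,
    intervalIntegral.integral_sub (S.F_int ..) i1,
    intervalIntegral.integral_smul_const, intervalIntegral.integral_smul_const, B.intP_eq]
  simp only [Pi.add_apply, Pi.smul_apply, hk, Bas.mo]
  module

theorem bDF (H : StepData B S l q0 p0 h ζ lam) : (fun o => S.DF (q0 o, p0 o, lam o)) =O[l] (fun _ => (1 : ℝ)) :=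
  bigO_bdd S.hDF (H.hq.prod_left (H.hp.prod_left H.hl))

theorem bF (H : StepData B S l q0 p0 h ζ lam) : (fun o => S.F (q0 o, lam o)) =O[l] (fun _ => (1 : ℝ)) :=
  bigO_bdd S.hF (H.hq.prod_left H.hl)

theorem z0_exp (H : StepData B S l q0 p0 h ζ lam) : (fun o => ζ o 0 + S.F (q0 o, lam o)
      + (h o / 2) • S.DF (q0 o, p0 o, lam o)) =O[l] (fun o => h o ^ 2) := by
  refine ((isBigO_pi.1 H.zeta_exp) 0).congr_left fun o => ?_
  simp only [Pi.add_apply, Pi.smul_apply, B.mo_zero, Bas.d, if_true]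
  module

theorem F1_exp (H : StepData B S l q0 p0 h ζ lam) : (fun o => S.F (S.uu B (q0 o) (p0 o) (h o) (ζ o) 1, lam o)
      - S.F (q0 o, lam o) - h o • S.DF (q0 o, p0 o, lam o)) =O[l] (fun o => h o ^ 2) := by
  have ht : Tendsto (fun o : Ω => (o, (1 : ℝ))) l (l ×ˢ 𝓟 (Icc (0 : ℝ) 1)) := by
    refine tendsto_id.prodMk ?_
    rw [tendsto_principal]
    exact Eventually.of_forall fun _ => by simp
  simpa [Function.comp_def] using H.F_exp.comp_tendsto ht

theorem z0_trap (H : StepData B S l q0 p0 h ζ lam) : (fun o => ζ o 0 + (1 / 2 : ℝ) • (S.F (q0 o, lam o) +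
      S.F (S.uu B (q0 o) (p0 o) (h o) (ζ o) 1, lam o))) =O[l] (fun o => h o ^ 2) := by
  refine (H.z0_exp.add (bigO_csmul (1 / 2) H.F1_exp)).congr_left fun o => ?_
  module

theorem z0_lin (H : StepData B S l q0 p0 h ζ lam) : (fun o => ζ o 0 + S.F (q0 o, lam o)) =O[l] h := by
  have h1 := hpow H.hh (a := 1) (b := 2) (by norm_num)
  have h2 : (fun o => (h o / 2) • S.DF (q0 o, p0 o, lam o)) =O[l] (fun o => h o ^ 1) := by
    have := bigO_csmul (1 / 2) ((isBigO_refl h l).smul H.bDF)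
    refine (this.congr_left fun o => ?_).congr_right fun o => by simp
    module
  refine ((H.z0_exp.trans h1).sub h2).congr (fun o => ?_) (fun o => pow_one _)
  abel

theorem r_exp (H : StepData B S l q0 p0 h ζ lam) : (fun o => B.Xi 0 (ζ o) - (1 / 2 : ℝ) • ζ o 0
      + (h o * B.cs) • S.DF (q0 o, p0 o, lam o)) =O[l] (fun o => h o ^ 2) := by
  have h1 := bigO_clm' (B.Xi 0) H.zeta_exp
  refine (h1.sub (bigO_csmul (1 / 2) H.z0_exp)).congr_left fun o => ?_
  rw [map_add, map_add, B.Xi_d, map_smul]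
  have : B.Xi 0 (fun k => B.mo k • S.DF (q0 o, p0 o, lam o))
      = (∑ k, B.X 0 k * B.mo k) • S.DF (q0 o, p0 o, lam o) := by
    rw [B.Xi_apply, Finset.sum_smul]
    exact Finset.sum_congr rfl fun k _ => by module
  rw [this, Bas.cs]
  module

theorem r_lin (H : StepData B S l q0 p0 h ζ lam) : (fun o => B.Xi 0 (ζ o) - (1 / 2 : ℝ) • ζ o 0) =O[l] h := by
  have h1 := hpow H.hh (a := 1) (b := 2) (by norm_num)
  have h2 : (fun o => (h o * B.cs) • S.DF (q0 o, p0 o, lam o)) =O[l] (fun o => h o ^ 1) := by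
    have := bigO_csmul B.cs ((isBigO_refl h l).smul H.bDF)
    refine (this.congr_left fun o => ?_).congr_right fun o => by simp
    module
  refine ((H.r_exp.trans h1).sub h2).congr (fun o => ?_) (fun o => pow_one _)
  abel

theorem q1_sub (H : StepData B S l q0 p0 h ζ lam) : (fun o => S.uu B (q0 o) (p0 o) (h o) (ζ o) 1 - q0 o) =O[l] h :=
  S.uu_one_sub B H.hp H.hζ H.hh'

theorem q1_bdd (H : StepData B S l q0 p0 h ζ lam) : (fun o => S.uu B (q0 o) (p0 o) (h o) (ζ o) 1) =O[l] (fun _ => (1 : ℝ)) :=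
  S.uu_one_bdd B H.hq H.hp H.hζ H.hh'

theorem bz0 (H : StepData B S l q0 p0 h ζ lam) : (fun o => ζ o 0) =O[l] (fun _ => (1 : ℝ)) := (isBigO_pi.1 H.hζ) 0

theorem p1_bdd (H : StepData B S l q0 p0 h ζ lam) : (fun o => p0 o + h o • ζ o 0) =O[l] (fun _ => (1 : ℝ)) := by
  refine H.hp.add ?_
  simpa using (h_bdd H.hh').smul H.bz0

theorem dg_exp (H : StepData B S l q0 p0 h ζ lam) : (fun o => fderiv ℝ S.g (S.uu B (q0 o) (p0 o) (h o) (ζ o) 1) - fderiv ℝ S.g (q0 o)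
      - h o • fderiv ℝ (fderiv ℝ S.g) (q0 o) (S.Mi (p0 o))) =O[l] (fun o => h o ^ 2) := by
  have t1 := bigO_taylor S.hg1 H.hq H.q1_bdd
  have t2 := t1.trans (H.q1_sub.norm_left.pow 2)
  have t3 : (fun o => h o ^ 2 • fderiv ℝ (fderiv ℝ S.g) (q0 o) (S.Mi (B.Xi 0 (ζ o)))) =O[l]
      (fun o => h o ^ 2) := by
    have := bigO_clm1 (bigO_bdd S.hg2 H.hq) (bigO_clm' S.Mi (bigO_clm' (B.Xi 0) H.hζ))
    simpa using (isBigO_refl (fun o => h o ^ 2) l).smul this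
  refine (t2.add t3).congr_left fun o => ?_
  simp only [uu_one, add_sub_cancel_left, map_add, map_smul]
  module

theorem dg_lin (H : StepData B S l q0 p0 h ζ lam) : (fun o => fderiv ℝ S.g (S.uu B (q0 o) (p0 o) (h o) (ζ o) 1) - fderiv ℝ S.g (q0 o))
      =O[l] h :=
  (bigO_lip S.hg1 H.hq H.q1_bdd).trans H.q1_sub

end StepData
end CSys
end StepEst

open MeasureTheory Matrix Set
open scoped ContDiff Topology
open Asymptotics Filter

section StepEst2
variable {σ : ℕ} {B : Bas σ}
variable {V L : Type*} [NormedAddCommGroup V] [NormedSpace ℝ V]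
  [NormedAddCommGroup L] [NormedSpace ℝ L]
variable {S : CSys V L}
variable {Ω : Type*} {l : Filter Ω} {q0 p0 : Ω → V} {h : Ω → ℝ}
  {ζ : Ω → Fin (σ + 1) → V} {lam : Ω → L}
variable [FiniteDimensional ℝ V] [FiniteDimensional ℝ L]
namespace CSys
namespace StepData

set_option maxSynthPendingDepth 3 in
theorem w_raw (H : StepData B S l q0 p0 h ζ lam) : (fun o => fderiv ℝ S.g (q0 o) (S.Mi (p0 o) + h o • S.Mi (B.Xi 0 (ζ o)))
      + fderiv ℝ S.g (S.uu B (q0 o) (p0 o) (h o) (ζ o) 1) (S.Mi (p0 o) + h o • S.Mi (B.Xi 0 (ζ o)))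
      - (h o ^ 2 / 6) • fderiv ℝ (fderiv ℝ (fderiv ℝ S.g)) (q0 o)
        (S.Mi (p0 o)) (S.Mi (p0 o)) (S.Mi (p0 o))) =O[l] (fun o => h o ^ 3) := by
  have hMp := bigO_clm' S.Mi H.hp
  have hX : (fun o => h o • S.Mi (B.Xi 0 (ζ o))) =O[l] h := by
    simpa using (isBigO_refl h l).smul (bigO_clm' S.Mi (bigO_clm' (B.Xi 0) H.hζ))
  have ha := hMp.add (hX.trans (h_bdd H.hh'))
  have T := bigO_trap S.hg H.hq ha H.hh'
  have hΦ : ContDiff ℝ ∞ (fun z : V × V => fderiv ℝ (fderiv ℝ (fderiv ℝ S.g)) z.1 z.2 z.2 z.2) := by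
    have := S.hg3
    fun_prop
  have T2 := bigO_lip hΦ (H.hq.prod_left hMp) (H.hq.prod_left ha)
  have T3 : (fun o => ((q0 o, S.Mi (p0 o) + h o • S.Mi (B.Xi 0 (ζ o))) - (q0 o, S.Mi (p0 o)) : V × V))
      =O[l] h := by
    simp only [Prod.mk_sub_mk, sub_self, add_sub_cancel_left]
    exact (isBigO_zero _ _).prod_left hX
  have T4 := (isBigO_refl (fun o => h o ^ 2 / 6) l).smul (T2.trans T3)
  have T4' := T4.trans (k := fun o => h o ^ 3) (IsBigO.of_bound 1 (by
    filter_upwards [H.hh] with o ho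
    rw [smul_eq_mul, Real.norm_of_nonneg (by have := ho.1; positivity),
      Real.norm_of_nonneg (by have := ho.1; positivity)]
    nlinarith [pow_pos ho.1 3]))
  have T5 := (isBigO_refl (fun o => 2 * (h o)⁻¹) l).smul T
  have T5' := T5.trans (k := fun o => h o ^ 3) (IsBigO.of_bound 2 (by
    filter_upwards [H.hh] with o ho
    have := ho.1
    rw [smul_eq_mul, Real.norm_of_nonneg (by positivity),
      Real.norm_of_nonneg (by positivity)]
    apply le_of_eq
    field_simp))
  refine (T5'.add T4').congr' ?_ EventuallyEq.rfl
  filter_upwards [H.hh, H.g0, H.st] with o ho g0 st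
  have h0 : h o ≠ 0 := ho.1.ne'
  have g1 := st.2
  rw [uu_one] at g1
  simp only [uu_one]
  rw [g1, g0]
  generalize fderiv ℝ S.g (q0 o + h o • (S.Mi (p0 o) + h o • S.Mi (B.Xi 0 (ζ o)))) = g1'
  generalize S.Mi (p0 o) + h o • S.Mi (B.Xi 0 (ζ o)) = a
  rw [sub_zero, sub_zero, smul_sub, smul_smul, smul_smul, smul_sub]
  have e1 : 2 * (h o)⁻¹ * (h o / 2) = 1 := by field_simp
  have e2 : 2 * (h o)⁻¹ * (h o ^ 3 / 12) = h o ^ 2 / 6 := by field_simp; norm_num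
  rw [e1, e2]
  module

set_option maxSynthPendingDepth 3 in
theorem w_exp (H : StepData B S l q0 p0 h ζ lam) : (fun o => fderiv ℝ S.g (q0 o) (S.Mi (p0 o))
      + fderiv ℝ S.g (S.uu B (q0 o) (p0 o) (h o) (ζ o) 1) (S.Mi (p0 o + h o • ζ o 0))
      - h o ^ 2 • S.dhat B.cs (q0 o, p0 o, lam o)) =O[l] (fun o => h o ^ 3) := by
  have b1 := bigO_bdd S.hg1 H.hq
  have b2 := bigO_bdd S.hg2 H.hq
  have hMp := bigO_clm' S.Mi H.hp
  have X3 := bigO_csmul (1 / 2) ((isBigO_refl h l).smul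
    (bigO_clm H.dg_exp (bigO_clm' S.Mi H.bz0)))
  have X4 := bigO_csmul (1 / 2) ((isBigO_refl (fun o => h o ^ 2) l).smul
    (bigO_clm1 (bigO_clm1 b2 hMp) (bigO_clm' S.Mi H.z0_lin)))
  have X5 := (isBigO_refl h l).smul (bigO_clm H.dg_lin (bigO_clm' S.Mi H.r_lin))
  have X6 := bigO_csmul 2 ((isBigO_refl h l).smul (bigO_clm1 b1 (bigO_clm' S.Mi H.r_exp)))
  have e3 : (fun o => h o • (h o ^ 2 * 1)) = (fun o => h o ^ 3) := by
    funext o; simp only [smul_eq_mul]; ring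
  have e4 : (fun o => h o ^ 2 • h o) = (fun o => h o ^ 3) := by
    funext o; simp only [smul_eq_mul]; ring
  have e5 : (fun o => h o • (h o * h o)) = (fun o => h o ^ 3) := by
    funext o; simp only [smul_eq_mul]; ring
  have e6 : (fun o => h o • h o ^ 2) = (fun o => h o ^ 3) := by
    funext o; simp only [smul_eq_mul]; ring
  rw [e3] at X3
  rw [e4] at X4
  rw [e5] at X5
  rw [e6] at X6
  refine ((((H.w_raw.add X3).add X4).sub X5).sub X6).congr_left fun o => ?_
  generalize fderiv ℝ S.g (S.uu B (q0 o) (p0 o) (h o) (ζ o) 1) = g1'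
  simp only [dhat, map_add, map_sub, map_smul, _root_.sub_apply, _root_.smul_apply, _root_.add_apply]
  module

theorem lam_exp (H : StepData B S l q0 p0 h ζ lam) : (fun o => (2 : ℝ) • fderiv ℝ S.g (q0 o) (S.Mi (p0 o))
      + h o • S.Psi (q0 o, p0 o, lam o)) =O[l] (fun o => h o ^ 2) := by
  have b1 := bigO_bdd S.hg1 H.hq
  have bd := bigO_bdd (S.hdhat B.cs) (H.hq.prod_left (H.hp.prod_left H.hl))
  have X1 := H.w_exp.trans (hpow H.hh (a := 2) (b := 3) (by norm_num))
  have X2 := (isBigO_refl (fun o => h o ^ 2) l).smul bd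
  have X3 := bigO_clm H.dg_exp (bigO_clm' S.Mi H.hp)
  have X4 := (isBigO_refl h l).smul (bigO_clm H.dg_lin (bigO_clm' S.Mi H.bz0))
  have X5 := (isBigO_refl h l).smul (bigO_clm1 b1 (bigO_clm' S.Mi H.z0_lin))
  have e2 : (fun o => h o ^ 2 • (1 : ℝ)) = (fun o => h o ^ 2) := by
    funext o; simp only [smul_eq_mul]; ring
  have e3 : (fun o => h o ^ 2 * (1 : ℝ)) = (fun o => h o ^ 2) := by
    funext o; ring
  have e4 : (fun o => h o • (h o * 1)) = (fun o => h o ^ 2) := by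
    funext o; simp only [smul_eq_mul]; ring
  have e5 : (fun o => h o • h o) = (fun o => h o ^ 2) := by
    funext o; simp only [smul_eq_mul]; ring
  rw [e2] at X2
  rw [e3] at X3
  rw [e4] at X4
  rw [e5] at X5
  refine ((((X1.add X2).sub X3).sub X4).sub X5).congr_left fun o => ?_
  generalize fderiv ℝ S.g (S.uu B (q0 o) (p0 o) (h o) (ζ o) 1) = g1'
  simp only [Psi, map_add, map_smul, _root_.sub_apply, _root_.smul_apply]
  module

end StepData
end CSys
end StepEst2

open MeasureTheory Matrix Set
open scoped ContDiff Topology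
open Asymptotics Filter

section Cmp
variable {σ : ℕ} {B : Bas σ}
variable {V L : Type*} [NormedAddCommGroup V] [NormedSpace ℝ V]
  [NormedAddCommGroup L] [NormedSpace ℝ L]
variable {S : CSys V L}
variable {Ω : Type*} {l : Filter Ω} {q0 p0 : Ω → V} {h t : Ω → ℝ}
  {ζ : Ω → Fin (σ + 1) → V} {lam : Ω → L} {T : ℝ}

theorem BL.bigO {E : Type*} [NormedAddCommGroup E] {z : ℝ → E} (hz : BL T z)
    (ht : ∀ᶠ o in l, t o ∈ Icc (0 : ℝ) T) : (fun o => z (t o)) =O[l] (fun _ => (1 : ℝ)) := by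
  obtain ⟨K, hK⟩ := hz
  refine IsBigO.of_bound K ?_
  filter_upwards [ht] with o ho
  simpa using (hK _ ho _ ho).1

theorem BL.bigO_sub {E : Type*} [NormedAddCommGroup E] {z : ℝ → E} (hz : BL T z)
    (ht : ∀ᶠ o in l, t o ∈ Icc (0 : ℝ) T) (ht' : ∀ᶠ o in l, t o + h o ∈ Icc (0 : ℝ) T) :
    (fun o => z (t o + h o) - z (t o)) =O[l] h := by
  obtain ⟨K, hK⟩ := hz
  refine IsBigO.of_bound K ?_
  filter_upwards [ht, ht'] with o ho ho'
  simpa using (hK _ ho _ ho').2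

theorem bigO_hsmul {E : Type*} [NormedAddCommGroup E] [NormedSpace ℝ E] {x : Ω → E} {b : Ω → ℝ}
    (hx : x =O[l] b) : (fun o => h o • x o) =O[l] (fun o => h o * b o) :=
  (isBigO_refl h l).smul hx

theorem bigO_hmul (hh : ∀ᶠ o in l, 0 < h o ∧ h o ≤ 1) (b : Ω → ℝ) :
    (fun o => h o * b o) =O[l] b := by
  refine IsBigO.of_bound 1 ?_
  filter_upwards [hh] with o ho
  rw [norm_mul, Real.norm_of_nonneg ho.1.le]
  gcongr
  exact ho.2

variable [FiniteDimensional ℝ V] [FiniteDimensional ℝ L]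
variable (Y : Traj S T)

noncomputable def Traj.Pt (t : ℝ) : V →L[ℝ] V := S.Proj (Y.q t, Y.N t)

noncomputable def Traj.dt (c t : ℝ) : L := S.dhat c (Y.q t, Y.p t, Y.lam t)

theorem Traj.blPt : BL T Y.Pt := (Y.blq.prodMk Y.blN).comp S.hProj
theorem Traj.bldt (c : ℝ) : BL T (Y.dt c) := (Y.blq.prodMk (Y.blp.prodMk Y.blam)).comp (S.hdhat c)

theorem Traj.e_bd {q p : Ω → V} (ht : ∀ᶠ o in l, t o ∈ Icc (0 : ℝ) T)
    (hq : q =O[l] (fun _ => (1 : ℝ))) (hp : p =O[l] (fun _ => (1 : ℝ))) {err : Ω → ℝ}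
    (hx : (fun o => q o - Y.q (t o)) =O[l] err)
    (hP : (fun o => Y.Pt (t o) (p o - Y.p (t o))) =O[l] err)
    (hw : (fun o => fderiv ℝ S.g (q o) (S.Mi (p o))) =O[l] err) :
    (fun o => p o - Y.p (t o)) =O[l] err := by
  have bq := Y.blq.bigO ht
  have h1 := (bigO_lip S.hg1 bq hq).trans hx
  have h2 := bigO_clm h1 (bigO_clm' S.Mi hp)
  simp only [mul_one] at h2
  have h3 := bigO_clm1 (bigO_bdd S.hG bq) (bigO_clm1 (Y.blN.bigO ht) (hw.sub h2))
  refine (hP.add h3).congr' ?_ EventuallyEq.rfl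
  filter_upwards [ht] with o ho
  have := Y.tan _ ho
  simp only [Traj.Pt, CSys.Proj, _root_.sub_apply, ContinuousLinearMap.comp_apply, map_sub, this,
    ContinuousLinearMap.id_apply, map_zero]
  abel

theorem Traj.w_bd {w : Ω → L} (hh : ∀ᶠ o in l, 0 < h o ∧ h o ≤ 1) (c : ℝ)
    (ht : ∀ᶠ o in l, t o ∈ Icc (0 : ℝ) T) {err : Ω → ℝ}
    (hd : (fun o => w o - (h o ^ 2 / 2) • Y.dt c (t o)) =O[l] err)
    (h2 : (fun o => h o ^ 2) =O[l] err) : w =O[l] err := by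
  have h1 := (isBigO_refl (fun o => h o ^ 2) l).smul ((Y.bldt c).bigO ht)
  simp only [smul_eq_mul, mul_one] at h1
  refine (hd.add (bigO_csmul (1 / 2) (h1.trans h2))).congr_left fun o => ?_
  module

variable {err : Ω → ℝ}

theorem Traj.E1 (H : CSys.StepData B S l q0 p0 h ζ lam) (ht : ∀ᶠ o in l, t o ∈ Icc (0 : ℝ) T)
    (hx : (fun o => q0 o - Y.q (t o)) =O[l] err)
    (he : (fun o => p0 o - Y.p (t o)) =O[l] err)
    (hw : (fun o => fderiv ℝ S.g (q0 o) (S.Mi (p0 o))) =O[l] err)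
    (h2 : (fun o => h o ^ 2) =O[l] err) :
    (fun o => h o • (lam o - Y.lam (t o))) =O[l] err := by
  have bq := Y.blq.bigO ht
  have bp := Y.blp.bigO ht
  have c1 := bigO_lip S.hPsi (bq.prod_left (bp.prod_left H.hl)) (H.hq.prod_left (H.hp.prod_left H.hl))
  have c2 : (fun o => ((q0 o, p0 o, lam o) - (Y.q (t o), Y.p (t o), lam o) : V × V × L)) =O[l] err := by
    simp only [Prod.mk_sub_mk, sub_self]
    exact hx.prod_left (he.prod_left (isBigO_zero _ _))
  have c3 := (bigO_hsmul (h := h) (c1.trans c2)).trans (bigO_hmul H.hh err)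
  have c4 := ((bigO_csmul 2 hw).add c3).sub (H.lam_exp.trans h2)
  have c5 := bigO_clm1 (Y.blN.bigO ht) c4
  refine c5.congr' ?_ EventuallyEq.rfl
  filter_upwards [ht] with o ho
  have m := Y.mult _ ho
  have n := DFunLike.congr_fun (Y.hN _ ho) (h o • (lam o - Y.lam (t o)))
  simp only [ContinuousLinearMap.comp_apply, ContinuousLinearMap.id_apply] at n
  rw [← n]
  congr 1
  have e : S.Psi (Y.q (t o), Y.p (t o), lam o) = S.Psi (Y.q (t o), Y.p (t o), lam o)
    - S.Psi (Y.q (t o), Y.p (t o), Y.lam (t o)) := by rw [m, sub_zero]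
  have e2 : S.Psi (Y.q (t o), Y.p (t o), lam o) = - S.A (Y.q (t o)) (lam o - Y.lam (t o)) := by
    rw [e]
    simp only [CSys.Psi, CSys.A, CSys.F, ContinuousLinearMap.comp_apply, map_add, map_sub]
    abel
  rw [e2, map_smul]
  module

theorem Traj.E2 (H : CSys.StepData B S l q0 p0 h ζ lam) (ht : ∀ᶠ o in l, t o ∈ Icc (0 : ℝ) T) (ht' : ∀ᶠ o in l, t o + h o ∈ Icc (0 : ℝ) T)
    
    (h2 : (fun o => h o ^ 2) =O[l] err)
    (he : (fun o => p0 o - Y.p (t o)) =O[l] err)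
    (he1 : (fun o => p0 o + h o • ζ o 0 - Y.p (t o + h o)) =O[l] err) :
    (fun o => (S.uu B (q0 o) (p0 o) (h o) (ζ o) 1 - Y.q (t o + h o)) - (q0 o - Y.q (t o)))
      =O[l] (fun o => h o * err o) := by
  obtain ⟨C, hC⟩ := Y.q_trap
  have c1 : (fun o => Y.q (t o + h o) - Y.q (t o) - (h o / 2) • S.Mi (Y.p (t o) + Y.p (t o + h o)))
      =O[l] (fun o => h o * h o ^ 2) := by
    refine IsBigO.of_bound C ?_
    filter_upwards [ht, ht', H.hh] with o a b c
    have := hC (t o) (h o) a.1 c.1.le b.2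
    rw [Real.norm_of_nonneg (by have := c.1; positivity)]
    linarith
  have c2 := c1.trans ((isBigO_refl h l).mul h2)
  have c3 := bigO_hsmul (h := h) (bigO_csmul (1 / 2) (bigO_clm' S.Mi (he.add he1)))
  have c4 := bigO_hsmul (h := h) (bigO_hsmul (h := h) (bigO_clm' S.Mi H.r_lin))
  have c5 := c4.trans (k := fun o => h o * err o) (by
    have := (isBigO_refl h l).mul h2
    refine this.congr_left fun o => by ring)
  refine ((c5.add c3).sub c2).congr_left fun o => ?_
  simp only [CSys.uu_one, map_add, map_sub, map_smul]
  module

theorem Traj.E3 (H : CSys.StepData B S l q0 p0 h ζ lam) (ht : ∀ᶠ o in l, t o ∈ Icc (0 : ℝ) T) (ht' : ∀ᶠ o in l, t o + h o ∈ Icc (0 : ℝ) T)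
    (hx : (fun o => q0 o - Y.q (t o)) =O[l] err)
    (he : (fun o => p0 o - Y.p (t o)) =O[l] err)
    (hw : (fun o => fderiv ℝ S.g (q0 o) (S.Mi (p0 o))) =O[l] err)
    (h2 : (fun o => h o ^ 2) =O[l] err) :
    (fun o => (fderiv ℝ S.g (q0 o) (S.Mi (p0 o)) - (h o ^ 2 / 2) • Y.dt B.cs (t o))
      + (fderiv ℝ S.g (S.uu B (q0 o) (p0 o) (h o) (ζ o) 1) (S.Mi (p0 o + h o • ζ o 0))
        - (h o ^ 2 / 2) • Y.dt B.cs (t o + h o)))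
      =O[l] (fun o => h o * err o) := by
  have bq := Y.blq.bigO ht
  have bp := Y.blp.bigO ht
  have bl := Y.blam.bigO ht
  have hh2 := (isBigO_refl h l).mul h2
  have c1 := bigO_lip (S.hdhat B.cs) (bq.prod_left (bp.prod_left bl))
    (H.hq.prod_left (H.hp.prod_left H.hl))
  have c2 : (fun o => h o • ((q0 o, p0 o, lam o) - (Y.q (t o), Y.p (t o), Y.lam (t o)) : V × V × L))
      =O[l] err := by
    simp only [Prod.mk_sub_mk, Prod.smul_mk]
    exact ((bigO_hsmul hx).trans (bigO_hmul H.hh err)).prod_left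
      (((bigO_hsmul he).trans (bigO_hmul H.hh err)).prod_left (Y.E1 H ht hx he hw h2))
  have c3 := ((isBigO_refl h l).smul c1).trans c2
  have c4 := bigO_hsmul (h := h) c3
  have c5 := (isBigO_refl (fun o => h o ^ 2) l).smul ((Y.bldt B.cs).bigO_sub ht ht')
  have c6 := c5.trans (k := fun o => h o * err o)
    (hh2.congr_left fun o => by simp only [smul_eq_mul]; ring)
  have c7 := H.w_exp.trans (k := fun o => h o * err o)
    (hh2.congr_left fun o => by ring)
  refine ((c7.add c4).sub (bigO_csmul (1 / 2) c6)).congr_left fun o => ?_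
  simp only [Traj.dt]
  module

theorem Traj.E4 (H : CSys.StepData B S l q0 p0 h ζ lam) (ht : ∀ᶠ o in l, t o ∈ Icc (0 : ℝ) T) (ht' : ∀ᶠ o in l, t o + h o ∈ Icc (0 : ℝ) T)
    (hx : (fun o => q0 o - Y.q (t o)) =O[l] err)
    (hx1 : (fun o => S.uu B (q0 o) (p0 o) (h o) (ζ o) 1 - Y.q (t o + h o)) =O[l] err)
    (he : (fun o => p0 o - Y.p (t o)) =O[l] err)
    (he1 : (fun o => p0 o + h o • ζ o 0 - Y.p (t o + h o)) =O[l] err)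
    (hw : (fun o => fderiv ℝ S.g (q0 o) (S.Mi (p0 o))) =O[l] err)
    (h2 : (fun o => h o ^ 2) =O[l] err) :
    (fun o => Y.Pt (t o + h o) (p0 o + h o • ζ o 0 - Y.p (t o + h o))
      - Y.Pt (t o) (p0 o - Y.p (t o)))
      =O[l] (fun o => h o * err o) := by
  have hh2 := (isBigO_refl h l).mul h2
  have bq := Y.blq.bigO ht
  have bq' := Y.blq.bigO (t := fun o => t o + h o) ht'
  have bP := Y.blPt.bigO ht
  have bP' := Y.blPt.bigO (t := fun o => t o + h o) ht'
  have bPP := bigO_csmul (1 / 2) (bP.add bP')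
  have dP := Y.blPt.bigO_sub ht ht'
  have dG := (Y.blq.comp S.hG).bigO_sub ht ht'
  have a1 := bigO_csmul (1 / 2) (bigO_clm dP (he.add he1))
  have a2 := (bigO_clm1 bPP (bigO_hsmul (h := h) H.z0_trap)).trans hh2
  obtain ⟨C, hC⟩ := Y.p_trap
  have a3 : (fun o => ((1 / 2 : ℝ) • (Y.Pt (t o) + Y.Pt (t o + h o)))
      (Y.p (t o + h o) - Y.p (t o)
        + (h o / 2) • (S.F (Y.q (t o), Y.lam (t o)) + S.F (Y.q (t o + h o), Y.lam (t o)))))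
      =O[l] (fun o => h o * h o ^ 2) := by
    refine IsBigO.of_bound C ?_
    filter_upwards [ht, ht', H.hh] with o a b c
    have := hC (t o) (h o) a.1 c.1.le b.2
    rw [Real.norm_of_nonneg (by have := c.1; positivity)]
    refine this.trans (le_of_eq (by ring))
  have a3' := a3.trans hh2
  have f0 := bigO_lip S.hF (bq.prod_left H.hl) (H.hq.prod_left H.hl)
  have f0' := f0.trans (k := err) (by
    simp only [Prod.mk_sub_mk, sub_self]
    exact hx.prod_left (isBigO_zero _ _))
  have f1 := bigO_lip S.hF (bq'.prod_left H.hl) (H.q1_bdd.prod_left H.hl)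
  have f1' := f1.trans (k := err) (by
    simp only [Prod.mk_sub_mk, sub_self]
    exact hx1.prod_left (isBigO_zero _ _))
  have a4 := bigO_clm1 bPP (bigO_hsmul (h := h) (bigO_csmul (1 / 2) (f0'.add f1')))
  have a5 := bigO_csmul (1 / 4) (bigO_clm dP (bigO_clm dG (Y.E1 H ht hx he hw h2)))
  have a5' := a5.trans (k := fun o => h o * err o)
    ((isBigO_refl h l).mul (bigO_hmul H.hh err))
  refine ((((a1.add a2).sub a3').sub a4).add a5').congr' ?_ EventuallyEq.rfl
  filter_upwards [ht, ht'] with o ho ho'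
  have P0 := fun y => DFunLike.congr_fun (CSys.Proj_G (Y.hN _ ho)) y
  have P1 := fun y => DFunLike.congr_fun (CSys.Proj_G (Y.hN _ ho')) y
  simp only [ContinuousLinearMap.comp_apply, _root_.zero_apply] at P0 P1
  simp only [Traj.Pt, CSys.F, map_add, map_sub, map_smul, _root_.sub_apply, _root_.smul_apply,
    _root_.add_apply, P0, P1]
  module

end Cmp

open MeasureTheory Matrix Set
open scoped ContDiff Topology
open Asymptotics Filter

section Loc
variable {σ : ℕ} (B : Bas σ)
variable {V L : Type*} [NormedAddCommGroup V] [NormedSpace ℝ V]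
  [NormedAddCommGroup L] [NormedSpace ℝ L]
variable {S : CSys V L} {T : ℝ}
variable [FiniteDimensional ℝ V] [FiniteDimensional ℝ L]
variable (Y : Traj S T)

noncomputable def Traj.En (c t h : ℝ) (q p : V) : ℝ :=
  ‖q - Y.q t‖ + ‖Y.Pt t (p - Y.p t)‖
    + ‖fderiv ℝ S.g q (S.Mi p) - (h ^ 2 / 2) • Y.dt c t‖

theorem Traj.En_nonneg (c t h : ℝ) (q p : V) : 0 ≤ Y.En c t h q p := by
  unfold Traj.En; positivity

theorem bigO_one_of_bd {Ω E : Type*} [NormedAddCommGroup E] {s : Set Ω} {x : Ω → E} {R : ℝ}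
    (hx : ∀ o ∈ s, ‖x o‖ ≤ R) : x =O[𝓟 s] (fun _ => (1 : ℝ)) := by
  rw [isBigO_principal]
  exact ⟨R, fun o ho => by simpa using hx o ho⟩

theorem bigO_of_le {Ω E : Type*} [NormedAddCommGroup E] {s : Set Ω} {x : Ω → E} {b : Ω → ℝ}
    (hx : ∀ o ∈ s, ‖x o‖ ≤ b o) : x =O[𝓟 s] b := by
  rw [isBigO_principal]
  exact ⟨1, fun o ho => by rw [one_mul]; exact (hx o ho).trans (le_abs_self _)⟩

theorem bigO_get {Ω E : Type*} [NormedAddCommGroup E] {s : Set Ω} {x : Ω → E} {b : Ω → ℝ}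
    (hx : x =O[𝓟 s] b) (hb : ∀ o ∈ s, 0 ≤ b o) : ∃ C, 0 ≤ C ∧ ∀ o ∈ s, ‖x o‖ ≤ C * b o := by
  rw [isBigO_principal] at hx
  obtain ⟨C, hC⟩ := hx
  refine ⟨max C 0, le_max_right _ _, fun o ho => ?_⟩
  have := hC o ho
  rw [Real.norm_of_nonneg (hb o ho)] at this
  exact this.trans (mul_le_mul_of_nonneg_right (le_max_left _ _) (hb o ho))

theorem Traj.recover (c R : ℝ) : ∃ C, 0 ≤ C ∧ ∀ t h q p, t ∈ Icc (0 : ℝ) T → 0 < h → h ≤ 1 →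
    ‖q‖ ≤ R → ‖p‖ ≤ R → ‖p - Y.p t‖ ≤ C * (Y.En c t h q p + h ^ 2) ∧
      ‖fderiv ℝ S.g q (S.Mi p)‖ ≤ C * (Y.En c t h q p + h ^ 2) := by
  let s : Set (ℝ × ℝ × V × V) := {z | z.1 ∈ Icc (0 : ℝ) T ∧ 0 < z.2.1 ∧ z.2.1 ≤ 1 ∧
    ‖z.2.2.1‖ ≤ R ∧ ‖z.2.2.2‖ ≤ R}
  let err : ℝ × ℝ × V × V → ℝ := fun z => Y.En c z.1 z.2.1 z.2.2.1 z.2.2.2 + z.2.1 ^ 2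
  have ht : ∀ᶠ z in 𝓟 s, z.1 ∈ Icc (0 : ℝ) T := eventually_principal.2 fun z hz => hz.1
  have hh : ∀ᶠ z in 𝓟 s, 0 < z.2.1 ∧ z.2.1 ≤ 1 :=
    eventually_principal.2 fun z hz => ⟨hz.2.1, hz.2.2.1⟩
  have hq : (fun z : ℝ × ℝ × V × V => z.2.2.1) =O[𝓟 s] (fun _ => (1 : ℝ)) :=
    bigO_one_of_bd (R := R) fun z hz => hz.2.2.2.1
  have hp : (fun z : ℝ × ℝ × V × V => z.2.2.2) =O[𝓟 s] (fun _ => (1 : ℝ)) :=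
    bigO_one_of_bd (R := R) fun z hz => hz.2.2.2.2
  have b1 : (fun z : ℝ × ℝ × V × V => z.2.2.1 - Y.q z.1) =O[𝓟 s] err :=
    bigO_of_le fun z hz => by simp only [err, Traj.En]; linarith [norm_nonneg (Y.Pt z.1 (z.2.2.2 - Y.p z.1)), norm_nonneg (fderiv ℝ S.g z.2.2.1 (S.Mi z.2.2.2) - (z.2.1 ^ 2 / 2) • Y.dt c z.1), sq_nonneg z.2.1]
  have b2 : (fun z : ℝ × ℝ × V × V => Y.Pt z.1 (z.2.2.2 - Y.p z.1)) =O[𝓟 s] err :=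
    bigO_of_le fun z hz => by simp only [err, Traj.En]; linarith [norm_nonneg (z.2.2.1 - Y.q z.1), norm_nonneg (fderiv ℝ S.g z.2.2.1 (S.Mi z.2.2.2) - (z.2.1 ^ 2 / 2) • Y.dt c z.1), sq_nonneg z.2.1]
  have b3 : (fun z : ℝ × ℝ × V × V => fderiv ℝ S.g z.2.2.1 (S.Mi z.2.2.2) - (z.2.1 ^ 2 / 2) • Y.dt c z.1) =O[𝓟 s] err :=
    bigO_of_le fun z hz => by simp only [err, Traj.En]; linarith [norm_nonneg (z.2.2.1 - Y.q z.1), norm_nonneg (Y.Pt z.1 (z.2.2.2 - Y.p z.1)), sq_nonneg z.2.1]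
  have b4 : (fun z : ℝ × ℝ × V × V => z.2.1 ^ 2) =O[𝓟 s] err :=
    bigO_of_le fun z hz => by
      rw [Real.norm_of_nonneg (sq_nonneg _)]
      have := Y.En_nonneg c z.1 z.2.1 z.2.2.1 z.2.2.2
      simp only [err]; linarith
  have w := Y.w_bd hh c ht b3 b4
  have e := Y.e_bd ht hq hp b1 b2 w
  have en : ∀ z ∈ s, 0 ≤ err z := fun z _ => add_nonneg (Y.En_nonneg ..) (sq_nonneg _)
  obtain ⟨C1, h1, H1⟩ := bigO_get w en
  obtain ⟨C2, h2, H2⟩ := bigO_get e en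
  refine ⟨max C1 C2, h1.trans (le_max_left _ _), fun t h q p a1 a2 a3 a4 a5 => ?_⟩
  have hz : ((t, h, q, p) : ℝ × ℝ × V × V) ∈ s := ⟨a1, a2, a3, a4, a5⟩
  have := en _ hz
  exact ⟨(H2 _ hz).trans (mul_le_mul_of_nonneg_right (le_max_right _ _) this),
    (H1 _ hz).trans (mul_le_mul_of_nonneg_right (le_max_left _ _) this)⟩

theorem Traj.local_err (R : ℝ) : ∃ C, 0 ≤ C ∧ ∀ t h q0 p0 ζ lam, t ∈ Icc (0 : ℝ) T →
    t + h ∈ Icc (0 : ℝ) T → 0 < h → h ≤ 1 → ‖q0‖ ≤ R → ‖p0‖ ≤ R → ‖ζ‖ ≤ R → ‖lam‖ ≤ R →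
    S.g q0 = 0 → S.IsStep B q0 p0 h ζ lam →
    Y.En B.cs (t + h) h (S.uu B q0 p0 h ζ 1) (p0 + h • ζ 0) ≤ Y.En B.cs t h q0 p0
      + C * h * (Y.En B.cs t h q0 p0
        + Y.En B.cs (t + h) h (S.uu B q0 p0 h ζ 1) (p0 + h • ζ 0) + h ^ 2) ∧
    h * ‖lam - Y.lam t‖ ≤ C * (Y.En B.cs t h q0 p0 + h ^ 2) := by
  let Ω := ℝ × ℝ × V × V × (Fin (σ + 1) → V) × L
  let t : Ω → ℝ := fun z => z.1
  let h : Ω → ℝ := fun z => z.2.1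
  let q0 : Ω → V := fun z => z.2.2.1
  let p0 : Ω → V := fun z => z.2.2.2.1
  let ζ : Ω → (Fin (σ + 1) → V) := fun z => z.2.2.2.2.1
  let lam : Ω → L := fun z => z.2.2.2.2.2
  let s : Set Ω := {z | t z ∈ Icc (0 : ℝ) T ∧ t z + h z ∈ Icc (0 : ℝ) T ∧ 0 < h z ∧ h z ≤ 1 ∧
    ‖q0 z‖ ≤ R ∧ ‖p0 z‖ ≤ R ∧ ‖ζ z‖ ≤ R ∧ ‖lam z‖ ≤ R ∧ S.g (q0 z) = 0 ∧
    S.IsStep B (q0 z) (p0 z) (h z) (ζ z) (lam z)}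
  let q1 : Ω → V := fun z => S.uu B (q0 z) (p0 z) (h z) (ζ z) 1
  let p1 : Ω → V := fun z => p0 z + h z • ζ z 0
  let E0 : Ω → ℝ := fun z => Y.En B.cs (t z) (h z) (q0 z) (p0 z)
  let E1 : Ω → ℝ := fun z => Y.En B.cs (t z + h z) (h z) (q1 z) (p1 z)
  have nE0 : ∀ z, 0 ≤ E0 z := fun z => Y.En_nonneg ..
  have nE1 : ∀ z, 0 ≤ E1 z := fun z => Y.En_nonneg ..
  let er0 : Ω → ℝ := fun z => E0 z + h z ^ 2
  let err : Ω → ℝ := fun z => E0 z + E1 z + h z ^ 2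
  have ner0 : ∀ z ∈ s, 0 ≤ er0 z := fun z _ => add_nonneg (nE0 z) (sq_nonneg _)
  have nerr : ∀ z ∈ s, 0 ≤ err z := fun z _ =>
    add_nonneg (add_nonneg (nE0 z) (nE1 z)) (sq_nonneg _)
  have ht : ∀ᶠ z in 𝓟 s, t z ∈ Icc (0 : ℝ) T := eventually_principal.2 fun z hz => hz.1
  have ht' : ∀ᶠ z in 𝓟 s, t z + h z ∈ Icc (0 : ℝ) T := eventually_principal.2 fun z hz => hz.2.1
  have H : CSys.StepData B S (𝓟 s) q0 p0 h ζ lam :=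
    { hq := bigO_one_of_bd (R := R) fun z hz => hz.2.2.2.2.1
      hp := bigO_one_of_bd (R := R) fun z hz => hz.2.2.2.2.2.1
      hζ := bigO_one_of_bd (R := R) fun z hz => hz.2.2.2.2.2.2.1
      hl := bigO_one_of_bd (R := R) fun z hz => hz.2.2.2.2.2.2.2.1
      hh := eventually_principal.2 fun z hz => ⟨hz.2.2.1, hz.2.2.2.1⟩
      g0 := eventually_principal.2 fun z hz => hz.2.2.2.2.2.2.2.2.1
      st := eventually_principal.2 fun z hz => hz.2.2.2.2.2.2.2.2.2 }
  have h2 : (fun z => h z ^ 2) =O[𝓟 s] er0 := bigO_of_le fun z hz => by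
    rw [Real.norm_of_nonneg (sq_nonneg _)]
    simp only [er0]
    linarith [nE0 z]
  have ere : er0 =O[𝓟 s] err := bigO_of_le fun z hz => by
    rw [Real.norm_of_nonneg (ner0 z hz)]
    simp only [er0, err]
    linarith [nE1 z]
  have e1e : E1 =O[𝓟 s] err := bigO_of_le fun z hz => by
    rw [Real.norm_of_nonneg (nE1 z)]
    simp only [err]
    linarith [nE0 z, sq_nonneg (h z)]
  have e0e : E0 =O[𝓟 s] er0 := bigO_of_le fun z hz => by
    rw [Real.norm_of_nonneg (nE0 z)]
    simp only [er0]
    linarith [sq_nonneg (h z)]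
  have c1 : ∀ (c t h : ℝ) (q p : V), ‖q - Y.q t‖ ≤ Y.En c t h q p ∧
      ‖Y.Pt t (p - Y.p t)‖ ≤ Y.En c t h q p ∧
      ‖fderiv ℝ S.g q (S.Mi p) - (h ^ 2 / 2) • Y.dt c t‖ ≤ Y.En c t h q p := by
    intro c t h q p
    unfold Traj.En
    have a1 := norm_nonneg (q - Y.q t)
    have a2 := norm_nonneg (Y.Pt t (p - Y.p t))
    have a3 := norm_nonneg (fderiv ℝ S.g q (S.Mi p) - (h ^ 2 / 2) • Y.dt c t)
    refine ⟨?_, ?_, ?_⟩ <;> linarith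
  have x0 : (fun z => q0 z - Y.q (t z)) =O[𝓟 s] er0 :=
    (bigO_of_le fun z _ => (c1 B.cs (t z) (h z) (q0 z) (p0 z)).1).trans e0e
  have P0 : (fun z => Y.Pt (t z) (p0 z - Y.p (t z))) =O[𝓟 s] er0 :=
    (bigO_of_le fun z _ => (c1 B.cs (t z) (h z) (q0 z) (p0 z)).2.1).trans e0e
  have d0 : (fun z => fderiv ℝ S.g (q0 z) (S.Mi (p0 z)) - (h z ^ 2 / 2) • Y.dt B.cs (t z))
      =O[𝓟 s] er0 :=
    (bigO_of_le fun z _ => (c1 B.cs (t z) (h z) (q0 z) (p0 z)).2.2).trans e0e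
  have x1 : (fun z => q1 z - Y.q (t z + h z)) =O[𝓟 s] err :=
    (bigO_of_le fun z _ => (c1 B.cs (t z + h z) (h z) (q1 z) (p1 z)).1).trans e1e
  have P1 : (fun z => Y.Pt (t z + h z) (p1 z - Y.p (t z + h z))) =O[𝓟 s] err :=
    (bigO_of_le fun z _ => (c1 B.cs (t z + h z) (h z) (q1 z) (p1 z)).2.1).trans e1e
  have d1 : (fun z => fderiv ℝ S.g (q1 z) (S.Mi (p1 z)) - (h z ^ 2 / 2) • Y.dt B.cs (t z + h z))
      =O[𝓟 s] err :=
    (bigO_of_le fun z _ => (c1 B.cs (t z + h z) (h z) (q1 z) (p1 z)).2.2).trans e1e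
  have w0 := Y.w_bd H.hh B.cs ht d0 h2
  have e0 := Y.e_bd ht H.hq H.hp x0 P0 w0
  have w1 := Y.w_bd (t := fun z => t z + h z) H.hh B.cs ht' d1 (h2.trans ere)
  have e1 := Y.e_bd (t := fun z => t z + h z) ht' H.q1_bdd H.p1_bdd x1 P1 w1
  have R1 := Y.E1 H ht x0 e0 w0 h2
  have R2 := Y.E2 H ht ht' (h2.trans ere) (e0.trans ere) e1
  have R3 := Y.E3 H ht ht' (x0.trans ere) (e0.trans ere) (w0.trans ere) (h2.trans ere)
  have R4 := Y.E4 H ht ht' (x0.trans ere) x1 (e0.trans ere) e1 (w0.trans ere) (h2.trans ere)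
  have nh : ∀ z ∈ s, 0 ≤ h z * err z := fun z hz => mul_nonneg hz.2.2.1.le (nerr z hz)
  obtain ⟨C1, k1, K1⟩ := bigO_get R1 ner0
  obtain ⟨C2, k2, K2⟩ := bigO_get R2 nh
  obtain ⟨C3, k3, K3⟩ := bigO_get R3 nh
  obtain ⟨C4, k4, K4⟩ := bigO_get R4 nh
  refine ⟨C1 + (C2 + C3 + C4), by positivity, ?_⟩
  intro t' h' q0' p0' ζ' lam' a1 a2 a3 a4 a5 a6 a7 a8 a9 a10
  have hz : ((t', h', q0', p0', ζ', lam') : Ω) ∈ s := ⟨a1, a2, a3, a4, a5, a6, a7, a8, a9, a10⟩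
  have K1 := K1 _ hz
  have K2 := K2 _ hz
  have K3 := K3 _ hz
  have K4 := K4 _ hz
  have nh := nh _ hz
  have ner0 := ner0 _ hz
  simp only [t, h, q0, p0, ζ, lam, err, er0, E0, E1, q1, p1] at K1 K2 K3 K4 nh ner0
  clear_value t h q0 p0 ζ lam
  constructor
  · have n1 : ∀ (a b : V), ‖a‖ ≤ ‖b‖ + ‖a - b‖ := fun a b => by
      have := norm_add_le b (a - b)
      simpa using this
    have n2 : ∀ (a b : L), ‖a‖ ≤ ‖b‖ + ‖b + a‖ := fun a b => by
      have := norm_sub_le (b + a) b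
      simp only [add_sub_cancel_left] at this
      linarith
    have m2 := (n1 _ _).trans (add_le_add_right K2 _)
    have m3 := (n2 _ _).trans (add_le_add_right K3 _)
    have m4 := (n1 _ _).trans (add_le_add_right K4 _)
    have nn : 0 ≤ C1 * (h' * (Y.En B.cs t' h' q0' p0' + Y.En B.cs (t' + h') h' (S.uu B q0' p0' h' ζ' 1) (p0' + h' • ζ' 0) + h' ^ 2)) :=
      mul_nonneg k1 nh
    have sp : Y.En B.cs (t' + h') h' (S.uu B q0' p0' h' ζ' 1) (p0' + h' • ζ' 0)
      ≤ Y.En B.cs t' h' q0' p0' + (C2 + C3 + C4) * (h' * (Y.En B.cs t' h' q0' p0' + Y.En B.cs (t' + h') h' (S.uu B q0' p0' h' ζ' 1) (p0' + h' • ζ' 0) + h' ^ 2)) := by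
      conv_lhs => rw [Traj.En]
      generalize Y.En B.cs (t' + h') h' (S.uu B q0' p0' h' ζ' 1) (p0' + h' • ζ' 0) = Z at *
      have : Y.En B.cs t' h' q0' p0' = ‖q0' - Y.q t'‖ + ‖Y.Pt t' (p0' - Y.p t')‖
        + ‖fderiv ℝ S.g q0' (S.Mi p0') - (h' ^ 2 / 2) • Y.dt B.cs t'‖ := rfl
      linarith
    linarith
  · rw [norm_smul, Real.norm_of_nonneg a3.le] at K1
    refine K1.trans (mul_le_mul_of_nonneg_right ?_ ner0)
    linarith
end Loc

open MeasureTheory Matrix Set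
open scoped ContDiff Topology
open Asymptotics Filter

section Glob
variable {σ : ℕ} (B : Bas σ)
variable {V L : Type*} [NormedAddCommGroup V] [NormedSpace ℝ V]
  [NormedAddCommGroup L] [NormedSpace ℝ L]
variable {S : CSys V L} {T : ℝ}
variable [FiniteDimensional ℝ V] [FiniteDimensional ℝ L]
variable (Y : Traj S T)

theorem gron_step {a E0 E1 k F : ℝ} (ha : 0 ≤ a) (ha2 : a ≤ 1 / 2) (hE0 : 0 ≤ E0) (hk : 0 ≤ k)
    (h1 : E1 ≤ E0 + a * (E0 + E1 + k)) (hF : E0 + k ≤ F) : E1 + k ≤ (1 + 4 * a) * F := by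
  have h2 : (E1 + k) * (1 - a) ≤ (E0 + k) * (1 + a) := by nlinarith
  have h3 : (E0 + k) * (1 + a) ≤ ((1 + 4 * a) * (E0 + k)) * (1 - a) := by
    have : 0 ≤ (E0 + k) * (2 * a * (1 - 2 * a)) := by
      have : 0 ≤ 1 - 2 * a := by linarith
      positivity
    nlinarith
  have h4 : (E1 + k) ≤ ((1 + 4 * a) * (E0 + k)) := by
    have : 0 < 1 - a := by linarith
    exact le_of_mul_le_mul_right (h2.trans h3) this
  exact h4.trans (by gcongr)

theorem exists_small (l : List ℝ) : ∃ h0 : ℝ, 0 < h0 ∧ h0 ≤ 1 ∧ ∀ K ∈ l, K * h0 ≤ 1 := by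
  induction l with
  | nil => exact ⟨1, by norm_num, le_rfl, by simp⟩
  | cons K l ih =>
    obtain ⟨h0, p, q, r⟩ := ih
    refine ⟨min h0 (1 / (|K| + 1)), lt_min p (by positivity), (min_le_left _ _).trans q, ?_⟩
    have hm : 0 < min h0 (1 / (|K| + 1)) := lt_min p (by positivity)
    intro K' hK'
    rcases List.mem_cons.1 hK' with rfl | h
    · calc K' * min h0 (1 / (|K'| + 1)) ≤ (|K'| + 1) * min h0 (1 / (|K'| + 1)) := by
            gcongr; linarith [le_abs_self K']
        _ ≤ (|K'| + 1) * (1 / (|K'| + 1)) := by gcongr; exact min_le_right _ _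
        _ = 1 := by field_simp
    · rcases le_or_gt K' 0 with h0' | h0'
      · nlinarith
      · exact le_trans (by gcongr; exact min_le_left _ _) (r K' h)

set_option maxHeartbeats 2000000 in
theorem Traj.glob (hT : 0 < T) : ∃ h₀ > 0, ∃ C > 0, ∀ N : ℕ, 0 < N → T / (N : ℝ) ≤ h₀ →
    ∃ (qa pa : ℕ → V) (ζ : ℕ → Fin (σ + 1) → V) (lam : ℕ → L),
      qa 0 = Y.q 0 ∧ pa 0 = Y.p 0 ∧
      (∀ n < N, S.IsStep B (qa n) (pa n) (T / (N : ℝ)) (ζ n) (lam n) ∧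
        qa (n + 1) = S.uu B (qa n) (pa n) (T / (N : ℝ)) (ζ n) 1 ∧
        pa (n + 1) = pa n + (T / (N : ℝ)) • ζ n 0 ∧
        ‖lam n - Y.lam ((n : ℝ) * (T / (N : ℝ)))‖ ≤ C * (T / (N : ℝ))) ∧
      (∀ n ≤ N, S.g (qa n) = 0 ∧
        ‖qa n - Y.q ((n : ℝ) * (T / (N : ℝ)))‖ ≤ C * (T / (N : ℝ)) ^ 2 ∧
        ‖pa n - Y.p ((n : ℝ) * (T / (N : ℝ)))‖ ≤ C * (T / (N : ℝ)) ^ 2 ∧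
        ‖fderiv ℝ S.g (qa n) (S.Mi (pa n))‖ ≤ C * (T / (N : ℝ)) ^ 2) := by
  obtain ⟨Kq, hKq0, hKq⟩ := Y.blq.nonneg
  obtain ⟨Kp, hKp0, hKp⟩ := Y.blp.nonneg
  obtain ⟨Λ, hΛ0, hΛ⟩ := Y.blN.nonneg
  set ρ := Kq + Kp + 1 with hρ
  obtain ⟨ε, hε, R, h1, hh1, hstep⟩ := CSys.exists_step B S ρ Λ
  set R2 := ρ + |R| with hR2
  have hρ0 : 0 ≤ ρ := by positivity
  have hR2a : ρ ≤ R2 := by have := abs_nonneg R; linarith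
  have hR2b : R ≤ R2 := by have := le_abs_self R; linarith
  obtain ⟨C1, hC1, hloc⟩ := Y.local_err B R2
  obtain ⟨C2, hC2, hrec⟩ := Y.recover B.cs R2
  obtain ⟨CA0, hA⟩ := ball_smooth S.A S.hA ρ
  set CA := |CA0| with hCA
  set C0 := ‖Y.dt B.cs 0‖ with hC0
  have hC00 : 0 ≤ C0 := norm_nonneg _
  set D := Real.exp (4 * C1 * T) * (C0 + 1) with hD
  have hD0 : 0 < D := by positivity
  obtain ⟨h2, h20, h21, hsm⟩ := exists_small [1 / h1, 2 * C1, D, C2 * D, Λ * CA * D / ε]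
  have s1 := hsm (1 / h1) (by simp)
  have s2 := hsm (2 * C1) (by simp)
  have s3 := hsm D (by simp)
  have s4 := hsm (C2 * D) (by simp)
  have s5 := hsm (Λ * CA * D / ε) (by simp)
  refine ⟨h2, h20, D + C2 * D + C1 * D, by positivity, ?_⟩
  intro N hN hNh
  set h := T / (N : ℝ) with hh
  have hNp : (0 : ℝ) < N := by exact_mod_cast hN
  have hpos : 0 < h := by positivity
  have hle1 : h ≤ 1 := hNh.trans h21
  have hNT : (N : ℝ) * h = T := by rw [hh]; field_simp
  have t1 : h ≤ h1 := by
    have : 1 / h1 * h2 * h1 = h2 := by field_simp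
    nlinarith
  have mono : ∀ K : ℝ, 0 ≤ K → K * h2 ≤ 1 → K * h ≤ 1 := fun K hK hK' =>
    le_trans (by gcongr) hK'
  have t2 : C1 * h ≤ 1 / 2 := by have := mono _ (by positivity) s2; linarith
  have t3 := mono _ (by positivity) s3
  have t4 := mono _ (by positivity) s4
  have t5 := mono _ (by positivity) s5
  have hhle : h ^ 2 ≤ h := by nlinarith
  have htn : ∀ n : ℕ, n ≤ N → (n : ℝ) * h ∈ Icc (0 : ℝ) T := fun n hn =>
    ⟨by positivity, by
      rw [← hNT]
      have : (n : ℝ) ≤ N := by exact_mod_cast hn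
      gcongr⟩
  have hch : ∀ z : V × V, ∃ y : (Fin (σ + 1) → V) × L,
      (∃ ζ lam, ‖ζ‖ ≤ R ∧ ‖lam‖ ≤ R ∧ S.IsStep B z.1 z.2 h ζ lam) →
      ‖y.1‖ ≤ R ∧ ‖y.2‖ ≤ R ∧ S.IsStep B z.1 z.2 h y.1 y.2 := by
    intro z
    by_cases hz : ∃ ζ lam, ‖ζ‖ ≤ R ∧ ‖lam‖ ≤ R ∧ S.IsStep B z.1 z.2 h ζ lam
    · obtain ⟨ζ, lam, hzz⟩ := hz
      exact ⟨(ζ, lam), fun _ => hzz⟩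
    · exact ⟨0, fun h => absurd h hz⟩
  choose φ hφ using hch
  let st : ℕ → V × V := fun n => Nat.rec (Y.q 0, Y.p 0)
    (fun _ z => (S.uu B z.1 z.2 h (φ z).1 1, z.2 + h • (φ z).1 0)) n
  have st0 : st 0 = (Y.q 0, Y.p 0) := rfl
  have stS : ∀ n, st (n + 1) = (S.uu B (st n).1 (st n).2 h (φ (st n)).1 1,
    (st n).2 + h • (φ (st n)).1 0) := fun n => rfl
  clear_value st
  let En : ℕ → ℝ := fun n => Y.En B.cs (n * h) h (st n).1 (st n).2
  have En0 : ∀ n, 0 ≤ En n := fun n => Y.En_nonneg ..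
  let Good : ℕ → Prop := fun n => S.g (st n).1 = 0 ∧ ‖(st n).2‖ ≤ R2 ∧
    En n + h ^ 2 ≤ (1 + 4 * (C1 * h)) ^ n * ((C0 + 1) * h ^ 2)
  have est : ∀ n ≤ N, Good n → En n + h ^ 2 ≤ D * h ^ 2 ∧
      ‖(st n).1 - Y.q (n * h)‖ ≤ D * h ^ 2 ∧ ‖(st n).2 - Y.p (n * h)‖ ≤ C2 * D * h ^ 2 ∧
      ‖fderiv ℝ S.g (st n).1 (S.Mi (st n).2)‖ ≤ C2 * D * h ^ 2 := by
    intro n hn hg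
    have f1 : (1 + 4 * (C1 * h)) ^ n ≤ Real.exp (4 * C1 * T) := by
      calc (1 + 4 * (C1 * h)) ^ n ≤ (Real.exp (4 * (C1 * h))) ^ n := by
            gcongr
            linarith [Real.add_one_le_exp (4 * (C1 * h))]
        _ = Real.exp (4 * C1 * (n * h)) := by rw [← Real.exp_nat_mul]; ring_nf
        _ ≤ _ := by
            gcongr
            exact (htn n hn).2
    have f2 : En n + h ^ 2 ≤ D * h ^ 2 := hg.2.2.trans (by
      rw [hD, mul_assoc]
      gcongr)
    have f3 : ‖(st n).1 - Y.q (n * h)‖ ≤ En n := by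
      simp only [En, Traj.En]
      linarith [norm_nonneg (Y.Pt (n * h) ((st n).2 - Y.p (n * h))),
        norm_nonneg (fderiv ℝ S.g (st n).1 (S.Mi (st n).2) - (h ^ 2 / 2) • Y.dt B.cs (n * h))]
    have f4 : ‖(st n).1 - Y.q (n * h)‖ ≤ D * h ^ 2 := by nlinarith
    have f5 : ‖(st n).1‖ ≤ R2 := by
      have a := norm_add_le (Y.q (n * h)) ((st n).1 - Y.q (n * h))
      rw [add_sub_cancel] at a
      have b := (hKq _ (htn n hn) _ (htn n hn)).1
      have : D * h ^ 2 ≤ 1 := by nlinarith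
      linarith
    have r := hrec (n * h) h (st n).1 (st n).2 (htn n hn) hpos hle1 f5 hg.2.1
    have f6 : C2 * (Y.En B.cs (n * h) h (st n).1 (st n).2 + h ^ 2) ≤ C2 * D * h ^ 2 := by
      rw [mul_assoc]
      exact mul_le_mul_of_nonneg_left f2 hC2
    exact ⟨f2, f4, r.1.trans f6, r.2.trans f6⟩
  have stp : ∀ n ≤ N, Good n → (‖(st n).1‖ ≤ ρ ∧ ‖(st n).2‖ ≤ ρ) ∧ ‖(φ (st n)).1‖ ≤ R ∧ ‖(φ (st n)).2‖ ≤ R ∧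
      S.IsStep B (st n).1 (st n).2 h (φ (st n)).1 (φ (st n)).2 := by
    intro n hn hg
    obtain ⟨f1, f2, f3, f4⟩ := est n hn hg
    have b1 : D * h ^ 2 ≤ 1 := by nlinarith
    have b2 : C2 * D * h ^ 2 ≤ h := by nlinarith
    have g1 : ‖(st n).1‖ ≤ ρ := by
      have a := norm_add_le (Y.q (n * h)) ((st n).1 - Y.q (n * h))
      rw [add_sub_cancel] at a
      have b := (hKq _ (htn n hn) _ (htn n hn)).1
      linarith
    have g2 : ‖(st n).2‖ ≤ ρ := by
      have a := norm_add_le (Y.p (n * h)) ((st n).2 - Y.p (n * h))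
      rw [add_sub_cancel] at a
      have b := (hKp _ (htn n hn) _ (htn n hn)).1
      linarith
    have g3 : ‖Y.q (n * h)‖ ≤ ρ := by
      have b := (hKq _ (htn n hn) _ (htn n hn)).1
      linarith
    have g4 := (hΛ _ (htn n hn) _ (htn n hn)).1
    refine ⟨⟨g1, g2⟩, hφ (st n) (hstep _ _ (Y.N (n * h)) h g1 g2 g4 hg.1 ?_ (f4.trans b2) hpos t1)⟩
    have e : ContinuousLinearMap.id ℝ L - (Y.N (n * h)).comp (S.A (st n).1)
        = -((Y.N (n * h)).comp (S.A (st n).1 - S.A (Y.q (n * h)))) := by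
      rw [← Y.hN _ (htn n hn), ContinuousLinearMap.comp_sub]
      abel
    rw [e, norm_neg]
    have hA' := (hA _ _ g3 g1).2
    calc _ ≤ ‖Y.N (n * h)‖ * ‖S.A (st n).1 - S.A (Y.q (n * h))‖ :=
          ContinuousLinearMap.opNorm_comp_le _ _
      _ ≤ Λ * (CA * (D * h ^ 2)) := by
          refine mul_le_mul g4 (hA'.trans ?_) (norm_nonneg _) hΛ0
          refine mul_le_mul (le_abs_self _) f2 (norm_nonneg _) (abs_nonneg _)
      _ = (Λ * CA * D / ε * h) * (ε * h) := by field_simp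
      _ ≤ 1 * (ε * h) := by gcongr
      _ ≤ ε := by nlinarith
  have hGood : ∀ n ≤ N, Good n := by
    intro n
    induction n with
    | zero =>
      intro _
      have z0 : (0 : ℝ) ∈ Icc 0 T := ⟨le_rfl, hT.le⟩
      refine ⟨by rw [st0]; exact Y.con 0 z0, ?_, ?_⟩
      · rw [st0]
        have := (hKp _ z0 _ z0).1
        change ‖Y.p 0‖ ≤ R2
        linarith
      · simp only [En, Traj.En, st0, Nat.cast_zero, zero_mul, sub_self, norm_zero, map_zero,
          Y.tan 0 z0, zero_sub, norm_neg, norm_smul, pow_zero, one_mul]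
        rw [Real.norm_of_nonneg (by positivity), ← hC0]
        nlinarith [sq_nonneg h, mul_nonneg hC00 (sq_nonneg h)]
    | succ n ih =>
      intro hn
      have hg := ih (by omega)
      obtain ⟨⟨g1, g2⟩, g3, g4, g5⟩ := stp n (by omega) hg
      have tt : ((n + 1 : ℕ) : ℝ) * h = n * h + h := by push_cast; ring
      have l1 := (hloc (n * h) h (st n).1 (st n).2 (φ (st n)).1 (φ (st n)).2 (htn n (by omega))
        (tt ▸ htn (n + 1) hn) hpos hle1 (g1.trans hR2a) (g2.trans hR2a) (g3.trans hR2b)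
        (g4.trans hR2b) hg.1 g5).1
      refine ⟨by rw [stS]; exact g5.2, ?_, ?_⟩
      · rw [stS]
        have a : ‖(st n).2 + h • (φ (st n)).1 0‖ ≤ ‖(st n).2‖ + h * ‖(φ (st n)).1 0‖ := by
          refine (norm_add_le _ _).trans (le_of_eq ?_)
          rw [norm_smul, Real.norm_of_nonneg hpos.le]
        have b := (norm_le_pi_norm (φ (st n)).1 0).trans (g3.trans (le_abs_self R))
        have c : h * ‖(φ (st n)).1 0‖ ≤ 1 * |R| := by gcongr
        change ‖(st n).2 + h • (φ (st n)).1 0‖ ≤ R2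
        linarith
      · have e1 : En (n + 1) = Y.En B.cs (n * h + h) h (S.uu B (st n).1 (st n).2 h (φ (st n)).1 1)
            ((st n).2 + h • (φ (st n)).1 0) := by
          simp only [En, stS, tt]
        rw [← e1] at l1
        rw [pow_succ' (1 + 4 * (C1 * h)) n, mul_assoc]
        exact gron_step (by positivity) t2 (En0 n) (by positivity) l1 hg.2.2
  refine ⟨fun n => (st n).1, fun n => (st n).2, fun n => (φ (st n)).1, fun n => (φ (st n)).2,
    by simp only [st0], by simp only [st0], ?_, ?_⟩
  · intro n hn
    have hg := hGood n hn.le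
    obtain ⟨⟨g1, g2⟩, g3, g4, g5⟩ := stp n hn.le hg
    refine ⟨g5, by simp only [stS], by simp only [stS], ?_⟩
    have tt : ((n + 1 : ℕ) : ℝ) * h = n * h + h := by push_cast; ring
    have l2 := (hloc (n * h) h (st n).1 (st n).2 (φ (st n)).1 (φ (st n)).2 (htn n hn.le)
      (tt ▸ htn (n + 1) hn) hpos hle1 (g1.trans hR2a) (g2.trans hR2a) (g3.trans hR2b)
      (g4.trans hR2b) hg.1 g5).2
    have f := (est n hn.le hg).1
    have l3 : h * ‖(φ (st n)).2 - Y.lam (n * h)‖ ≤ h * (C1 * D * h) := by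
      refine l2.trans ((mul_le_mul_of_nonneg_left f hC1).trans (le_of_eq (by ring)))
    have l4 := le_of_mul_le_mul_left l3 hpos
    refine l4.trans ?_
    gcongr
    have : 0 ≤ C2 * D := by positivity
    linarith
  · intro n hn
    have hg := hGood n hn
    obtain ⟨f1, f2, f3, f4⟩ := est n hn hg
    have p1 : 0 ≤ C2 * D := by positivity
    have p2 : 0 ≤ C1 * D := by positivity
    exact ⟨hg.1, f2.trans (by gcongr; linarith), f3.trans (by gcongr; linarith),
      f4.trans (by gcongr; linarith)⟩
end Glob

open MeasureTheory Matrix Set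
open scoped ContDiff Topology
open Asymptotics Filter

section Leg
open Polynomial in
noncomputable def LP (j : ℕ) : ℝ[X] :=
  C (Real.sqrt (2 * j + 1) / (Nat.factorial j)) * derivative^[j] ((X ^ 2 - X) ^ j)

open Polynomial in
noncomputable def IP (j : ℕ) : ℝ[X] :=
  if j = 0 then X else
  C (Real.sqrt (2 * j + 1) / (Nat.factorial j)) * derivative^[j - 1] ((X ^ 2 - X) ^ j)

theorem LP_zero : LP 0 = 1 := by simp [LP]

theorem iteratedDeriv_poly (j : ℕ) (P : Polynomial ℝ) :
    iteratedDeriv j (fun y => P.eval y) = fun y => (Polynomial.derivative^[j] P).eval y := by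
  induction j with
  | zero => simp
  | succ j ih =>
    rw [iteratedDeriv_succ, ih]
    funext y
    rw [Polynomial.deriv, Function.iterate_succ_apply']

theorem LP_eval (j : ℕ) (x : ℝ) : (LP j).eval x = shiftedLegendre j x := by
  have := congrFun (iteratedDeriv_poly j ((Polynomial.X ^ 2 - Polynomial.X) ^ j)) x
  simp only [Polynomial.eval_pow, Polynomial.eval_sub, Polynomial.eval_X] at this
  rw [shiftedLegendre, this, LP, Polynomial.eval_mul, Polynomial.eval_C]

theorem IP_deriv (j : ℕ) : Polynomial.derivative (IP j) = LP j := by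
  unfold IP
  split_ifs with h
  · subst h; simp [LP]
  · rw [Polynomial.derivative_C_mul, ← Function.iterate_succ_apply' (⇑Polynomial.derivative), LP]
    congr 2
    rw [Nat.succ_eq_add_one, Nat.sub_add_cancel (Nat.pos_of_ne_zero h)]

theorem IP_deg (j : ℕ) : (IP j).natDegree ≤ j + 1 := by
  unfold IP
  split_ifs with h
  · subst h; simp
  · refine (Polynomial.natDegree_C_mul_le _ _).trans
      ((Polynomial.natDegree_iterate_derivative _ _).trans ?_)
    have h1 : ((Polynomial.X ^ 2 - Polynomial.X : Polynomial ℝ) ^ j).natDegree ≤ j * 2 := by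
      refine Polynomial.natDegree_pow_le.trans ?_
      gcongr
      refine (Polynomial.natDegree_sub_le _ _).trans ?_
      simp
    omega

theorem IP_root (j : ℕ) (h : j ≠ 0) (x : ℝ) (hx : x ^ 2 - x = 0) : (IP j).eval x = 0 := by
  rw [IP, if_neg h, Polynomial.eval_mul]
  have h1 := Polynomial.pow_sub_dvd_iterate_derivative_pow
    (Polynomial.X ^ 2 - Polynomial.X : Polynomial ℝ) j (j - 1)
  have h2 : j - (j - 1) = 1 := by omega
  rw [h2, pow_one] at h1
  have h3 : (Polynomial.X ^ 2 - Polynomial.X : Polynomial ℝ).eval x = 0 := by simpa using hx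
  have := Polynomial.eval_eq_zero_of_dvd_of_eval_eq_zero h1 h3
  rw [this, mul_zero]

theorem IP_zero (j : ℕ) : (IP j).eval 0 = 0 := by
  by_cases h : j = 0
  · subst h; simp [IP]
  · exact IP_root j h 0 (by simp)

noncomputable def legBas (σ : ℕ) : Bas σ where
  P k c := (LP k).eval c
  I k c := (IP k).eval c
  hP k := (LP k).continuous
  hI k := (IP k).continuous
  P0 c := by simp [LP]
  I0 c := by simp [IP]
  I1 k hk := IP_root k (by simpa using hk) 1 (by simp)
  intP k hk := by
    have := intervalIntegral.integral_eq_sub_of_hasDerivAt (a := 0) (b := 1)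
      (f := fun c => (IP k).eval c) (f' := fun c => (LP k).eval c)
      (fun c _ => by rw [← IP_deriv]; exact (IP k).hasDerivAt c)
      ((LP k).continuous.intervalIntegrable _ _)
    rw [this, IP_root k (by simpa using hk) 1 (by simp), IP_zero, sub_zero]

end Leg

open MeasureTheory Matrix Set
open scoped ContDiff Topology
open Asymptotics Filter

section MkTraj
variable {V L : Type*} [NormedAddCommGroup V] [NormedSpace ℝ V]
  [NormedAddCommGroup L] [NormedSpace ℝ L]
variable [FiniteDimensional ℝ V] [FiniteDimensional ℝ L]

theorem CSys.Psi_lin (S : CSys V L) (x y : V) (a : L) :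
    S.Psi (x, y, a) = S.Psi (x, y, 0) - S.A x a := by
  simp only [CSys.Psi, CSys.A, CSys.F, ContinuousLinearMap.comp_apply, map_add, map_zero]
  abel

theorem mkTraj (S : CSys V L) {T : ℝ} (hT : 0 < T) (q p : ℝ → V) (lam : ℝ → L)
    (dq : ∀ t ∈ Icc (0 : ℝ) T, HasDerivAt q (S.Mi (p t)) t)
    (dp : ∀ t ∈ Icc (0 : ℝ) T, HasDerivAt p (-(S.F (q t, lam t))) t)
    (con : ∀ t ∈ Icc (0 : ℝ) T, S.g (q t) = 0)
    (hu : ∀ t ∈ Icc (0 : ℝ) T, IsUnit (S.A (q t)))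
    (mult : ∀ t ∈ Icc (0 : ℝ) T, S.Psi (q t, p t, lam t) = 0) :
    ∃ Y : Traj S T, Y.q = q ∧ Y.p = p ∧ Y.lam = lam := by
  have : CompleteSpace L := FiniteDimensional.complete ℝ L
  let N : ℝ → L →L[ℝ] L := fun t => Ring.inverse (S.A (q t))
  have hN : ∀ t ∈ Icc (0 : ℝ) T, N t * S.A (q t) = 1 := fun t ht =>
    Ring.inverse_mul_cancel _ (hu t ht)
  have hN' : ∀ t ∈ Icc (0 : ℝ) T, S.A (q t) * N t = 1 := fun t ht =>
    Ring.mul_inverse_cancel _ (hu t ht)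
  have cq : ContinuousOn q (Icc 0 T) := fun t ht => (dq t ht).continuousAt.continuousWithinAt
  have cp : ContinuousOn p (Icc 0 T) := fun t ht => (dp t ht).continuousAt.continuousWithinAt
  have cN : ContinuousOn N (Icc 0 T) := by
    intro t ht
    obtain ⟨u, hu'⟩ := hu t ht
    have h1 : ContinuousAt Ring.inverse (S.A (q t)) := by
      rw [← hu']; exact NormedRing.inverse_continuousAt u
    have h2 : ContinuousAt (fun t => S.A (q t)) t :=
      S.hA.continuous.continuousAt.comp (dq t ht).continuousAt
    exact (h1.comp (f := fun t => S.A (q t)) h2).continuousWithinAt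
  have blq : BL T q := BL.of_deriv dq
    ((isCompact_Icc (a := (0 : ℝ)) (b := T)).exists_bound_of_continuousOn
      (S.Mi.continuous.comp_continuousOn cp))
  have hlam : ∀ t ∈ Icc (0 : ℝ) T, lam t = N t (S.Psi (q t, p t, 0)) := by
    intro t ht
    have h1 := mult t ht
    rw [S.Psi_lin, sub_eq_zero] at h1
    rw [h1]
    have := DFunLike.congr_fun (hN t ht) (lam t)
    exact this.symm
  have clam : ContinuousOn lam (Icc 0 T) := by
    refine ContinuousOn.congr ?_ hlam
    refine cN.clm_apply (S.hPsi.continuous.comp_continuousOn ?_)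
    exact cq.prodMk (cp.prodMk continuousOn_const)
  have blp : BL T p := BL.of_deriv dp
    ((isCompact_Icc (a := (0 : ℝ)) (b := T)).exists_bound_of_continuousOn
      (S.hF.continuous.comp_continuousOn (cq.prodMk clam)).neg)
  have blN : BL T N := by
    obtain ⟨K, hK⟩ := (isCompact_Icc (a := (0 : ℝ)) (b := T)).exists_bound_of_continuousOn cN
    obtain ⟨KA, hKA0, hKA⟩ := (blq.comp S.hA).nonneg
    refine ⟨max K (K * KA * K), fun t ht t' ht' => ⟨(hK t ht).trans (le_max_left _ _), ?_⟩⟩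
    have e : N t' - N t = N t' * ((S.A (q t) - S.A (q t')) * N t) := by
      rw [sub_mul, mul_sub, hN' t ht, ← mul_assoc, hN t' ht', mul_one, one_mul]
    have hK0 : 0 ≤ K := (norm_nonneg _).trans (hK t ht)
    calc ‖N t' - N t‖ ≤ ‖N t'‖ * (‖S.A (q t) - S.A (q t')‖ * ‖N t‖) := by
          rw [e]
          refine (norm_mul_le _ _).trans ?_
          gcongr
          exact norm_mul_le _ _
      _ ≤ K * ((KA * |t - t'|) * K) := by
          gcongr
          · exact hK t' ht'
          · exact (hKA t' ht' t ht).2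
          · exact hK t ht
      _ = K * KA * K * |t' - t| := by rw [abs_sub_comm]; ring
      _ ≤ _ := by gcongr; exact le_max_right _ _
  have blam : BL T lam := by
    have hΦ : ContDiff ℝ ∞ (fun z : (L →L[ℝ] L) × V × V => z.1 (S.Psi (z.2.1, z.2.2, 0))) := by
      have := S.hPsi
      fun_prop
    obtain ⟨K, hK⟩ := (blN.prodMk (blq.prodMk blp)).comp hΦ
    refine ⟨K, fun t ht t' ht' => ?_⟩
    rw [hlam t ht, hlam t' ht']
    exact hK t ht t' ht'
  refine ⟨⟨q, p, lam, N, dq, dp, con, ?_, hN, mult, blq, blp, blam, blN⟩, rfl, rfl, rfl⟩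
  intro t ht
  have h1 : HasDerivAt (fun t => S.g (q t)) (fderiv ℝ S.g (q t) (S.Mi (p t))) t :=
    ((S.hg.differentiable (by simp)) (q t)).hasFDerivAt.comp_hasDerivAt t (dq t ht)
  have h2 : HasDerivWithinAt (fun t => S.g (q t)) 0 (Icc 0 T) t :=
    (hasDerivWithinAt_const t (Icc 0 T) (0 : L)).congr con (con t ht)
  exact (uniqueDiffOn_Icc hT t ht).eq_deriv _ h1.hasDerivWithinAt h2

end MkTraj

section Conc
variable {m ν : ℕ}

theorem grad_smooth {U : (Fin m → ℝ) → ℝ} (hU : ContDiff ℝ ∞ U) : ContDiff ℝ ∞ (grad U) := by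
  have : ContDiff ℝ ∞ (fderiv ℝ U) := hU.fderiv_right (by simp)
  rw [contDiff_pi]
  intro i
  unfold grad
  fun_prop

theorem gradMat_smooth {g : (Fin m → ℝ) → (Fin ν → ℝ)} (hg : ContDiff ℝ ∞ g) (i : Fin m)
    (a : Fin ν) : ContDiff ℝ ∞ (fun q => gradMat g q i a) := by
  have h1 : ContDiff ℝ ∞ (fun x => g x a) := contDiff_pi.1 hg a
  have : ContDiff ℝ ∞ (fderiv ℝ (fun x => g x a)) := h1.fderiv_right (by simp)
  simp only [gradMat, Matrix.of_apply]
  fun_prop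

noncomputable def matCLM {m ν : ℕ} (A : Matrix (Fin m) (Fin ν) ℝ) : (Fin ν → ℝ) →L[ℝ] (Fin m → ℝ) :=
  ∑ i, ∑ a, A i a • (ContinuousLinearMap.proj (R := ℝ) (φ := fun _ : Fin ν => ℝ) a).smulRight
    (Pi.single i (1 : ℝ) : Fin m → ℝ)

theorem matCLM_apply (A : Matrix (Fin m) (Fin ν) ℝ) (x : Fin ν → ℝ) : matCLM A x = A *ᵥ x := by
  ext k
  simp [matCLM, Matrix.mulVec, dotProduct, Finset.sum_apply, Pi.single_apply]

noncomputable def mkS (M : Matrix (Fin m) (Fin m) ℝ) {U : (Fin m → ℝ) → ℝ} (hU : ContDiff ℝ ∞ U)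
    {g : (Fin m → ℝ) → (Fin ν → ℝ)} (hg : ContDiff ℝ ∞ g) : CSys (Fin m → ℝ) (Fin ν → ℝ) where
  g := g
  f := grad U
  G q := matCLM (gradMat g q)
  Mi := matCLM M⁻¹
  hg := hg
  hf := grad_smooth hU
  hG := by
    unfold matCLM
    refine ContDiff.sum fun i _ => ContDiff.sum fun a _ => ?_
    exact (gradMat_smooth hg i a).smul contDiff_const

theorem lin_expand {E : Type*} [NormedAddCommGroup E] [NormedSpace ℝ E]
    (A : (Fin m → ℝ) →L[ℝ] E) (v : Fin m → ℝ) : A v = ∑ i, v i • A (Pi.single i 1) := by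
  conv_lhs => rw [pi_eq_sum_univ' v]
  simp only [map_sum, map_smul]
  

theorem dg_apply {g : (Fin m → ℝ) → (Fin ν → ℝ)} (hg : ContDiff ℝ ∞ g) (q v : Fin m → ℝ) :
    fderiv ℝ g q v = (gradMat g q)ᵀ *ᵥ v := by
  have hd : DifferentiableAt ℝ g q := (hg.differentiable (by simp)) q
  ext a
  have e : fderiv ℝ (fun x => g x a) q = (ContinuousLinearMap.proj a).comp (fderiv ℝ g q) :=
    ((hasFDerivAt_pi'.1 hd.hasFDerivAt) a).fderiv
  simp only [Matrix.mulVec, dotProduct, gradMat, Matrix.transpose_apply, Matrix.of_apply, e,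
    ContinuousLinearMap.comp_apply, ContinuousLinearMap.proj_apply]
  rw [lin_expand (fderiv ℝ g q) v]
  simp [mul_comm]

theorem hess_apply {g : (Fin m → ℝ) → (Fin ν → ℝ)} (hg : ContDiff ℝ ∞ g) (q v w : Fin m → ℝ) :
    fderiv ℝ (fderiv ℝ g) q v w = hessVec g q v w := by
  have hd : ∀ x, DifferentiableAt ℝ g x := fun x => (hg.differentiable (by simp)) x
  have h1 : ContDiff ℝ ∞ (fderiv ℝ g) := hg.fderiv_right (by simp)
  have hd2 : HasFDerivAt (fderiv ℝ g) (fderiv ℝ (fderiv ℝ g) q) q :=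
    ((h1.differentiable (by simp)) q).hasFDerivAt
  ext a
  have e : ∀ x, fderiv ℝ (fun x => g x a) x w = fderiv ℝ g x w a := fun x => by
    rw [((hasFDerivAt_pi'.1 (hd x).hasFDerivAt) a).fderiv]; rfl
  simp only [hessVec, e]
  have h2 : HasFDerivAt (fun x => fderiv ℝ g x w) ((fderiv ℝ (fderiv ℝ g) q).flip w) q := by
    simpa using hd2.clm_apply (hasFDerivAt_const w q)
  rw [((hasFDerivAt_pi'.1 h2) a).fderiv]
  rfl

variable (M : Matrix (Fin m) (Fin m) ℝ) {U : (Fin m → ℝ) → ℝ} (hU : ContDiff ℝ ∞ U)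
    {g : (Fin m → ℝ) → (Fin ν → ℝ)} (hg : ContDiff ℝ ∞ g)

theorem mkS_A (q : Fin m → ℝ) :
    (mkS M hU hg).A q = matCLM ((gradMat g q)ᵀ * M⁻¹ * gradMat g q) := by
  ext1 x
  simp only [CSys.A, mkS, ContinuousLinearMap.comp_apply, matCLM_apply, dg_apply hg,
    Matrix.mulVec_mulVec, Matrix.mul_assoc]

theorem matCLM_mul {a b c : ℕ} (A : Matrix (Fin a) (Fin b) ℝ) (C : Matrix (Fin b) (Fin c) ℝ) :
    (matCLM A).comp (matCLM C) = matCLM (A * C) := by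
  ext1 x
  simp [matCLM_apply, Matrix.mulVec_mulVec]

theorem matCLM_one {a : ℕ} : matCLM (1 : Matrix (Fin a) (Fin a) ℝ) = ContinuousLinearMap.id ℝ _ := by
  ext1 x
  simp [matCLM_apply]

theorem matCLM_unit {a : ℕ} {A : Matrix (Fin a) (Fin a) ℝ} (h : IsUnit A) : IsUnit (matCLM A) := by
  obtain ⟨u, rfl⟩ := h
  refine ⟨⟨matCLM u.val, matCLM u.inv, ?_, ?_⟩, rfl⟩
  · exact (matCLM_mul _ _).trans (by rw [u.val_inv, matCLM_one]; rfl)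
  · exact (matCLM_mul _ _).trans (by rw [u.inv_val, matCLM_one]; rfl)

theorem mkS_Psi (q p : Fin m → ℝ) (h : IsUnit ((gradMat g q)ᵀ * M⁻¹ * gradMat g q)) :
    (mkS M hU hg).Psi (q, p, lagMult M U g q p) = 0 := by
  rw [CSys.Psi_lin, mkS_A, matCLM_apply, lagMult, Matrix.mulVec_mulVec,
    Matrix.mul_nonsing_inv _ ((Matrix.isUnit_iff_isUnit_det _).1 h), Matrix.one_mulVec]
  simp only [CSys.Psi, CSys.F, mkS, matCLM_apply, dg_apply hg, hess_apply hg, Matrix.mulVec_zero,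
    add_zero]
  abel

end Conc

open MeasureTheory Matrix Set
open scoped ContDiff Topology
open Asymptotics Filter

section PC
variable {m ν σ : ℕ}

noncomputable def pc (h : ℝ) (q0 : Fin m → ℝ) (a : Fin (σ + 1) → Fin m → ℝ) (t : ℝ) : Fin m → ℝ :=
  q0 + h • ∑ j : Fin (σ + 1), (IP j).eval (t / h) • a j

theorem pc_zero (h : ℝ) (q0 : Fin m → ℝ) (a : Fin (σ + 1) → Fin m → ℝ) : pc h q0 a 0 = q0 := by
  simp [pc, IP_zero]

theorem pc_c {h : ℝ} (hh : h ≠ 0) (q0 : Fin m → ℝ) (a : Fin (σ + 1) → Fin m → ℝ) (c : ℝ) :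
    pc h q0 a (c * h) = q0 + h • ∑ j : Fin (σ + 1), (IP j).eval c • a j := by
  rw [pc, mul_div_cancel_right₀ _ hh]

theorem pc_poly (h : ℝ) (q0 : Fin m → ℝ) (a : Fin (σ + 1) → Fin m → ℝ) (i : Fin m) :
    ∃ P : Polynomial ℝ, P.natDegree ≤ σ + 1 ∧ ∀ t, pc h q0 a t i = P.eval t := by
  refine ⟨Polynomial.C (q0 i) + Polynomial.C h * ∑ j : Fin (σ + 1),
    (IP j).comp (Polynomial.C h⁻¹ * Polynomial.X) * Polynomial.C (a j i), ?_, ?_⟩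
  · refine Polynomial.natDegree_add_le_of_degree_le (by simp) ?_
    refine (Polynomial.natDegree_C_mul_le _ _).trans ?_
    refine Polynomial.natDegree_sum_le_of_forall_le _ _ fun j _ => ?_
    refine (Polynomial.natDegree_mul_C_le _ _).trans ?_
    refine Polynomial.natDegree_comp_le.trans ?_
    have h1 := IP_deg j
    have h2 : (Polynomial.C h⁻¹ * Polynomial.X : Polynomial ℝ).natDegree ≤ 1 :=
      (Polynomial.natDegree_C_mul_le _ _).trans (by simp)
    have h3 := j.2
    calc _ ≤ ((j : ℕ) + 1) * 1 := Nat.mul_le_mul h1 h2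
      _ ≤ _ := by omega
  · intro t
    simp [pc, Polynomial.eval_finset_sum, Finset.sum_apply, div_eq_inv_mul]

theorem pcc_deriv (h : ℝ) (q0 : Fin m → ℝ) (a : Fin (σ + 1) → Fin m → ℝ) (c : ℝ) :
    HasDerivAt (fun c => q0 + h • ∑ j : Fin (σ + 1), (IP j).eval c • a j)
      (h • ∑ j : Fin (σ + 1), (LP j).eval c • a j) c := by
  refine HasDerivAt.const_add _ (HasDerivAt.const_smul h ?_)
  refine HasDerivAt.fun_sum fun j _ => ?_
  rw [← IP_deriv]
  exact ((IP j).hasDerivAt c).smul_const _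

theorem pc_deriv {h : ℝ} (hh : h ≠ 0) (q0 : Fin m → ℝ) (a : Fin (σ + 1) → Fin m → ℝ) (c : ℝ) :
    HasDerivAt (pc h q0 a) (∑ j : Fin (σ + 1), (LP j).eval c • a j) (c * h) := by
  have h1 : HasDerivAt (fun t : ℝ => t / h) (1 / h) (c * h) := (hasDerivAt_id _).div_const h
  have h2 := pcc_deriv h q0 a c
  have e : c = c * h / h := (mul_div_cancel_right₀ _ hh).symm
  rw [e] at h2
  have h3 := HasDerivAt.scomp (c * h) h2 h1
  rw [← e, smul_smul, one_div_mul_cancel hh, one_smul] at h3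
  exact h3

noncomputable def dotL (b : Fin m → ℝ) : (Fin m → ℝ) →L[ℝ] ℝ :=
  ∑ i, b i • ContinuousLinearMap.proj (R := ℝ) (φ := fun _ : Fin m => ℝ) i

theorem dotL_apply (b x : Fin m → ℝ) : dotL b x = b ⬝ᵥ x := by
  simp [dotL, dotProduct]

theorem dot_hasDerivAt {n : ℕ} {x y : ℝ → Fin n → ℝ} {x' y' : Fin n → ℝ} {c : ℝ}
    (hx : HasDerivAt x x' c) (hy : HasDerivAt y y' c) :
    HasDerivAt (fun c => x c ⬝ᵥ y c) (x' ⬝ᵥ y c + x c ⬝ᵥ y') c := by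
  simp only [dotProduct, ← Finset.sum_add_distrib]
  exact HasDerivAt.fun_sum fun i _ => ((hasDerivAt_pi.1 hx) i).mul ((hasDerivAt_pi.1 hy) i)

theorem gam_int {V L : Type*} [NormedAddCommGroup V] [NormedSpace ℝ V] [FiniteDimensional ℝ V]
    [NormedAddCommGroup L] [NormedSpace ℝ L] (S : CSys V L) (B : Bas σ) (p0 : V) (h : ℝ)
    (ζ : Fin (σ + 1) → V) (j : Fin (σ + 1)) :
    S.gam B p0 h ζ j = S.Mi (∫ c in (0:ℝ)..1, B.P j c • (p0 + h • ∑ k, B.I k c • ζ k)) := by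
  have : CompleteSpace V := FiniteDimensional.complete ℝ V
  have hP := B.hP
  have hI := B.hI
  rw [CSys.gam]
  congr 1
  have e : ∀ c, B.P j c • (p0 + h • ∑ k, B.I k c • ζ k) =
      B.P j c • p0 + h • ∑ k, (B.P j c * B.I k c) • ζ k := by
    intro c
    rw [smul_add, smul_comm, Finset.smul_sum]
    simp only [smul_smul]
  simp only [e]
  rw [intervalIntegral.integral_add, intervalIntegral.integral_smul_const, B.intP_eq,
    intervalIntegral.integral_smul, intervalIntegral.integral_finset_sum]
  · simp only [intervalIntegral.integral_smul_const, Bas.X]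
  · intro k _
    exact Continuous.intervalIntegrable (by fun_prop) _ _
  · exact Continuous.intervalIntegrable (by fun_prop) _ _
  · exact Continuous.intervalIntegrable (by fun_prop) _ _

end PC

section Fin
variable {m ν σ : ℕ}
variable (M : Matrix (Fin m) (Fin m) ℝ) {U : (Fin m → ℝ) → ℝ} (hU : ContDiff ℝ ∞ U)
    {g : (Fin m → ℝ) → (Fin ν → ℝ)} (hg : ContDiff ℝ ∞ g)

theorem grad_dot {U : (Fin m → ℝ) → ℝ} (q v : Fin m → ℝ) : fderiv ℝ U q v = grad U q ⬝ᵥ v := by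
  rw [lin_expand]
  simp [dotProduct, grad, mul_comm]

theorem energy (hM : M⁻¹ᵀ = M⁻¹) (q0 p0 : Fin m → ℝ) (h : ℝ) (ζ : Fin (σ + 1) → Fin m → ℝ)
    (lam : Fin ν → ℝ) (hg0 : g q0 = 0)
    (st : (mkS M hU hg).IsStep (legBas σ) q0 p0 h ζ lam) :
    Ham M U ((mkS M hU hg).uu (legBas σ) q0 p0 h ζ 1) (p0 + h • ζ 0) = Ham M U q0 p0 := by
  set S := mkS M hU hg with hS
  set B := legBas σ with hB
  obtain ⟨hz, hg1⟩ := st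
  set γ := S.gam B p0 h ζ with hγ
  have hMi : ∀ x, S.Mi x = M⁻¹ *ᵥ x := fun x => matCLM_apply _ _
  have hF : ∀ x, S.F (x, lam) = grad U x + gradMat g x *ᵥ lam := fun x => by
    rw [CSys.F]
    congr 1
    exact matCLM_apply _ _
  have hSg : S.g = g := rfl
  rw [hSg] at hg1
  have hsym : ∀ x y : Fin m → ℝ, x ⬝ᵥ (M⁻¹ *ᵥ y) = y ⬝ᵥ (M⁻¹ *ᵥ x) := by
    intro x y
    rw [Matrix.dotProduct_mulVec, ← Matrix.mulVec_transpose, hM, dotProduct_comm]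
  let Vc : ℝ → Fin m → ℝ := fun c => p0 + h • ∑ k : Fin (σ + 1), (IP k).eval c • ζ k
  let Uc : ℝ → Fin m → ℝ := fun c => q0 + h • ∑ k : Fin (σ + 1), (IP k).eval c • γ k
  have hUc : ∀ c, S.uu B q0 p0 h ζ c = Uc c := fun c => rfl
  have cV : Continuous Vc := by
    have := fun k : Fin (σ + 1) => (IP k).continuous
    fun_prop
  have cU : Continuous Uc := by
    have := fun k : Fin (σ + 1) => (IP k).continuous
    fun_prop
  have cF : Continuous fun c => S.F (Uc c, lam) := S.hF.continuous.comp (cU.prodMk continuous_const)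
  let K : ℝ → ℝ := fun c => (1 / 2) * (Vc c ⬝ᵥ (M⁻¹ *ᵥ Vc c)) + U (Uc c) + lam ⬝ᵥ g (Uc c)
  let K' : ℝ → ℝ := fun c => h * ∑ k : Fin (σ + 1),
    (dotL (ζ k) (S.Mi ((LP k).eval c • Vc c)) + dotL (γ k) ((LP k).eval c • S.F (Uc c, lam)))
  have hK : ∀ c, HasDerivAt K (K' c) c := by
    intro c
    have dV : HasDerivAt Vc _ c := pcc_deriv h p0 ζ c
    have dU : HasDerivAt Uc _ c := pcc_deriv h q0 γ c
    set V' := h • ∑ j : Fin (σ + 1), (LP j).eval c • ζ j with hV'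
    set U' := h • ∑ j : Fin (σ + 1), (LP j).eval c • γ j with hU'
    have dMV : HasDerivAt (fun c => M⁻¹ *ᵥ Vc c) (M⁻¹ *ᵥ V') c := by
      have := S.Mi.hasFDerivAt.comp_hasDerivAt c dV
      rw [hMi] at this
      exact this.congr_of_eventuallyEq (Eventually.of_forall fun c => (hMi _).symm)
    have d1 := (dot_hasDerivAt dV dMV).const_mul (1 / 2 : ℝ)
    have d2 : HasDerivAt (fun c => U (Uc c)) _ c :=
      ((hU.differentiable (by simp)) (Uc c)).hasFDerivAt.comp_hasDerivAt c dU
    have d3 : HasDerivAt (fun c => g (Uc c)) _ c :=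
      ((hg.differentiable (by simp)) (Uc c)).hasFDerivAt.comp_hasDerivAt c dU
    have d4 := dot_hasDerivAt (hasDerivAt_const c lam) d3
    refine ((d1.add d2).add d4).congr_deriv ?_
    rw [hsym (Vc c) V', grad_dot, dg_apply hg, zero_dotProduct, zero_add,
      Matrix.dotProduct_mulVec lam, Matrix.vecMul_transpose]
    have e1 : K' c = V' ⬝ᵥ (M⁻¹ *ᵥ Vc c) + S.F (Uc c, lam) ⬝ᵥ U' := by
      simp only [K', map_smul, dotL_apply, hMi, hV', hU', smul_dotProduct, dotProduct_smul,
        sum_dotProduct, dotProduct_sum, Finset.sum_add_distrib, smul_eq_mul, mul_add]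
      simp only [dotProduct_comm (γ _), Matrix.mulVec_smul, dotProduct_smul, smul_eq_mul]
    rw [e1, hF, add_dotProduct]
    ring
  have cK' : Continuous K' := by
    have := fun k : Fin (σ + 1) => (LP k).continuous
    fun_prop
  have hintK := intervalIntegral.integral_eq_sub_of_hasDerivAt (a := 0) (b := 1)
    (fun c _ => hK c) (cK'.intervalIntegrable _ _)
  have hzero : ∫ c in (0:ℝ)..1, K' c = 0 := by
    simp only [K']
    rw [intervalIntegral.integral_const_mul, intervalIntegral.integral_finset_sum]
    · rw [Finset.sum_eq_zero, mul_zero]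
      intro k _
      have cL := (LP k).continuous
      have i1 : IntervalIntegrable (fun c => (LP k).eval c • Vc c) volume 0 1 :=
        (cL.smul cV).intervalIntegrable _ _
      have i2 : IntervalIntegrable (fun c => (LP k).eval c • S.F (Uc c, lam)) volume 0 1 :=
        (cL.smul cF).intervalIntegrable _ _
      rw [intervalIntegral.integral_add]
      · have e1 := ((dotL (ζ k)).comp S.Mi).intervalIntegral_comp_comm i1
        have e2 := (dotL (γ k)).intervalIntegral_comp_comm i2
        simp only [ContinuousLinearMap.comp_apply] at e1
        rw [e1, e2]
        have e3 : S.Mi (∫ c in (0:ℝ)..1, (LP k).eval c • Vc c) = γ k := (gam_int S B p0 h ζ k).symm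
        have e4 : ζ k = -∫ c in (0:ℝ)..1, (LP k).eval c • S.F (Uc c, lam) := congrFun hz k
        rw [e3]
        rw [neg_eq_iff_eq_neg.symm] at e4
        rw [← e4, map_neg, dotL_apply, dotL_apply, dotProduct_comm, add_neg_cancel]
      · exact Continuous.intervalIntegrable (by fun_prop) _ _
      · exact Continuous.intervalIntegrable (by fun_prop) _ _
    · intro k _
      have cL := (LP k).continuous
      exact Continuous.intervalIntegrable (by fun_prop) _ _
  rw [hzero] at hintK
  have hV1 : Vc 1 = p0 + h • ζ 0 := by
    simp only [Vc]
    congr 2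
    rw [Finset.sum_eq_single 0]
    · simp [IP]
    · intro k _ hk
      rw [IP_root k (by simpa using hk) 1 (by simp), zero_smul]
    · simp
  have hV0 : Vc 0 = p0 := by simp [Vc, IP_zero]
  have hU0 : Uc 0 = q0 := by simp [Uc, IP_zero]
  have hU1 : g (Uc 1) = 0 := hg1
  have hK01 : K 1 = K 0 := by linarith
  simp only [K, hU0, hV0, hU1, hg0, hV1, dotProduct_zero, add_zero] at hK01
  rw [hUc, Ham, Ham]
  exact hK01

end Fin

open MeasureTheory Matrix Set
open scoped ContDiff Topology
open Asymptotics Filter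

section Fin
variable {m ν σ : ℕ}
variable (M : Matrix (Fin m) (Fin m) ℝ) {U : (Fin m → ℝ) → ℝ} (hU : ContDiff ℝ ∞ U)
    {g : (Fin m → ℝ) → (Fin ν → ℝ)} (hg : ContDiff ℝ ∞ g)

theorem gammaC_eq (p0 : Fin m → ℝ) {h : ℝ} (hh : h ≠ 0) (ζ : Fin (σ + 1) → Fin m → ℝ)
    (k : Fin (σ + 1)) :
    gammaC M h (pc h p0 ζ) k = (mkS M hU hg).gam (legBas σ) p0 h ζ k := by
  rw [gam_int, gammaC]
  simp only [pc_c hh, ← LP_eval]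
  exact (matCLM_apply _ _).symm

theorem psi_rho_eq (q0 p0 : Fin m → ℝ) {h : ℝ} (hh : h ≠ 0) (ζ : Fin (σ + 1) → Fin m → ℝ)
    (lam : Fin ν → ℝ) (st : (mkS M hU hg).IsStep (legBas σ) q0 p0 h ζ lam) (k : Fin (σ + 1)) :
    psiC U h (pc h q0 ((mkS M hU hg).gam (legBas σ) p0 h ζ)) k +
      rhoC g h (pc h q0 ((mkS M hU hg).gam (legBas σ) p0 h ζ)) k *ᵥ lam = -ζ k := by
  set S := mkS M hU hg with hS
  set u := pc h q0 (S.gam (legBas σ) p0 h ζ) with hu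
  have hu' : ∀ c, S.uu (legBas σ) q0 p0 h ζ c = u (c * h) := fun c => by
    rw [hu, pc_c hh]; rfl
  have hcu : Continuous fun c => u (c * h) := by
    have := S.uu_cont (legBas σ) q0 p0 h ζ
    exact this.congr hu'
  have cL := (LP k).continuous
  have cg : Continuous fun c => grad U (u (c * h)) := (grad_smooth hU).continuous.comp hcu
  have cG : ∀ i a, Continuous fun c => gradMat g (u (c * h)) i a := fun i a =>
    (gradMat_smooth hg i a).continuous.comp hcu
  have hF : ∀ x, S.F (x, lam) = grad U x + gradMat g x *ᵥ lam := fun x => by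
    rw [CSys.F]
    congr 1
    exact matCLM_apply _ _
  have e4 : ζ k = -∫ c in (0:ℝ)..1, (LP k).eval c • S.F (S.uu (legBas σ) q0 p0 h ζ c, lam) :=
    congrFun st.1 k
  have cGl : Continuous fun c => gradMat g (u (c * h)) *ᵥ lam := by
    refine continuous_pi fun i => ?_
    simp only [Matrix.mulVec, dotProduct]
    exact continuous_finset_sum _ fun a _ => (cG i a).mul continuous_const
  simp only [hu', hF, smul_add] at e4
  have i1 : IntervalIntegrable (fun c => (LP k).eval c • grad U (u (c * h)))
      volume 0 1 := (cL.smul cg).intervalIntegrable _ _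
  have i2 : IntervalIntegrable (fun c => (LP k).eval c • (gradMat g (u (c * h)) *ᵥ lam))
      volume 0 1 := (cL.smul cGl).intervalIntegrable _ _
  rw [intervalIntegral.integral_add i1 i2] at e4
  rw [e4, neg_neg, psiC]
  simp only [← LP_eval]
  congr 1
  ext i
  have e5 := (ContinuousLinearMap.proj (R := ℝ) (φ := fun _ : Fin m => ℝ)
    i).intervalIntegral_comp_comm i2
  simp only [ContinuousLinearMap.proj_apply] at e5
  rw [← e5]
  simp only [Matrix.mulVec, dotProduct, rhoC, Matrix.of_apply, Pi.smul_apply, smul_eq_mul,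
    Finset.mul_sum, ← LP_eval]
  rw [intervalIntegral.integral_finset_sum]
  · refine Finset.sum_congr rfl fun a _ => ?_
    rw [← intervalIntegral.integral_mul_const]
    simp only [mul_assoc]
  · intro a _
    exact (cL.mul ((cG i a).mul continuous_const)).intervalIntegrable _ _

end Fin

theorem stmt14 {m ν : ℕ} (hmn : ν < m)
    (M : Matrix (Fin m) (Fin m) ℝ) (hM : M.PosDef)
    (U : (Fin m → ℝ) → ℝ) (hU : ∀ x, AnalyticAt ℝ U x)
    (g : (Fin m → ℝ) → (Fin ν → ℝ)) (hg : ∀ x, AnalyticAt ℝ g x)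
    (s : ℕ) (hs : 1 ≤ s)
    (T : ℝ) (hT : 0 < T)
    (q p : ℝ → Fin m → ℝ)
    (hq : ∀ t ∈ Set.Icc (0:ℝ) T, HasDerivAt q (M⁻¹ *ᵥ p t) t)
    (hp : ∀ t ∈ Set.Icc (0:ℝ) T,
      HasDerivAt p (-(grad U (q t) + gradMat g (q t) *ᵥ lagMult M U g (q t) (p t))) t)
    (hcon : ∀ t ∈ Set.Icc (0:ℝ) T, g (q t) = 0)
    (hg0 : g (q 0) = 0)
    (hh0 : (gradMat g (q 0))ᵀ *ᵥ (M⁻¹ *ᵥ p 0) = 0)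
    (hns : ∀ t ∈ Set.Icc (0:ℝ) T,
      IsUnit ((gradMat g (q t))ᵀ * M⁻¹ * gradMat g (q t))) :
    ∃ h₀ > 0, ∃ C > 0, ∀ N : ℕ, 0 < N → T / (N : ℝ) ≤ h₀ →
      ∃ (qa pa : ℕ → Fin m → ℝ) (lam : ℕ → Fin ν → ℝ) (u v : ℕ → ℝ → Fin m → ℝ),
        qa 0 = q 0 ∧ pa 0 = p 0 ∧
        (∀ n < N,
          u n 0 = qa n ∧ v n 0 = pa n ∧
          (∀ i, ∃ P : Polynomial ℝ, P.natDegree ≤ s ∧ ∀ t, u n t i = P.eval t) ∧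
          (∀ i, ∃ P : Polynomial ℝ, P.natDegree ≤ s ∧ ∀ t, v n t i = P.eval t) ∧
          (∀ c ∈ Set.Icc (0:ℝ) 1,
            HasDerivAt (u n)
              (∑ j ∈ Finset.range s, shiftedLegendre j c • gammaC M (T / (N : ℝ)) (v n) j)
              (c * (T / (N : ℝ))) ∧
            HasDerivAt (v n)
              (-(∑ j ∈ Finset.range s, shiftedLegendre j c •
                (psiC U (T / (N : ℝ)) (u n) j + rhoC g (T / (N : ℝ)) (u n) j *ᵥ lam n)))
              (c * (T / (N : ℝ)))) ∧
          qa (n + 1) = u n (T / (N : ℝ)) ∧ pa (n + 1) = v n (T / (N : ℝ)) ∧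
          ‖lam n - lagMult M U g (q ((n : ℝ) * (T / (N : ℝ)))) (p ((n : ℝ) * (T / (N : ℝ))))‖ ≤
            C * (T / (N : ℝ))) ∧
        (∀ n ≤ N,
          g (qa n) = 0 ∧
          Ham M U (qa n) (pa n) = Ham M U (qa 0) (pa 0) ∧
          ‖qa n - q ((n : ℝ) * (T / (N : ℝ)))‖ ≤ C * (T / (N : ℝ)) ^ 2 ∧
          ‖pa n - p ((n : ℝ) * (T / (N : ℝ)))‖ ≤ C * (T / (N : ℝ)) ^ 2 ∧
          ‖(gradMat g (qa n))ᵀ *ᵥ (M⁻¹ *ᵥ pa n)‖ ≤ C * (T / (N : ℝ)) ^ 2) := by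
  obtain ⟨σ, rfl⟩ : ∃ σ, s = σ + 1 := ⟨s - 1, by omega⟩
  have sU : ContDiff ℝ ∞ U := contDiff_iff_contDiffAt.2 fun x => (hU x).contDiffAt
  have sg : ContDiff ℝ ∞ g := contDiff_iff_contDiffAt.2 fun x => (hg x).contDiffAt
  have hMs : M⁻¹ᵀ = M⁻¹ := by
    rw [Matrix.transpose_nonsing_inv]
    congr 1
    have := hM.isHermitian.eq
    rwa [Matrix.conjTranspose_eq_transpose_of_trivial] at this
  obtain ⟨Y, hYq, hYp, hYl⟩ := mkTraj (mkS M sU sg) hT q p (fun t => lagMult M U g (q t) (p t))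
    (fun t ht => by
      have := hq t ht
      rw [← matCLM_apply] at this
      exact this)
    (fun t ht => by
      have := hp t ht
      rw [← matCLM_apply] at this
      exact this)
    hcon (fun t ht => by rw [mkS_A]; exact matCLM_unit (hns t ht))
    (fun t ht => mkS_Psi M sU sg (q t) (p t) (hns t ht))
  obtain ⟨h₀, hh₀, C, hC, H⟩ := Y.glob (legBas σ) hT
  refine ⟨h₀, hh₀, C, hC, fun N hN hNh => ?_⟩
  obtain ⟨qa, pa, ζ, lam, hq0, hp0, hst, hbd⟩ := H N hN hNh
  rw [hYq] at hq0
  rw [hYp] at hp0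
  rw [hYq, hYp] at hbd
  rw [hYl] at hst
  have hh : T / (N : ℝ) ≠ 0 := by positivity
  set h := T / (N : ℝ) with hdef
  refine ⟨qa, pa, lam, fun n => pc h (qa n) ((mkS M sU sg).gam (legBas σ) (pa n) h (ζ n)),
    fun n => pc h (pa n) (ζ n), hq0, hp0, ?_, ?_⟩
  · intro n hn
    obtain ⟨st, e1, e2, e3⟩ := hst n hn
    refine ⟨pc_zero _ _ _, pc_zero _ _ _, pc_poly _ _ _, pc_poly _ _ _, ?_, ?_, ?_, e3⟩
    · intro c _
      refine ⟨(pc_deriv hh _ _ c).congr_deriv ?_, (pc_deriv hh _ _ c).congr_deriv ?_⟩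
      · rw [Finset.sum_range]
        refine Finset.sum_congr rfl fun k _ => ?_
        rw [gammaC_eq M sU sg _ hh, LP_eval]
      · rw [Finset.sum_range, ← Finset.sum_neg_distrib]
        refine Finset.sum_congr rfl fun k _ => ?_
        rw [psi_rho_eq M sU sg _ _ hh _ _ st, smul_neg, neg_neg, LP_eval]
    · rw [e1]
      have := pc_c hh (qa n) ((mkS M sU sg).gam (legBas σ) (pa n) h (ζ n)) 1
      rw [one_mul] at this
      exact this.symm
    · rw [e2]
      have := pc_c hh (pa n) (ζ n) 1
      rw [one_mul] at this
      simp only [this]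
      congr 2
      rw [Finset.sum_eq_single 0]
      · simp [IP]
      · intro k _ hk
        rw [IP_root k (by simpa using hk) 1 (by simp), zero_smul]
      · simp
  · have hen : ∀ n ≤ N, Ham M U (qa n) (pa n) = Ham M U (qa 0) (pa 0) := by
      intro n
      induction n with
      | zero => intro _; rfl
      | succ n ih =>
        intro hn
        obtain ⟨st, e1, e2, e3⟩ := hst n (by omega)
        rw [← ih (by omega), e1, e2]
        exact energy M sU sg hMs _ _ _ _ _ (hbd n (by omega)).1 st
    intro n hn
    obtain ⟨b1, b2, b3, b4⟩ := hbd n hn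
    refine ⟨b1, hen n hn, b2, b3, ?_⟩
    have e : fderiv ℝ (mkS M sU sg).g (qa n) ((mkS M sU sg).Mi (pa n)) =
        (gradMat g (qa n))ᵀ *ᵥ (M⁻¹ *ᵥ pa n) := by
      rw [← matCLM_apply M⁻¹]
      exact dg_apply sg _ _
    rw [← e]
    exact b4
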